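/- arXiv:math/0502271 — 2 statements merged into one kernel-verified Lean document; each statement's English description precedes it below -/
import Mathlib

section
/- Let (W,S) be a Coxeter system satisfying conditions (0)–(3) of the main theorem, and let φ: W → W' be an isomorphism onto a Coxeter group with Coxeter system (W',S'). Then (W',S') also satisfies the corresponding conditions (0')–(3'): even orders m'(s',t') lie in {2} ∪ 4ℕ; pairs with odd order are maximal spherical subsets; no three-element subset has two odd-order consecutive pairs; and each odd pair meets at most two maximal spherical subsets. -/
open Subgroup

/-- `S` is a Coxeter generating set for the group `W`: there is a Coxeter matrix on `S` and a
Coxeter system on `W` whose simple reflections are exactly the elements of `S`. -/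
def IsCoxGenSet {W : Type*} [Group W] (S : Set W) : Prop :=
  S.Finite ∧ ∃ (M : CoxeterMatrix S) (cs : CoxeterSystem M W), ∀ s : S, cs.simple s = (s : W)

/-- `T` is a spherical subset of the generating set `S`: the parabolic subgroup `W_T` is finite. -/
def IsSpherical {W : Type*} [Group W] (S T : Set W) : Prop :=
  T ⊆ S ∧ ((Subgroup.closure T : Subgroup W) : Set W).Finite

/-- `T` is a maximal spherical subset of `S`. -/
def IsMaxSpherical {W : Type*} [Group W] (S T : Set W) : Prop :=
  IsSpherical S T ∧ ∀ U : Set W, IsSpherical S U → T ⊆ U → U = T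

/-- `T` is independent: all pairwise orders `m(s,t)` equal `2`. -/
def IsIndep {W : Type*} [Group W] (T : Set W) : Prop :=
  ∀ s ∈ T, ∀ t ∈ T, s ≠ t → orderOf (s * t) = 2

/-- `T` is a maximal independent subset of `Sb`. -/
def IsMaxIndep {W : Type*} [Group W] (Sb T : Set W) : Prop :=
  IsIndep T ∧ T ⊆ Sb ∧ ∀ U : Set W, IsIndep U → U ⊆ Sb → T ⊆ U → U = T

/-- all pairwise orders lie in `{2} ∪ 4ℕ` (with `orderOf = 0` meaning `∞`). -/
def IsStrongEvenSet {W : Type*} [Group W] (T : Set W) : Prop :=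
  ∀ s ∈ T, ∀ t ∈ T, s ≠ t → (orderOf (s * t) = 2 ∨ 4 ∣ orderOf (s * t))

/-- all pairwise orders are even (with `orderOf = 0` meaning `∞`). -/
def IsEvenSet {W : Type*} [Group W] (T : Set W) : Prop :=
  ∀ s ∈ T, ∀ t ∈ T, s ≠ t → Even (orderOf (s * t))

/-- `S̄`: the union of all maximal spherical subsets `T` of `S` with `(W_T, T)` strong even. -/
def Sbar {W : Type*} [Group W] (S : Set W) : Set W :=
  ⋃₀ {T | IsMaxSpherical S T ∧ IsStrongEvenSet T}

/-- Condition (0): even orders lie in `{2} ∪ 4ℕ`. -/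
def Cond0 {W : Type*} [Group W] (S : Set W) : Prop :=
  ∀ s ∈ S, ∀ t ∈ S, s ≠ t → Even (orderOf (s * t)) →
    (orderOf (s * t) = 2 ∨ 4 ∣ orderOf (s * t))

/-- Condition (1): odd-order pairs are maximal spherical subsets. -/
def Cond1 {W : Type*} [Group W] (S : Set W) : Prop :=
  ∀ s ∈ S, ∀ t ∈ S, s ≠ t → Odd (orderOf (s * t)) → IsMaxSpherical S {s, t}

/-- Condition (2): no three-element subset `{s,t,u}` with `m(s,t)`, `m(t,u)` both odd. -/
def Cond2 {W : Type*} [Group W] (S : Set W) : Prop :=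
  ¬ ∃ s ∈ S, ∃ t ∈ S, ∃ u ∈ S, s ≠ t ∧ t ≠ u ∧ s ≠ u ∧
    Odd (orderOf (s * t)) ∧ Odd (orderOf (t * u))

/-- Condition (3): each odd pair meets at most two maximal spherical subsets. -/
def Cond3 {W : Type*} [Group W] (S : Set W) : Prop :=
  ∀ s ∈ S, ∀ t ∈ S, s ≠ t → Odd (orderOf (s * t)) →
    ∀ T₁ T₂ T₃ : Set W,
      (IsMaxSpherical S T₁ ∧ (T₁ ∩ {s, t}).Nonempty) →
      (IsMaxSpherical S T₂ ∧ (T₂ ∩ {s, t}).Nonempty) →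
      (IsMaxSpherical S T₃ ∧ (T₃ ∩ {s, t}).Nonempty) →
      T₁ = T₂ ∨ T₁ = T₃ ∨ T₂ = T₃

/-- Conditions (0)–(3) of the main theorem. -/
def Conds {W : Type*} [Group W] (S : Set W) : Prop :=
  Cond0 S ∧ Cond1 S ∧ Cond2 S ∧ Cond3 S

/-- `A τ A'`: equality of images in the abelianization of `W'`:
`π'(φ(W_A)) = π'(W'_{A'})`. -/
def Tau {W W' : Type*} [Group W] [Group W'] (φ : W →* W') (A : Set W) (A' : Set W') : Prop :=
  Subgroup.map ((Abelianization.of).comp φ) (Subgroup.closure A) =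
  Subgroup.map Abelianization.of (Subgroup.closure A')

namespace CoxRep

set_option linter.unusedSectionVars false
set_option linter.unusedSimpArgs false

open CoxeterSystem Real

variable {B : Type*} [Fintype B] [DecidableEq B] (M : CoxeterMatrix B)

/-- the Gram coefficients -/
noncomputable def kk (i j : B) : ℝ := -cos (π / M i j)

/-- the simple root -/
def ee (i : B) : B → ℝ := Pi.single i 1

/-- twice the bilinear form against a simple root -/
noncomputable def ff (i : B) : (B → ℝ) →ₗ[ℝ] ℝ :=
  ∑ j, (2 * kk M i j) • LinearMap.proj j

/-- simple reflection -/
noncomputable def sg (i : B) : Module.End ℝ (B → ℝ) :=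
  LinearMap.id - (ff M i).smulRight (ee i)

lemma sg_apply (i : B) (v : B → ℝ) : sg M i v = v - ff M i v • ee i := rfl

lemma ff_apply (i : B) (v : B → ℝ) : ff M i v = ∑ j, 2 * kk M i j * v j := by
  simp [ff]

lemma ff_ee (i j : B) : ff M i (ee j) = 2 * kk M i j := by
  simp [ff_apply, ee, Pi.single_apply]

lemma kk_self (i : B) : kk M i i = 1 := by simp [kk]

lemma kk_symm (i j : B) : kk M i j = kk M j i := by simp [kk, M.symmetric i j]

lemma kk_nonpos {i j : B} (h : i ≠ j) : kk M i j ≤ 0 := by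
  have h1 := M.off_diagonal i j h
  unfold kk
  rw [neg_nonpos]
  apply cos_nonneg_of_neg_pi_div_two_le_of_le
  · have : 0 ≤ π / M i j := by positivity
    linarith [pi_pos]
  · rcases Nat.eq_zero_or_pos (M i j) with h0 | h0
    · simp [h0]; positivity
    · have : (2 : ℝ) ≤ M i j := by exact_mod_cast (by omega : 2 ≤ M i j)
      gcongr

lemma sg_ee_self (i : B) : sg M i (ee i) = - ee i := by
  rw [sg_apply, ff_ee, kk_self]; module

lemma sg_ee (i j : B) : sg M i (ee j) = ee j - (2 * kk M i j) • ee i := by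
  rw [sg_apply, ff_ee]

lemma sg_sg (i : B) (v) : sg M i (sg M i v) = v := by
  rw [sg_apply, sg_apply, map_sub, map_smul, ff_ee, kk_self]
  simp only [smul_eq_mul]
  module

/-- Chebyshev-type sequence -/
def aq (p : ℝ) : ℕ → ℝ
  | 0 => 0
  | 1 => 1
  | (k+2) => p * aq p (k+1) - aq p k

lemma aq_sin (θ : ℝ) (k : ℕ) : aq (2 * cos θ) k * sin θ = sin (k * θ) ∧
    aq (2 * cos θ) (k+1) * sin θ = sin ((k+1) * θ) := by
  induction k with
  | zero => simp [aq]
  | succ k ih =>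
    refine ⟨by push_cast; exact ih.2, ?_⟩
    rw [show k + 1 + 1 = k + 2 from rfl, aq, sub_mul, ih.1, mul_assoc, ih.2]
    have e1 : ((k + 1 : ℕ) + 1 : ℝ) * θ = (k+1) * θ + θ := by push_cast; ring
    have e2 : (k : ℝ) * θ = (k+1) * θ - θ := by ring
    rw [e1, e2, sin_add, sin_sub]; ring

lemma aq_two (k : ℕ) : aq 2 k = k ∧ aq 2 (k+1) = k + 1 := by
  induction k with
  | zero => simp [aq]
  | succ k ih =>
    refine ⟨by push_cast; exact ih.2, ?_⟩
    rw [show k + 1 + 1 = k + 2 from rfl, aq, ih.1, ih.2]; push_cast; ring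

lemma sin_pi_div_pos {m : ℕ} (hm : 2 ≤ m) : 0 < sin (π / m) := by
  have hm' : (2 : ℝ) ≤ m := by exact_mod_cast hm
  apply sin_pos_of_pos_of_lt_pi
  · have := pi_pos; positivity
  · rw [div_lt_iff₀ (by linarith)]; nlinarith [pi_pos]

lemma aq_nonneg {m k : ℕ} (hm : m ≠ 1) (hk : m = 0 ∨ k ≤ m) : 0 ≤ aq (2 * cos (π / m)) k := by
  rcases Nat.eq_zero_or_pos m with h0 | h0
  · subst h0; simp [(aq_two k).1]
  · have hm2 : 2 ≤ m := by omega
    have hk : k ≤ m := by omega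
    have hs := sin_pi_div_pos hm2
    have h1 := (aq_sin (π / m) k).1
    have hm' : (0 : ℝ) < m := by exact_mod_cast h0
    have hk' : (k : ℝ) ≤ m := by exact_mod_cast hk
    have h2 : 0 ≤ sin (k * (π / m)) := by
      apply sin_nonneg_of_nonneg_of_le_pi
      · have := pi_pos; positivity
      · rw [mul_div_assoc', div_le_iff₀ hm']; nlinarith [pi_pos]
    rw [← h1] at h2
    exact nonneg_of_mul_nonneg_left h2 hs

lemma two_kk (i j : B) : -(2 * kk M i j) = 2 * cos (π / M i j) := by simp [kk]

lemma rot_pow (i j : B) (n : ℕ) :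
    ((sg M i * sg M j) ^ n) (ee i) =
      aq (-(2 * kk M i j)) (2*n+1) • ee i + aq (-(2 * kk M i j)) (2*n) • ee j ∧
    ((sg M i * sg M j) ^ n) (ee j) =
      -aq (-(2 * kk M i j)) (2*n) • ee i -
        (-(2 * kk M i j) * aq (-(2 * kk M i j)) (2*n) - aq (-(2 * kk M i j)) (2*n+1)) • ee j := by
  induction n with
  | zero => simp [aq]
  | succ n ih =>
    have e : 2 * (n+1) = 2*n+2 := by ring
    have e' : 2 * (n+1) + 1 = (2*n+1)+2 := by ring
    rw [pow_succ']
    simp only [Module.End.mul_apply, ih.1, ih.2, e, map_add, map_sub, map_smul, sg_ee,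
      kk_self, kk_symm M j i, aq]
    constructor <;> module

lemma fix_of_plane (i j : B) (A : Module.End ℝ (B → ℝ)) (hd : (kk M i j)^2 ≠ 1)
    (h1 : A (ee i) = ee i) (h2 : A (ee j) = ee j)
    (h3 : ∀ v, ff M i v = 0 → ff M j v = 0 → A v = v) : A = 1 := by
  refine LinearMap.ext fun v => ?_
  change A v = v
  set k := kk M i j with hk
  set a := ff M i v with ha
  set b := ff M j v with hb
  have hd' : 1 - k^2 ≠ 0 := fun h => hd (by linarith)
  set α := (a - k*b)/(2*(1-k^2)) with hα
  set β := (b - k*a)/(2*(1-k^2)) with hβ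
  have hu := h3 (v - α • ee i - β • ee j)
    (by
      simp only [map_sub, map_smul, ff_ee, kk_self, smul_eq_mul, ← ha, ← hk]
      rw [hα, hβ]; field_simp; ring)
    (by
      simp only [map_sub, map_smul, ff_ee, kk_self, smul_eq_mul, ← hb, kk_symm M j i, ← hk]
      rw [hα, hβ]; field_simp; ring)
  simp only [map_sub, map_smul, h1, h2] at hu
  simpa using hu

lemma liftable : M.IsLiftable (sg M) := by
  intro i j
  by_cases hij : i = j
  · subst hij
    refine LinearMap.ext fun v => ?_
    simp [sg_sg]
  rcases Nat.eq_zero_or_pos (M i j) with h0 | h0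
  · simp [h0]
  have hm : 2 ≤ M i j := by have := M.off_diagonal i j hij; omega
  have hs := sin_pi_div_pos hm
  have hm' : (M i j : ℝ) ≠ 0 := by positivity
  have hr := rot_pow M i j (M i j)
  have q1 : aq (-(2 * kk M i j)) (2 * M i j) = 0 := by
    have := (aq_sin (π / M i j) (2 * M i j)).1
    have e : ((2 * M i j : ℕ) : ℝ) * (π / M i j) = 2 * π := by push_cast; field_simp
    rw [e, sin_two_pi] at this
    rw [two_kk]
    exact (mul_eq_zero.1 this).resolve_right hs.ne'
  have q2 : aq (-(2 * kk M i j)) (2 * M i j + 1) = 1 := by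
    have := (aq_sin (π / M i j) (2 * M i j)).2
    have e : (((2 * M i j : ℕ) : ℝ) + 1) * (π / M i j) = π / M i j + 2 * π := by
      push_cast; field_simp; ring
    rw [e, sin_add_two_pi] at this
    rw [two_kk]
    exact mul_right_cancel₀ hs.ne' (by rw [this, one_mul])
  rw [q1, q2] at hr
  apply fix_of_plane M i j
  · have := sin_sq_add_cos_sq (π / M i j)
    unfold kk
    intro h
    nlinarith
  · simpa using hr.1
  · simpa using hr.2
  · intro v hi hj
    generalize M i j = n
    induction n with
    | zero => simp
    | succ n ih => rw [pow_succ', Module.End.mul_apply, ih]; simp [sg_apply, hi, hj]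

variable {M} {W : Type*} [Group W] (cs : CoxeterSystem M W)

/-- geometric representation -/
noncomputable def rho : W →* Module.End ℝ (B → ℝ) := cs.lift ⟨sg M, liftable M⟩

lemma rho_simple (i : B) : rho cs (cs.simple i) = sg M i := cs.lift_apply_simple _ _

lemma rho_mul (v w : W) (x) : rho cs (v * w) x = rho cs v (rho cs w x) := by
  rw [map_mul]; rfl

lemma rho_inv_apply (w : W) (x) : rho cs w⁻¹ (rho cs w x) = x := by
  rw [← rho_mul]; simp

lemma rho_apply_inv (w : W) (x) : rho cs w (rho cs w⁻¹ x) = x := by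
  rw [← rho_mul]; simp

lemma alt_apply (i j : B) (k : ℕ) :
    rho cs (cs.wordProd (alternatingWord i j k)) (ee i) =
      aq (-(2 * kk M i j)) (k+1) • ee (if Even k then i else j) +
      aq (-(2 * kk M i j)) k • ee (if Even k then j else i) := by
  induction k with
  | zero => simp [aq, alternatingWord]
  | succ k ih =>
    rw [alternatingWord_succ', wordProd_cons, rho_mul, ih, rho_simple]
    by_cases hk : Even k
    · have : ¬ Even (k+1) := by simpa [Nat.even_add_one] using hk
      simp only [hk, this, if_true, if_false, map_add, map_smul, sg_ee, kk_self, kk_symm M j i, aq]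
      module
    · have : Even (k+1) := by simpa [Nat.even_add_one] using hk
      simp only [hk, this, if_true, if_false, map_add, map_smul, sg_ee, kk_self, kk_symm M j i, aq]
      module

lemma ee_nonneg (i : B) : 0 ≤ (ee i : B → ℝ) := by
  intro j; simp only [ee, Pi.single_apply, Pi.zero_apply]; split_ifs <;> norm_num

theorem pos_of_not_descent (w : W) (i : B) (h : ¬ cs.IsRightDescent w i) :
    0 ≤ rho cs w (ee i) := by
  induction hn : cs.length w using Nat.strong_induction_on generalizing w i with
  | _ n IH =>
  by_cases hw : w = 1
  · subst hw; simpa using ee_nonneg i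
  obtain ⟨j, hj⟩ := cs.exists_rightDescent_of_ne_one hw
  have hij : i ≠ j := by rintro rfl; exact h hj
  -- maximal alternating suffix
  let P : ℕ → Prop := fun k => cs.length (w * (cs.wordProd (alternatingWord i j k))⁻¹) + k
    = cs.length w
  have hP1 : P 1 := by
    have := cs.isRightDescent_iff.1 hj
    simpa [P, alternatingWord] using this
  obtain ⟨k, hk, hkmax⟩ : ∃ k, P k ∧ ∀ l, P l → l ≤ k := by
    classical
    have hb : ∀ l, P l → l ≤ cs.length w := fun l hl => by simp only [P] at hl; omega
    refine ⟨Nat.findGreatest P (cs.length w), ?_, fun l hl => Nat.le_findGreatest (hb l hl) hl⟩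
    exact Nat.findGreatest_spec (P := P) (hb 1 hP1) hP1
  have hk1 : 1 ≤ k := hkmax 1 hP1
  set v := w * (cs.wordProd (alternatingWord i j k))⁻¹ with hv
  have hwv : w = v * cs.wordProd (alternatingWord i j k) := by simp [hv]
  have hlen : cs.length v + k = cs.length w := hk
  have hx : ¬ cs.IsRightDescent v (if Even k then i else j) := by
    intro hd
    have hd' := cs.isRightDescent_iff.1 hd
    obtain ⟨k', rfl⟩ : ∃ k', k = k' + 1 := ⟨k-1, by omega⟩
    have : w = (v * cs.simple (if Even (k'+1) then i else j)) *
        cs.wordProd (alternatingWord i j k') := by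
      rw [hwv, alternatingWord_succ', wordProd_cons]
      by_cases he : Even k' <;> simp [Nat.even_add_one, he, mul_assoc]
    have h1 := cs.length_mul_le (v * cs.simple (if Even (k'+1) then i else j))
      (cs.wordProd (alternatingWord i j k'))
    rw [← this] at h1
    have h2 := cs.length_wordProd_le (alternatingWord i j k')
    rw [length_alternatingWord] at h2
    omega
  have hy : ¬ cs.IsRightDescent v (if Even k then j else i) := by
    intro hd
    have hd' := cs.isRightDescent_iff.1 hd
    have : P (k+1) := by
      simp only [P]
      rw [alternatingWord_succ', wordProd_cons, mul_inv_rev, ← mul_assoc, ← hv, inv_simple]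
      omega
    have := hkmax _ this
    omega
  have hkm : M i j = 0 ∨ k + 1 ≤ M i j := by
    by_contra hcon
    push Not at hcon
    obtain ⟨hm0, hkm⟩ := hcon
    apply h
    -- split the alternating word
    have hsplit : ∀ d, ∃ u : List B, u.length = d ∧
        cs.wordProd (alternatingWord i j (M i j + d)) =
          cs.wordProd u * cs.wordProd (alternatingWord i j (M i j)) := by
      intro d
      induction d with
      | zero => exact ⟨[], by simp⟩
      | succ d ih =>
        obtain ⟨u, hu, hu'⟩ := ih
        refine ⟨(if Even (M i j + d) then j else i) :: u, by simpa using hu, ?_⟩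
        rw [← add_assoc, alternatingWord_succ', wordProd_cons, hu', wordProd_cons, mul_assoc]
    obtain ⟨u, hu, hu'⟩ := hsplit (k - M i j)
    rw [show M i j + (k - M i j) = k by omega, cs.wordProd_braidWord_eq, braidWord,
      M.symmetric j i] at hu'
    obtain ⟨m, hm⟩ : ∃ m, M i j = m + 1 := ⟨M i j - 1, by omega⟩
    rw [hm, alternatingWord_succ, wordProd_concat] at hu'
    have e : w * cs.simple i = v * (cs.wordProd u * cs.wordProd (alternatingWord i j m)) := by
      rw [hwv, hu']; simp [mul_assoc]
    have h1 := cs.length_mul_le v (cs.wordProd u * cs.wordProd (alternatingWord i j m))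
    have h2 := cs.length_mul_le (cs.wordProd u) (cs.wordProd (alternatingWord i j m))
    have h3 := cs.length_wordProd_le u
    have h4 := cs.length_wordProd_le (alternatingWord i j m)
    rw [length_alternatingWord] at h4
    unfold IsRightDescent
    rw [e]
    omega
  have hM := M.off_diagonal i j hij
  rw [hwv, rho_mul, alt_apply, map_add, map_smul, map_smul, two_kk]
  have n1 := aq_nonneg (m := M i j) (k := k+1) hM (by omega)
  have n2 := aq_nonneg (m := M i j) (k := k) hM (by omega)
  have p1 := IH (cs.length v) (by omega) v _ hx rfl
  have p2 := IH (cs.length v) (by omega) v _ hy rfl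
  exact add_nonneg (smul_nonneg n1 p1) (smul_nonneg n2 p2)

lemma neg_of_descent (w : W) (i : B) (h : cs.IsRightDescent w i) :
    rho cs w (ee i) ≤ 0 := by
  have := pos_of_not_descent cs (w * cs.simple i) i
    (cs.isRightDescent_iff_not_isRightDescent_mul.1 h)
  rw [rho_mul, rho_simple, sg_ee_self, map_neg] at this
  exact neg_nonneg.1 this

lemma ee_ne_zero (i : B) : (ee i : B → ℝ) ≠ 0 := by
  intro h; have := congrFun h i; simp [ee] at this

theorem faithful (w : W) (h : rho cs w = 1) : w = 1 := by
  by_contra hw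
  obtain ⟨i, hi⟩ := cs.exists_rightDescent_of_ne_one hw
  have := neg_of_descent cs w i hi
  rw [h] at this
  exact ee_ne_zero i (le_antisymm this (ee_nonneg i))

end CoxRep
namespace CoxRep

open CoxeterSystem Real

set_option linter.unusedSectionVars false
set_option linter.unusedSimpArgs false

variable {B : Type*} [Fintype B] [DecidableEq B] {M : CoxeterMatrix B}
variable {W : Type*} [Group W] (cs : CoxeterSystem M W)

/-- roots -/
def Phi : Set (B → ℝ) := {α | ∃ w i, α = rho cs w (ee i)}

lemma ee_mem (i : B) : ee i ∈ Phi cs := ⟨1, i, by simp⟩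

lemma rho_mem {α} (h : α ∈ Phi cs) (w : W) : rho cs w α ∈ Phi cs := by
  obtain ⟨v, i, rfl⟩ := h
  exact ⟨w * v, i, by rw [rho_mul]⟩

lemma sg_mem {α} (h : α ∈ Phi cs) (i : B) : sg M i α ∈ Phi cs := by
  rw [← rho_simple cs]; exact rho_mem cs h _

lemma neg_mem {α} (h : α ∈ Phi cs) : -α ∈ Phi cs := by
  obtain ⟨v, i, rfl⟩ := h
  exact ⟨v * cs.simple i, i, by rw [rho_mul, rho_simple, sg_ee_self, map_neg]⟩

lemma sign {α} (h : α ∈ Phi cs) : 0 ≤ α ∨ α ≤ 0 := by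
  obtain ⟨v, i, rfl⟩ := h
  by_cases hd : cs.IsRightDescent v i
  · exact Or.inr (neg_of_descent cs v i hd)
  · exact Or.inl (pos_of_not_descent cs v i hd)

lemma root_ne {α} (h : α ∈ Phi cs) : α ≠ 0 := by
  obtain ⟨v, i, rfl⟩ := h
  intro h0
  have := rho_inv_apply cs v (ee i)
  rw [h0, map_zero] at this
  exact ee_ne_zero i this.symm

variable (M) in
/-- invariant form -/
noncomputable def GG : (B → ℝ) →ₗ[ℝ] (B → ℝ) →ₗ[ℝ] ℝ :=
  Matrix.toBilin' (Matrix.of fun i j => 2 * kk M i j)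

lemma GG_ee_left (i : B) (v) : GG M (ee i) v = ff M i v := by
  rw [GG, Matrix.toBilin'_apply, ff_apply, Finset.sum_eq_single i]
  · simp [ee]
  · intro b _ hb; simp [ee, Pi.single_apply, hb]
  · simp

lemma GG_ee_right (i : B) (v) : GG M v (ee i) = ff M i v := by
  rw [GG, Matrix.toBilin'_apply, ff_apply]
  refine Finset.sum_congr rfl fun j _ => ?_
  rw [Finset.sum_eq_single i]
  · simp [ee, kk_symm M j i]; ring
  · intro b _ hb; simp [ee, Pi.single_apply, hb]
  · simp

lemma GG_sg (i : B) (v) : GG M (sg M i v) (sg M i v) = GG M v v := by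
  simp only [sg_apply, map_sub, map_smul, LinearMap.sub_apply, LinearMap.smul_apply,
    GG_ee_left, GG_ee_right, ff_ee, kk_self, smul_eq_mul]
  ring

lemma GG_rho (w : W) : ∀ v, GG M (rho cs w v) (rho cs w v) = GG M v v := by
  refine cs.simple_induction_left (p := fun w => ∀ v, GG M (rho cs w v) (rho cs w v) = GG M v v)
    w (by simp) ?_
  intro w i ih v
  rw [rho_mul, rho_simple, GG_sg, ih]

lemma GG_root {α} (h : α ∈ Phi cs) : GG M α α = 2 := by
  obtain ⟨v, i, rfl⟩ := h
  rw [GG_rho, GG_ee_left, ff_ee, kk_self]; norm_num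

lemma simple_perm {α} (h : α ∈ Phi cs) (hp : 0 ≤ α) (i : B) (hne : α ≠ ee i) :
    0 ≤ sg M i α := by
  refine (sign cs (sg_mem cs h i)).resolve_right fun hn => hne ?_
  have hz : ∀ j, j ≠ i → α j = 0 := by
    intro j hj
    have h1 := hn j
    have h2 := hp j
    simp only [sg_apply, Pi.sub_apply, Pi.smul_apply, ee, Pi.single_apply, hj, if_false,
      Pi.zero_apply, smul_zero, sub_zero] at h1 h2
    linarith
  have he : α = α i • ee i := by
    ext j
    by_cases hj : j = i
    · subst hj; simp [ee]
    · simp [ee, Pi.single_apply, hj, hz j hj]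
  have hq := GG_root cs h
  rw [he] at hq
  simp only [map_smul, LinearMap.smul_apply, GG_ee_left, ff_ee, kk_self, smul_eq_mul] at hq
  have h0 : 0 ≤ α i := hp i
  have : α i = 1 := by nlinarith
  rw [he, this, one_smul]

/-- the height functional -/
noncomputable def cc : (B → ℝ) →ₗ[ℝ] ℝ := ∑ j, LinearMap.proj j

lemma cc_pos {α} (h : α ∈ Phi cs) (hp : 0 ≤ α) : 0 < cc α := by
  have e : cc α = ∑ j, α j := by simp [cc]
  rw [e]
  refine lt_of_le_of_ne (Finset.sum_nonneg fun j _ => hp j) fun h0 => root_ne cs h ?_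
  have := (Finset.sum_eq_zero_iff_of_nonneg (fun j _ => hp j)).1 h0.symm
  ext j; exact this j (Finset.mem_univ _)

/-- positive roots on which a functional is negative -/
def NN (x : (B → ℝ) →ₗ[ℝ] ℝ) : Set (B → ℝ) := {α | α ∈ Phi cs ∧ 0 ≤ α ∧ x α < 0}

/-- positive roots sent to negative -/
def NW (w : W) : Set (B → ℝ) := {α | α ∈ Phi cs ∧ 0 ≤ α ∧ rho cs w α ≤ 0}

lemma NW_finite (w : W) : (NW cs w).Finite := by
  refine cs.simple_induction_right (p := fun w => (NW cs w).Finite) w ?_ ?_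
  · convert Set.finite_empty
    ext α
    simp only [NW, Set.mem_setOf_eq, Set.mem_empty_iff_false, iff_false, map_one]
    rintro ⟨h, h1, h2⟩
    exact root_ne cs h (le_antisymm h2 h1)
  · intro w i hw
    refine ((hw.image (sg M i)).insert (ee i)).subset ?_
    rintro α ⟨h, h1, h2⟩
    by_cases hα : α = ee i
    · exact Or.inl hα
    · refine Or.inr ⟨sg M i α, ⟨sg_mem cs h i, simple_perm cs h h1 i hα, ?_⟩, sg_sg M i α⟩
      rwa [rho_mul, rho_simple] at h2

lemma exists_dominant (x : (B → ℝ) →ₗ[ℝ] ℝ) (hx : (NN cs x).Finite) :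
    ∃ w : W, ∀ i, 0 ≤ x (rho cs w (ee i)) := by
  induction hn : (NN cs x).ncard using Nat.strong_induction_on generalizing x with
  | _ n IH =>
  by_cases hd : ∀ i, 0 ≤ x (ee i)
  · exact ⟨1, by simpa using hd⟩
  push Not at hd
  obtain ⟨i, hi⟩ := hd
  have hsub : sg M i '' (NN cs (x ∘ₗ sg M i)) ⊆ NN cs x \ {ee i} := by
    rintro _ ⟨α, ⟨h, h1, h2⟩, rfl⟩
    have hne : α ≠ ee i := by
      rintro rfl
      rw [LinearMap.comp_apply, sg_ee_self, map_neg] at h2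
      linarith
    refine ⟨⟨sg_mem cs h i, simple_perm cs h h1 i hne, h2⟩, ?_⟩
    intro he
    have : α = - ee i := by rw [← sg_ee_self M, ← (show sg M i α = ee i from he), sg_sg]
    rw [this] at h1
    exact ee_ne_zero i (le_antisymm (by simpa using h1) (ee_nonneg i))
  have hinj : Function.Injective (sg M i) := fun a b hab => by
    rw [← sg_sg M i a, hab, sg_sg]
  have hmem : ee i ∈ NN cs x := ⟨ee_mem cs i, ee_nonneg i, hi⟩
  have hfin : (NN cs (x ∘ₗ sg M i)).Finite :=
    Set.Finite.of_finite_image (hx.sdiff.subset hsub) hinj.injOn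
  have hlt : (NN cs (x ∘ₗ sg M i)).ncard < n := by
    rw [← Set.ncard_image_of_injective _ hinj, ← hn]
    exact lt_of_le_of_lt (Set.ncard_le_ncard hsub hx.sdiff)
      (Set.ncard_sdiff_singleton_lt_of_mem hmem hx)
  obtain ⟨w, hw⟩ := IH _ hlt _ hfin rfl
  refine ⟨cs.simple i * w, fun j => ?_⟩
  rw [rho_mul, rho_simple]
  exact hw j

/-- standard parabolic -/
def par (T : Set B) : Subgroup W := Subgroup.closure (cs.simple '' T)

lemma dominant_unique (y : (B → ℝ) →ₗ[ℝ] ℝ) (hy : ∀ i, 0 ≤ y (ee i)) (w : W)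
    (hw : ∀ i, 0 ≤ y (rho cs w (ee i))) :
    (∀ v, y (rho cs w v) = y v) ∧ w ∈ par cs {i | y (ee i) = 0} := by
  induction hn : cs.length w using Nat.strong_induction_on generalizing w with
  | _ n IH =>
  by_cases h1 : w = 1
  · subst h1; exact ⟨by simp, one_mem _⟩
  obtain ⟨i, hi⟩ := cs.exists_rightDescent_of_ne_one h1
  have hneg := neg_of_descent cs w i hi
  have hmono : ∀ v : B → ℝ, 0 ≤ v → 0 ≤ y v := by
    intro v hv
    have : v = ∑ j, v j • ee j := by
      ext k; simp [ee, Finset.sum_apply, Pi.single_apply]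
    rw [this, map_sum]
    refine Finset.sum_nonneg fun j _ => ?_
    rw [map_smul]
    exact smul_nonneg (hv j) (hy j)
  have h0 : y (rho cs w (ee i)) = 0 := by
    refine le_antisymm ?_ (hw i)
    have := hmono _ (neg_nonneg.2 hneg)
    rw [map_neg] at this
    linarith
  have hstep : ∀ v, y (rho cs (w * cs.simple i) v) = y (rho cs w v) := by
    intro v
    rw [rho_mul, rho_simple, sg_apply, map_sub, map_sub, map_smul, map_smul, h0]
    simp
  have := IH (cs.length (w * cs.simple i)) (by rw [← hn]; exact hi) (w * cs.simple i)
    (fun j => by rw [hstep]; exact hw j) rfl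
  have hA : ∀ v, y (rho cs w v) = y v := fun v => by rw [← hstep, this.1]
  refine ⟨hA, ?_⟩
  have e : w = w * cs.simple i * cs.simple i := by simp
  rw [e]
  refine mul_mem this.2 (Subgroup.subset_closure ⟨i, ?_, rfl⟩)
  change y (ee i) = 0
  rw [← hA, h0]

lemma par_fix (y : (B → ℝ) →ₗ[ℝ] ℝ) (T : Set B) (hT : ∀ i ∈ T, y (ee i) = 0) (w : W)
    (hw : w ∈ par cs T) : ∀ v, y (rho cs w v) = y v := by
  induction hw using Subgroup.closure_induction with
  | mem x hx =>
    obtain ⟨i, hi, rfl⟩ := hx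
    intro v
    rw [rho_simple, sg_apply, map_sub, map_smul, hT i hi]; simp
  | one => simp
  | mul a b _ _ ha hb => intro v; rw [rho_mul, ha, hb]
  | inv a _ ha => intro v; rw [← ha, rho_apply_inv]

/-- finiteness of the stabilizer -/
lemma stab_finite (y : (B → ℝ) →ₗ[ℝ] ℝ) (hy : ∀ i, 0 ≤ y (ee i))
    (hf : {α | α ∈ Phi cs ∧ y α = 0}.Finite) : (par cs {i | y (ee i) = 0} : Set W).Finite := by
  set Z := {α | α ∈ Phi cs ∧ y α = 0} with hZ
  have : Finite Z := hf
  have hfix : ∀ w ∈ par cs {i | y (ee i) = 0}, ∀ v, y (rho cs w v) = y v :=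
    par_fix cs y _ (fun i hi => hi)
  let F : (par cs {i | y (ee i) = 0} : Set W) → (Z → Z) := fun w α =>
    ⟨rho cs w.1 α.1, rho_mem cs α.2.1 _, by
      rw [hfix w.1 w.2]; exact α.2.2⟩
  have hF : Function.Injective F := by
    rintro ⟨a, ha⟩ ⟨b, hb⟩ hab
    rw [Subtype.mk.injEq]
    by_contra hne
    have hg : b⁻¹ * a ≠ 1 := fun h => hne (by
      have := congrArg (b * ·) h; simpa using this)
    have hmem : b⁻¹ * a ∈ par cs {i | y (ee i) = 0} := mul_mem (inv_mem hb) ha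
    obtain ⟨i, hi⟩ := cs.exists_rightDescent_of_ne_one hg
    have hneg := neg_of_descent cs _ i hi
    have h1 := hfix _ hmem (ee i)
    have h0 : y (ee i) = 0 := by
      refine le_antisymm ?_ (hy i)
      rw [← h1]
      have hv : (rho cs (b⁻¹ * a) (ee i)) = ∑ j, (rho cs (b⁻¹ * a) (ee i)) j • ee j := by
        ext k; simp [ee, Finset.sum_apply, Pi.single_apply]
      rw [hv, map_sum]
      refine Finset.sum_nonpos fun j _ => ?_
      rw [map_smul]
      exact mul_nonpos_of_nonpos_of_nonneg (hneg j) (hy j)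
    have := congrArg Subtype.val (congrFun hab ⟨ee i, ee_mem cs i, h0⟩)
    change rho cs a (ee i) = rho cs b (ee i) at this
    rw [rho_mul, this, rho_inv_apply] at hneg
    exact ee_ne_zero i (le_antisymm hneg (ee_nonneg i))
  exact Finite.of_injective F hF

/-- averaged functional of a finite set -/
noncomputable def avg (H : Finset W) : (B → ℝ) →ₗ[ℝ] ℝ := ∑ h ∈ H, cc ∘ₗ rho cs h

lemma avg_apply (H : Finset W) (v) : avg cs H v = ∑ h ∈ H, cc (rho cs h v) := by
  simp [avg]

lemma avg_nonpos_finite (H : Finset W) (hH : H.Nonempty) :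
    {α | α ∈ Phi cs ∧ 0 ≤ α ∧ avg cs H α ≤ 0}.Finite := by
  refine (H.finite_toSet.biUnion (t := fun h => NW cs h) fun h _ => NW_finite cs h).subset ?_
  rintro α ⟨h, h1, h2⟩
  rw [avg_apply] at h2
  by_contra hcon
  simp only [Set.mem_iUnion, not_exists] at hcon
  refine absurd h2 (not_le.2 (Finset.sum_pos (fun g hg => ?_) hH))
  have hr := rho_mem cs h g
  refine cc_pos cs hr ((sign cs hr).resolve_right fun hn => hcon g (by simpa using hg) ⟨h, h1, hn⟩)

lemma avg_inv (H : Subgroup W) (hH : (H : Set W).Finite) (g : W) (hg : g ∈ H) (v) :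
    avg cs hH.toFinset (rho cs g v) = avg cs hH.toFinset v := by
  rw [avg_apply, avg_apply]
  refine Finset.sum_bij (fun h _ => h * g) ?_ ?_ ?_ ?_
  · intro a ha; simp only [Set.Finite.mem_toFinset, SetLike.mem_coe] at ha ⊢; exact mul_mem ha hg
  · intro a _ b _ hab; exact mul_right_cancel hab
  · intro b hb
    simp only [Set.Finite.mem_toFinset, SetLike.mem_coe] at hb
    exact ⟨b * g⁻¹, by simpa using mul_mem hb (inv_mem hg), by simp⟩
  · intro a _; rw [rho_mul]

theorem finite_conj (H : Subgroup W) (hH : (H : Set W).Finite) :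
    ∃ (w : W) (T : Set B), (par cs T : Set W).Finite ∧ ∀ h ∈ H, w⁻¹ * h * w ∈ par cs T := by
  set x := avg cs hH.toFinset with hx
  have hne : hH.toFinset.Nonempty := ⟨1, by simp⟩
  have hZ := avg_nonpos_finite cs hH.toFinset hne
  obtain ⟨w, hw⟩ := exists_dominant cs x (hZ.subset fun α h => ⟨h.1, h.2.1, h.2.2.le⟩)
  set y : (B → ℝ) →ₗ[ℝ] ℝ := x ∘ₗ rho cs w with hy
  have hy0 : ∀ i, 0 ≤ y (ee i) := hw
  refine ⟨w, {i | y (ee i) = 0}, stab_finite cs y hy0 ?_, ?_⟩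
  · have hinj : Function.Injective (rho cs w) := fun a b hab => by
      rw [← rho_inv_apply cs w a, hab, rho_inv_apply]
    refine Set.Finite.of_finite_image (f := rho cs w) ?_ hinj.injOn
    refine (hZ.union (hZ.image Neg.neg)).subset ?_
    rintro _ ⟨α, ⟨h, h0⟩, rfl⟩
    have hr := rho_mem cs h w
    have h0' : x (rho cs w α) = 0 := h0
    rcases sign cs hr with hp | hn
    · exact Or.inl ⟨hr, hp, h0'.le⟩
    · exact Or.inr ⟨-(rho cs w α), ⟨neg_mem cs hr, neg_nonneg.2 hn, by
        rw [map_neg, ← hx, h0']; simp⟩, by simp⟩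
  · intro h hh
    have key : ∀ v, y (rho cs (w⁻¹ * h * w) v) = y v := by
      intro v
      simp only [hy, LinearMap.comp_apply]
      rw [← rho_mul, show w * (w⁻¹ * h * w) = h * w by group, rho_mul, hx,
        avg_inv cs H hH h hh]
    exact (dominant_unique cs y hy0 _ fun i => by rw [key]; exact hy0 i).2

open Classical in
/-- functional cutting out the parabolic -/
noncomputable def yy (T : Set B) : (B → ℝ) →ₗ[ℝ] ℝ :=
  ∑ j, (if j ∈ T then (0:ℝ) else 1) • LinearMap.proj j

open Classical in
lemma yy_ee (T : Set B) (i : B) : yy T (ee i) = if i ∈ T then (0:ℝ) else 1 := by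
  simp only [yy, LinearMap.sum_apply, LinearMap.smul_apply, LinearMap.proj_apply, ee,
    Pi.single_apply, smul_eq_mul, mul_ite, mul_one, mul_zero, Finset.sum_ite_eq', Finset.mem_univ,
    if_true]

lemma yy_ee_nonneg (T : Set B) (i : B) : 0 ≤ yy T (ee i) := by
  rw [yy_ee]; split_ifs <;> norm_num

lemma yy_zero_set (T : Set B) : {i | yy T (ee i) = 0} = T := by
  ext i; simp [yy_ee]

lemma expand (v : B → ℝ) : v = ∑ j, v j • ee j := by
  ext k; simp [ee, Finset.sum_apply, Pi.single_apply]

/-- support of a positive vector -/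
lemma yy_eq_zero (T : Set B) (v : B → ℝ) (hv : 0 ≤ v) (h : yy T v = 0) : ∀ i ∉ T, v i = 0 := by
  intro i hi
  rw [expand v, map_sum] at h
  have h2 := (Finset.sum_eq_zero_iff_of_nonneg (fun j _ => by
    rw [map_smul]; exact smul_nonneg (hv j) (yy_ee_nonneg T j))).1 h i (Finset.mem_univ _)
  rw [map_smul, yy_ee, if_neg hi] at h2
  simpa using h2

/-- if the parabolic is finite there are finitely many positive roots supported on it -/
lemma supp_finite (T : Set B) (hT : (par cs T : Set W).Finite) :
    {α | α ∈ Phi cs ∧ 0 ≤ α ∧ ∀ i ∉ T, α i = 0}.Finite := by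
  have hne : hT.toFinset.Nonempty := ⟨1, by simp⟩
  refine (avg_nonpos_finite cs hT.toFinset hne).subset ?_
  rintro α ⟨h, h1, h2⟩
  refine ⟨h, h1, ?_⟩
  rw [expand α, map_sum]
  refine Finset.sum_nonpos fun j _ => ?_
  by_cases hj : j ∈ T
  · have hm : cs.simple j ∈ par cs T := Subgroup.subset_closure ⟨j, hj, rfl⟩
    have := avg_inv cs (par cs T) hT _ hm (ee j)
    rw [rho_simple, sg_ee_self, map_neg] at this
    have h0 : avg cs hT.toFinset (ee j) = 0 := by linarith
    rw [map_smul, h0]; simp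
  · rw [h2 j hj]; simp

theorem max_unique (T U : Set B) (hT : (par cs T : Set W).Finite)
    (hmax : ∀ s ∉ T, ¬ (par cs (insert s T) : Set W).Finite) (w : W)
    (hw : ∀ h ∈ par cs T, w⁻¹ * h * w ∈ par cs U) : T ⊆ U := by
  set x : (B → ℝ) →ₗ[ℝ] ℝ := yy U ∘ₗ rho cs w⁻¹ with hx
  have hxT : ∀ t ∈ T, x (ee t) = 0 := by
    intro t ht
    have hm := hw (cs.simple t) (Subgroup.subset_closure ⟨t, ht, rfl⟩)
    have := par_fix cs (yy U) U (fun i hi => by simp [yy_ee, hi]) _ hm (rho cs w⁻¹ (ee t))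
    rw [← rho_mul, show w⁻¹ * cs.simple t * w * w⁻¹ = w⁻¹ * cs.simple t by group, rho_mul,
      rho_simple, sg_ee_self, map_neg, map_neg] at this
    change yy U (rho cs w⁻¹ (ee t)) = 0
    linarith
  have hpos : ∀ v : B → ℝ, 0 ≤ v → 0 ≤ yy U v := by
    intro v hv
    rw [expand v, map_sum]
    exact Finset.sum_nonneg fun j _ => by
      rw [map_smul]; exact smul_nonneg (hv j) (yy_ee_nonneg U j)
  have hN : (NN cs x).Finite := by
    refine (NW_finite cs w⁻¹).subset ?_
    rintro α ⟨h, h1, h2⟩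
    refine ⟨h, h1, (sign cs (rho_mem cs h w⁻¹)).resolve_left fun hp => ?_⟩
    exact absurd (hpos _ hp) (not_le.2 h2)
  have hdom : ∀ s, 0 ≤ x (ee s) := by
    intro s
    by_contra hs
    push Not at hs
    have hsT : s ∉ T := fun h => by rw [hxT s h] at hs; exact lt_irrefl _ hs
    refine hmax s hsT ?_
    have hP : {α | α ∈ Phi cs ∧ 0 ≤ α ∧ yy (insert s T) α = 0}.Finite := by
      refine (hN.union (supp_finite cs T hT)).subset ?_
      rintro α ⟨h, h1, h2⟩
      have h3 := yy_eq_zero _ α h1 h2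
      have hxa : x α = α s * x (ee s) := by
        conv_lhs => rw [expand α, map_sum]
        rw [Finset.sum_eq_single s]
        · rw [map_smul, smul_eq_mul]
        · intro j _ hj
          by_cases hjT : j ∈ T
          · rw [map_smul, hxT j hjT, smul_zero]
          · rw [h3 j (by simp [hj, hjT])]; simp
        · simp
      rcases (h1 s).eq_or_lt with h0 | h0
      · refine Or.inr ⟨h, h1, fun i hi => ?_⟩
        by_cases his : i = s
        · rw [his]; exact h0.symm
        · exact h3 i (by simp [hi, his])
      · exact Or.inl ⟨h, h1, by rw [hxa]; exact mul_neg_of_pos_of_neg h0 hs⟩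
    have := stab_finite cs (yy (insert s T)) (yy_ee_nonneg _) ?_
    · rwa [yy_zero_set] at this
    refine (hP.union (hP.image Neg.neg)).subset ?_
    rintro α ⟨h, h0⟩
    rcases sign cs h with hp | hn
    · exact Or.inl ⟨h, hp, h0⟩
    · exact Or.inr ⟨-α, ⟨neg_mem cs h, neg_nonneg.2 hn, by rw [map_neg, h0, neg_zero]⟩, by simp⟩
  have := (dominant_unique cs (yy U) (yy_ee_nonneg U) w⁻¹ hdom).1
  intro t ht
  have h1 := hxT t ht
  rw [hx, LinearMap.comp_apply, this, yy_ee] at h1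
  by_contra hU
  simp [hU] at h1

end CoxRep
namespace CoxRep

open CoxeterSystem Real

set_option linter.unusedSectionVars false
set_option linter.unusedSimpArgs false

variable {B : Type*} [Fintype B] [DecidableEq B] {M : CoxeterMatrix B}
variable {W : Type*} [Group W] (cs : CoxeterSystem M W)

lemma law_arith (p q r U V Y a4 b4 : ℝ) (hp : 1 ≤ p) (hq : 1 ≤ q) (hr : 0 ≤ r)
    (ha4 : a4 = p * (p^2 - 2)) (_hb4 : b4 = q * (q^2 - 2))
    (hU : U = p * (p * r + (p^2 - 1) * q)) (hV : V = p * (r + p * q)) (hY : Y = q * (p + r * q))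
    (h1 : U * Y + V * b4 = 0) (h2 : b4 * a4 = q^2 * U) (h3 : p^2 * b4 = -(a4 * Y)) : False := by
  have hVp : 0 < V := by rw [hV]; positivity
  have hYp : 0 < Y := by rw [hY]; positivity
  have hp2 : 0 ≤ p^2 - 1 := by nlinarith
  have hU0 : 0 ≤ U := by rw [hU]; positivity
  rcases hU0.eq_or_lt with h | h
  · have hb : b4 = 0 := by
      rw [← h] at h1
      have : V * b4 = 0 := by linarith
      exact (mul_eq_zero.1 this).resolve_left hVp.ne'
    have ha : a4 = 0 := by
      rw [hb] at h3
      have : a4 * Y = 0 := by linarith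
      exact (mul_eq_zero.1 this).resolve_right hYp.ne'
    have hpp : p^2 = 2 := by
      rw [ha4] at ha
      have := (mul_eq_zero.1 ha).resolve_left (by linarith)
      linarith
    rw [hpp] at hU
    have : 0 < p * (p * r + (2 - 1) * q) := by positivity
    linarith
  · have hb : b4 < 0 := by
      by_contra hb
      push Not at hb
      have := mul_pos h hYp
      have := mul_nonneg hVp.le hb
      linarith
    have ha : 0 < a4 := by
      by_contra ha
      push Not at ha
      have := mul_nonneg (neg_nonneg.2 ha) hYp.le
      have : p^2 * b4 < 0 := mul_neg_of_pos_of_neg (by positivity) hb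
      linarith
    have := mul_neg_of_neg_of_pos hb ha
    have : 0 < q^2 * U := by positivity
    linarith

lemma neg_two_kk_ge {i j : B} (hij : i ≠ j) (h2 : M i j ≠ 2) : 1 ≤ -(2 * kk M i j) := by
  rw [two_kk]
  have h1 := M.off_diagonal i j hij
  rcases Nat.eq_zero_or_pos (M i j) with h0 | h0
  · simp [h0]
  have h3 : (3 : ℝ) ≤ M i j := by exact_mod_cast (by omega : 3 ≤ M i j)
  have : cos (π / 3) ≤ cos (π / M i j) := by
    apply cos_le_cos_of_nonneg_of_le_pi
    · have := pi_pos; positivity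
    · linarith [pi_pos]
    · gcongr
  rw [cos_pi_div_three] at this
  linarith

theorem law_fail {i j k : B} (hij : i ≠ j) (hjk : j ≠ k) (hik : i ≠ k)
    (h1 : M i j ≠ 2) (h2 : M j k ≠ 2) :
    ¬ Commute ((cs.simple i * cs.simple j)^2) ((cs.simple j * cs.simple k)^2) := by
  intro hc
  have hv : ∀ v, sg M i (sg M j (sg M i (sg M j (sg M j (sg M k (sg M j (sg M k v))))))) =
      sg M j (sg M k (sg M j (sg M k (sg M i (sg M j (sg M i (sg M j v))))))) := by
    intro v
    have := congrArg (fun w => rho cs w v) hc.eq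
    simpa only [pow_two, rho_mul, rho_simple] using this
  have hp := neg_two_kk_ge hij h1
  have hq := neg_two_kk_ge hjk h2
  have hr : 0 ≤ -(2 * kk M i k) := by have := kk_nonpos M hik; linarith
  obtain ⟨p, hpe⟩ : ∃ p, 2 * kk M i j = -p := ⟨-(2 * kk M i j), by ring⟩
  obtain ⟨q, hqe⟩ : ∃ q, 2 * kk M j k = -q := ⟨-(2 * kk M j k), by ring⟩
  obtain ⟨r, hre⟩ : ∃ r, 2 * kk M i k = -r := ⟨-(2 * kk M i k), by ring⟩
  have hpe' : 2 * kk M j i = -p := by rw [kk_symm, hpe]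
  have hqe' : 2 * kk M k j = -q := by rw [kk_symm, hqe]
  have hre' : 2 * kk M k i = -r := by rw [kk_symm, hre]
  rw [hpe, neg_neg] at hp
  rw [hqe, neg_neg] at hq
  rw [hre, neg_neg] at hr
  have sii : ∀ a : B, sg M a (ee a) = - ee a := sg_ee_self M
  have sij : sg M i (ee j) = ee j + p • ee i := by rw [sg_ee, hpe]; module
  have sji : sg M j (ee i) = ee i + p • ee j := by rw [sg_ee, hpe']; module
  have sjk : sg M j (ee k) = ee k + q • ee j := by rw [sg_ee, hqe]; module
  have skj : sg M k (ee j) = ee j + q • ee k := by rw [sg_ee, hqe']; module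
  have sik : sg M i (ee k) = ee k + r • ee i := by rw [sg_ee, hre]; module
  have ski : sg M k (ee i) = ee i + r • ee k := by rw [sg_ee, hre']; module
  have A1 : ∀ v, v = ee j → sg M i (sg M j (sg M i (sg M j v))) =
      (-(p*(p^2-2))) • ee i + (1 - p^2) • ee j := by
    rintro v rfl
    simp only [sii, sij, sji, map_neg, map_add, map_smul, neg_add]; module
  have A3 : sg M i (sg M j (sg M i (sg M j (ee k)))) =
      ee k + (p * (p * r + (p^2 - 1) * q)) • ee i + (p * (r + p * q)) • ee j := by
    simp only [sii, sij, sji, sik, sjk, map_neg, map_add, map_smul, neg_add]; module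
  have B1 : sg M j (sg M k (sg M j (sg M k (ee j)))) =
      (q^4 - 3*q^2+1) • ee j + (q * (q^2-2)) • ee k := by
    simp only [sii, sjk, skj, map_neg, map_add, map_smul, neg_add]; module
  have B3 : sg M j (sg M k (sg M j (sg M k (ee k)))) =
      (-(q * (q^2-2))) • ee j + (1 - q^2) • ee k := by
    simp only [sii, sjk, skj, map_neg, map_add, map_smul, neg_add]; module
  obtain ⟨X, B2⟩ : ∃ X : ℝ, sg M j (sg M k (sg M j (sg M k (ee i)))) =
      ee i + X • ee j + (q * (p + r * q)) • ee k := by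
    refine ⟨p - (p + r*q) + q^2*(p+r*q), ?_⟩
    simp only [sii, sjk, skj, ski, sji, map_neg, map_add, map_smul, neg_add]; module
  have A1 := A1 _ rfl
  have E1 := hv (ee j)
  have E2 := hv (ee k)
  rw [B1, A1] at E1
  rw [B3, A3] at E2
  simp only [map_add, map_smul, A1, A3, B1, B2, B3] at E1 E2
  have c1 := congrFun E1 k
  have c2 := congrFun E2 i
  have c3 := congrFun E2 k
  simp only [Pi.add_apply, Pi.smul_apply, ee, Pi.single_apply, hij, hij.symm, hjk, hjk.symm,
    hik, hik.symm, if_true, if_false, smul_eq_mul, mul_zero, mul_one, add_zero, zero_add]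
    at c1 c2 c3
  exact law_arith p q r _ _ _ _ _ hp hq hr rfl rfl rfl rfl rfl
    (by linarith) (by linarith) (by linarith)

/-! ### parabolic subgroups are Coxeter groups -/

/-- restricted matrix -/
def resM (M : CoxeterMatrix B) (T : Set B) : CoxeterMatrix T where
  M := Matrix.of fun i j => M i.1 j.1
  isSymm := by
    ext i j; exact M.symmetric j.1 i.1 |>.trans (M.symmetric _ _) |>.trans (M.symmetric _ _)
  diagonal i := M.diagonal i.1
  off_diagonal i j h := M.off_diagonal i.1 j.1 (fun e => h (Subtype.ext e))

lemma resM_apply (T : Set B) (i j : T) : resM M T i j = M i.1 j.1 := rfl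

lemma res_liftable (T : Set B) : (resM M T).IsLiftable (fun t : T => cs.simple t.1) := by
  intro i j; exact cs.simple_mul_simple_pow _ _

/-- the inclusion of the abstract parabolic group -/
noncomputable def inc (T : Set B) : (resM M T).Group →* W :=
  (resM M T).toCoxeterSystem.lift ⟨fun t : T => cs.simple t.1, res_liftable cs T⟩

lemma inc_simple (T : Set B) (t : T) :
    inc cs T ((resM M T).toCoxeterSystem.simple t) = cs.simple t.1 :=
  CoxeterSystem.lift_apply_simple _ _ _

theorem inc_injective (T : Set B) : Function.Injective (inc cs T) := by
  classical
  rw [injective_iff_map_eq_one]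
  intro w hw
  let E : (T → ℝ) →ₗ[ℝ] (B → ℝ) :=
    ∑ t : T, (LinearMap.proj t : (T → ℝ) →ₗ[ℝ] ℝ).smulRight (ee t.1)
  have Eapp : ∀ (v : T → ℝ) (t : T), E v t.1 = v t := by
    intro v t
    simp only [E, LinearMap.sum_apply, LinearMap.smulRight_apply, LinearMap.proj_apply,
      Finset.sum_apply, Pi.smul_apply, ee, Pi.single_apply, smul_eq_mul, mul_ite, mul_one, mul_zero]
    rw [Finset.sum_eq_single t]
    · simp
    · intro b _ hb; rw [if_neg]; intro h; exact hb (Subtype.ext h.symm)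
    · simp
  have Eee : ∀ t : T, E (ee t) = ee t.1 := by
    intro t
    simp only [E, LinearMap.sum_apply, LinearMap.smulRight_apply, LinearMap.proj_apply]
    rw [Finset.sum_eq_single t]
    · simp [ee]
    · intro b _ hb; simp [ee, Pi.single_apply, hb]
    · simp
  have Eff : ∀ (t : T) v, ff M t.1 (E v) = ff (resM M T) t v := by
    intro t v
    rw [expand v]
    simp only [map_sum, map_smul, Eee, ff_ee]
    rfl
  have key : ∀ (w : (resM M T).Group) (v : T → ℝ),
      rho cs (inc cs T w) (E v) = E (rho (resM M T).toCoxeterSystem w v) := by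
    intro w
    refine (resM M T).toCoxeterSystem.simple_induction_left
      (p := fun w => ∀ v, rho cs (inc cs T w) (E v) = E (rho (resM M T).toCoxeterSystem w v))
      w (by simp) ?_
    intro w t ih v
    rw [map_mul, inc_simple, rho_mul, ih, rho_mul, rho_simple, rho_simple, sg_apply, sg_apply, Eff,
      map_sub, map_smul, Eee]
  apply faithful (resM M T).toCoxeterSystem
  refine LinearMap.ext fun v => ?_
  have h1 := key w v
  rw [hw, map_one] at h1
  ext t
  have := congrFun h1 t.1
  rw [Eapp] at this
  simpa [Eapp] using this.symm

end CoxRep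

namespace CoxRep

set_option linter.unusedSectionVars false

section translate

variable {W : Type} [Group W] {S : Set W}

lemma cox_sq (hS : IsCoxGenSet S) {s : W} (hs : s ∈ S) : s * s = 1 := by
  obtain ⟨_, M, cs, h⟩ := hS
  have := cs.simple_mul_simple_self ⟨s, hs⟩
  rwa [h] at this

lemma cox_ne_one (hS : IsCoxGenSet S) {s : W} (hs : s ∈ S) : s ≠ 1 := by
  obtain ⟨_, M, cs, h⟩ := hS
  intro e
  have h1 := cs.length_simple ⟨s, hs⟩
  rw [h] at h1
  simp [e] at h1

lemma cox_closure (hS : IsCoxGenSet S) : Subgroup.closure S = ⊤ := by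
  obtain ⟨_, M, cs, h⟩ := hS
  have := cs.subgroup_closure_range_simple
  have e : Set.range cs.simple = S := by
    ext x; constructor
    · rintro ⟨i, rfl⟩; rw [h]; exact i.2
    · intro hx; exact ⟨⟨x, hx⟩, h _⟩
  rwa [e] at this

lemma cox_lift (hS : IsCoxGenSet S) {G : Type} [Group G] (f : W → G)
    (h1 : ∀ s ∈ S, f s * f s = 1)
    (h2 : ∀ s ∈ S, ∀ t ∈ S, s ≠ t → (f s * f t) ^ orderOf (s * t) = 1) :
    ∃ ψ : W →* G, ∀ s ∈ S, ψ s = f s := by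
  obtain ⟨_, M, cs, h⟩ := hS
  have hl : M.IsLiftable (fun s : S => f s.1) := by
    intro i j
    by_cases hij : i = j
    · subst hij; simp [h1 i.1 i.2]
    · have h3 := cs.simple_mul_simple_pow i j
      rw [h, h] at h3
      obtain ⟨k, hk⟩ := orderOf_dvd_of_pow_eq_one h3
      rw [hk, pow_mul, h2 i.1 i.2 j.1 j.2 (fun e => hij (Subtype.ext e)), one_pow]
  refine ⟨cs.lift ⟨_, hl⟩, fun s hs => ?_⟩
  have := cs.lift_apply_simple hl ⟨s, hs⟩
  rwa [h] at this

lemma par_eq {M : CoxeterMatrix S} (cs : CoxeterSystem M W) (h : ∀ s : S, cs.simple s = (s : W))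
    (T : Set S) : par cs T = Subgroup.closure (Subtype.val '' T) := by
  unfold par
  congr 1
  exact Set.image_congr fun s _ => h s

lemma image_pre {T : Set W} (hT : T ⊆ S) : Subtype.val '' ((Subtype.val : S → W) ⁻¹' T) = T := by
  rw [Subtype.image_preimage_coe]; exact Set.inter_eq_right.2 hT

lemma cox_conj (hS : IsCoxGenSet S) (H : Subgroup W) (hH : (H : Set W).Finite) :
    ∃ w T, IsSpherical S T ∧ ∀ h ∈ H, w⁻¹ * h * w ∈ Subgroup.closure T := by
  classical
  obtain ⟨hf, M, cs, h⟩ := hS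
  have := hf.fintype
  obtain ⟨w, T, h1, h2⟩ := finite_conj cs H hH
  rw [par_eq cs h] at h1 h2
  exact ⟨w, _, ⟨by rintro _ ⟨x, _, rfl⟩; exact x.2, h1⟩, h2⟩

lemma cox_uniq (hS : IsCoxGenSet S) {T U : Set W} (hT : IsMaxSpherical S T) (hU : IsSpherical S U)
    (w : W) (hw : ∀ h ∈ Subgroup.closure T, w⁻¹ * h * w ∈ Subgroup.closure U) : U = T := by
  classical
  obtain ⟨hf, M, cs, h⟩ := hS
  have := hf.fintype
  have key := max_unique cs (Subtype.val ⁻¹' T) (Subtype.val ⁻¹' U)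
  simp only [par_eq cs h, image_pre hT.1.1, image_pre hU.1, Set.image_insert_eq] at key
  have := key hT.1.2 (fun s hs hfin => hs (by
    have := hT.2 (insert s.1 T) ⟨Set.insert_subset s.2 hT.1.1, hfin⟩ (Set.subset_insert _ _)
    show s.1 ∈ T
    rw [← this]; exact Set.mem_insert _ _)) w hw
  refine hT.2 U hU fun x hx => ?_
  exact this (show (⟨x, hT.1.1 hx⟩ : S) ∈ Subtype.val ⁻¹' T from hx)

lemma cox_par (hS : IsCoxGenSet S) {T : Set W} (hT : T ⊆ S) :
    IsCoxGenSet ((Subtype.val : Subgroup.closure T → W) ⁻¹' T) := by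
  classical
  obtain ⟨hf, M, cs, h⟩ := hS
  have := hf.fintype
  refine ⟨(hf.subset hT).preimage Subtype.val_injective.injOn, ?_⟩
  let T0 : Set S := Subtype.val ⁻¹' T
  let e : T0 ≃ ((Subtype.val : Subgroup.closure T → W) ⁻¹' T) :=
    { toFun := fun x => ⟨⟨x.1.1, Subgroup.subset_closure x.2⟩, x.2⟩
      invFun := fun x => ⟨⟨x.1.1, hT x.2⟩, x.2⟩
      left_inv := fun x => rfl
      right_inv := fun x => rfl }
  have hr : (inc cs T0).range = Subgroup.closure T := by
    rw [MonoidHom.range_eq_map, ← (resM M T0).toCoxeterSystem.subgroup_closure_range_simple,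
      MonoidHom.map_closure]
    congr 1
    ext x; constructor
    · rintro ⟨_, ⟨i, rfl⟩, rfl⟩
      rw [inc_simple, h]; exact i.2
    · intro hx
      exact ⟨_, ⟨⟨⟨x, hT hx⟩, hx⟩, rfl⟩, by rw [inc_simple, h]⟩
  let f : (resM M T0).Group ≃* Subgroup.closure T :=
    (MonoidHom.ofInjective (inc_injective cs T0)).trans (MulEquiv.subgroupCongr hr)
  refine ⟨_, ((resM M T0).toCoxeterSystem.map f).reindex e, fun s => ?_⟩
  rw [CoxeterSystem.reindex_simple, CoxeterSystem.map_simple]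
  apply Subtype.ext
  show inc cs T0 _ = _
  rw [inc_simple, h]
  rfl

lemma cox_law (hS : IsCoxGenSet S) {s t u : W} (hs : s ∈ S) (ht : t ∈ S) (hu : u ∈ S)
    (hsu : s ≠ u) (h1 : ¬ Commute s t) (h2 : ¬ Commute t u) :
    ¬ Commute ((s * t) ^ 2) ((t * u) ^ 2) := by
  classical
  have hsq := fun {x} => cox_sq hS (s := x)
  obtain ⟨hf, M, cs, h⟩ := hS
  have := hf.fintype
  have aux : ∀ a b : S, ¬ Commute a.1 b.1 → M a b ≠ 2 := by
    intro a b hab e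
    apply hab
    have h3 := cs.simple_mul_simple_pow a b
    rw [h, h, e] at h3
    have ha := hsq a.2
    have hb := hsq b.2
    have ha' : (a.1)⁻¹ = a.1 := inv_eq_of_mul_eq_one_left ha
    have hb' : (b.1)⁻¹ = b.1 := inv_eq_of_mul_eq_one_left hb
    have h4 : (a.1 * b.1)⁻¹ = a.1 * b.1 := inv_eq_of_mul_eq_one_left (by rw [← pow_two, h3])
    rw [mul_inv_rev, ha', hb'] at h4
    exact h4.symm
  have := law_fail cs (i := ⟨s, hs⟩) (j := ⟨t, ht⟩) (k := ⟨u, hu⟩)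
    (fun e => h1 (by cases e; exact Commute.refl _))
    (fun e => h2 (by cases e; exact Commute.refl _))
    (fun e => hsu (by cases e; rfl)) (aux _ _ h1) (aux _ _ h2)
  simpa [h] using this

end translate

end CoxRep

namespace CoxRep

section groups

/-- squares commute -/
def Law (G : Type) [Group G] : Prop := ∀ x y : G, Commute (x ^ 2) (y ^ 2)

/-- a property separating strong even groups from the others -/
def QQ (G : Type) [Group G] : Prop := ∀ s r : G, s * s = 1 → r ≠ 1 → Odd (orderOf r) →
  s * r * s = r⁻¹ → ∃ g, Commute g r ∧ ¬ Odd (orderOf (s * g * s⁻¹ * g⁻¹))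

/-- every element is an involution or has odd order -/
def OO (G : Type) [Group G] : Prop := ∀ x : G, x * x = 1 ∨ Odd (orderOf x)

lemma Law.equiv {G H : Type} [Group G] [Group H] (h : Law G) (e : G ≃* H) : Law H := by
  intro x y
  have := (h (e.symm x) (e.symm y)).map e
  simpa using this

lemma OO.equiv {G H : Type} [Group G] [Group H] (h : OO G) (e : G ≃* H) : OO H := by
  intro x
  rcases h (e.symm x) with h | h
  · left
    have := congrArg e h
    simpa using this
  · right; rwa [MulEquiv.orderOf_eq] at h

lemma QQ.equiv {G H : Type} [Group G] [Group H] (h : QQ G) (e : G ≃* H) : QQ H := by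
  intro s r h1 h2 h3 h4
  obtain ⟨g, hg, hg'⟩ := h (e.symm s) (e.symm r) (by rw [← map_mul, h1, map_one])
    (by simpa using h2) (by rwa [MulEquiv.orderOf_eq]) (by rw [← map_mul, ← map_mul, h4, map_inv])
  refine ⟨e g, by simpa using hg.map e, ?_⟩
  rw [← MulEquiv.orderOf_eq e] at hg'
  simpa using hg'

lemma Law.prod {G H : Type} [Group G] [Group H] (h : Law G) (h' : Law H) : Law (G × H) := by
  intro x y
  exact Prod.ext (h x.1 y.1) (h' x.2 y.2)

lemma QQ.prod {G H : Type} [Group G] [Group H] (h : QQ G) (h' : QQ H) : QQ (G × H) := by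
  rintro ⟨s, s'⟩ ⟨r, r'⟩ h1 h2 h3 h4
  simp only [Prod.mk_mul_mk, Prod.mk_eq_one, Prod.inv_mk, Prod.mk.injEq] at h1 h4
  have o1 : Odd (orderOf r) :=
    h3.of_dvd_nat (orderOf_map_dvd (MonoidHom.fst G H) (r, r'))
  have o2 : Odd (orderOf r') :=
    h3.of_dvd_nat (orderOf_map_dvd (MonoidHom.snd G H) (r, r'))
  by_cases hr : r = 1
  · have hr' : r' ≠ 1 := fun e => h2 (by simp [hr, e])
    obtain ⟨g, hg, hg'⟩ := h' s' r' h1.2 hr' o2 h4.2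
    refine ⟨(1, g), Prod.ext (Commute.one_left _) hg, fun ho => hg' ?_⟩
    exact ho.of_dvd_nat (orderOf_map_dvd (MonoidHom.snd G H) _)
  · obtain ⟨g, hg, hg'⟩ := h s r h1.1 hr o1 h4.1
    refine ⟨(g, 1), Prod.ext hg (Commute.one_left _), fun ho => hg' ?_⟩
    exact ho.of_dvd_nat (orderOf_map_dvd (MonoidHom.fst G H) _)

variable {G : Type} [Group G]

lemma comm_of_sq {s t : G} (hs : s * s = 1) (ht : t * t = 1) (h : (s * t) ^ 2 = 1) :
    Commute s t := by
  have ha' : s⁻¹ = s := inv_eq_of_mul_eq_one_left hs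
  have hb' : t⁻¹ = t := inv_eq_of_mul_eq_one_left ht
  have h4 : (s * t)⁻¹ = s * t := inv_eq_of_mul_eq_one_left (by rw [← pow_two, h])
  rw [mul_inv_rev, ha', hb'] at h4
  exact h4.symm

lemma sq_of_comm {s t : G} (hs : s * s = 1) (ht : t * t = 1) (h : Commute s t) :
    (s * t) ^ 2 = 1 := by
  rw [h.mul_pow, pow_two, pow_two, hs, ht, one_mul]

lemma refl_pow {s t : G} (hs : s * s = 1) (ht : t * t = 1) (k : ℤ) :
    s * (s * t) ^ k = (s * t) ^ (-k) * s := by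
  have ha' : s⁻¹ = s := inv_eq_of_mul_eq_one_left hs
  have hb' : t⁻¹ = t := inv_eq_of_mul_eq_one_left ht
  have h1 : s * (s * t) * s⁻¹ = (s * t)⁻¹ := by
    rw [mul_inv_rev, ha', hb', ← mul_assoc, hs, one_mul]
  have h2 : s * (s * t) ^ k * s⁻¹ = (s * t) ^ (-k) := by
    rw [← conj_zpow, h1, inv_zpow, zpow_neg]
  rw [← h2, inv_mul_cancel_right]

lemma refl_pow_sq {s t : G} (hs : s * s = 1) (ht : t * t = 1) (k : ℤ) :
    ((s * t) ^ k * s) * ((s * t) ^ k * s) = 1 := by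
  rw [mul_assoc, ← mul_assoc s, refl_pow hs ht, mul_assoc, hs, mul_one, zpow_neg, mul_inv_cancel]

lemma decomp {s t : G} (hs : s * s = 1) (ht : t * t = 1) (H : Subgroup G)
    (hH : ∀ h ∈ H, Commute h s ∧ Commute h t) (X : Set G) (hX : Subgroup.closure X = ⊤)
    (hx : ∀ x ∈ X, x = s ∨ x = t ∨ x ∈ H) (g : G) :
    ∃ k : ℤ, ∃ h ∈ H, g = (s * t) ^ k * h ∨ g = (s * t) ^ k * s * h := by
  have ha' : s⁻¹ = s := inv_eq_of_mul_eq_one_left hs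
  have hb' : t⁻¹ = t := inv_eq_of_mul_eq_one_left ht
  have stepS : ∀ g : G, (∃ k : ℤ, ∃ h ∈ H, g = (s * t) ^ k * h ∨ g = (s * t) ^ k * s * h) →
      (∃ k : ℤ, ∃ h ∈ H, s * g = (s * t) ^ k * h ∨ s * g = (s * t) ^ k * s * h) := by
    rintro _ ⟨k, h, hh, rfl | rfl⟩
    · exact ⟨-k, h, hh, Or.inr (by rw [← mul_assoc, refl_pow hs ht])⟩
    · refine ⟨-k, h, hh, Or.inl ?_⟩
      rw [← mul_assoc, ← mul_assoc, refl_pow hs ht, mul_assoc _ s s, hs, mul_one]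
  have stepR : ∀ g : G, (∃ k : ℤ, ∃ h ∈ H, g = (s * t) ^ k * h ∨ g = (s * t) ^ k * s * h) →
      (∃ k : ℤ, ∃ h ∈ H, (s * t) * g = (s * t) ^ k * h ∨ (s * t) * g = (s * t) ^ k * s * h) := by
    rintro _ ⟨k, h, hh, rfl | rfl⟩
    · exact ⟨1 + k, h, hh, Or.inl (by rw [zpow_one_add]; group)⟩
    · exact ⟨1 + k, h, hh, Or.inr (by rw [zpow_one_add]; group)⟩
  have stepH : ∀ x ∈ H, ∀ g : G,
      (∃ k : ℤ, ∃ h ∈ H, g = (s * t) ^ k * h ∨ g = (s * t) ^ k * s * h) →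
      (∃ k : ℤ, ∃ h ∈ H, x * g = (s * t) ^ k * h ∨ x * g = (s * t) ^ k * s * h) := by
    intro x hxH
    obtain ⟨c1, c2⟩ := hH x hxH
    rintro _ ⟨k, h, hh, rfl | rfl⟩
    · refine ⟨k, x * h, H.mul_mem hxH hh, Or.inl ?_⟩
      rw [← mul_assoc, ((c1.mul_right c2).zpow_right k).eq, mul_assoc]
    · refine ⟨k, x * h, H.mul_mem hxH hh, Or.inr ?_⟩
      rw [← mul_assoc, (((c1.mul_right c2).zpow_right k).mul_right c1).eq, mul_assoc]
  have stepT : ∀ g : G, (∃ k : ℤ, ∃ h ∈ H, g = (s * t) ^ k * h ∨ g = (s * t) ^ k * s * h) →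
      (∃ k : ℤ, ∃ h ∈ H, t * g = (s * t) ^ k * h ∨ t * g = (s * t) ^ k * s * h) := by
    intro g hg
    have := stepS _ (stepR g hg)
    rwa [← mul_assoc, ← mul_assoc, hs, one_mul] at this
  have hg : g ∈ Subgroup.closure X := by rw [hX]; trivial
  induction hg using Subgroup.closure_induction_left with
  | one => exact ⟨0, 1, H.one_mem, Or.inl (by simp)⟩
  | mul_left x hx' y _ ih =>
    rcases hx x hx' with rfl | rfl | h
    · exact stepS _ ih
    · exact stepT _ ih
    · exact stepH _ h _ ih
  | inv_mul_cancel x hx' y _ ih =>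
    rcases hx x hx' with rfl | rfl | h
    · rw [ha']; exact stepS _ ih
    · rw [hb']; exact stepT _ ih
    · exact stepH _ (H.inv_mem h) _ ih

lemma dihedral_decomp {s t : G} (hs : s * s = 1) (ht : t * t = 1)
    (hX : Subgroup.closure {s, t} = ⊤) (g : G) :
    ∃ k : ℤ, g = (s * t) ^ k ∨ g = (s * t) ^ k * s := by
  obtain ⟨k, h, hh, hg⟩ := decomp hs ht ⊥ (by simp) {s, t} hX
    (by rintro x (rfl | rfl) <;> simp) g
  rw [Subgroup.mem_bot] at hh
  subst hh
  exact ⟨k, by simpa using hg⟩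

lemma dihedral_law {s t : G} (hs : s * s = 1) (ht : t * t = 1)
    (hX : Subgroup.closure {s, t} = ⊤) : Law G := by
  have key : ∀ x : G, ∃ j : ℤ, x ^ 2 = (s * t) ^ j := by
    intro x
    obtain ⟨k, rfl | rfl⟩ := dihedral_decomp hs ht hX x
    · exact ⟨k * 2, by rw [zpow_mul]; norm_cast⟩
    · exact ⟨0, by rw [pow_two, refl_pow_sq hs ht, zpow_zero]⟩
  intro x y
  obtain ⟨j, hj⟩ := key x
  obtain ⟨k, hk⟩ := key y
  rw [hj, hk]
  exact (Commute.refl _).zpow_zpow _ _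

lemma odd_zpow {x : G} (h : Odd (orderOf x)) (k : ℤ) : Odd (orderOf (x ^ k)) :=
  h.of_dvd_nat (orderOf_dvd_of_mem_zpowers (Subgroup.zpow_mem_zpowers x k))

lemma odd_sq {x : G} (h : Odd (orderOf x)) (h2 : x * x = 1) : x = 1 := by
  have h1 : orderOf x ∣ 2 := orderOf_dvd_of_pow_eq_one (by rw [pow_two, h2])
  rcases (Nat.dvd_prime Nat.prime_two).1 h1 with h3 | h3
  · exact orderOf_eq_one_iff.1 h3
  · rw [h3] at h; exact absurd h (by decide)

lemma dihedral_OO {s t : G} (hs : s * s = 1) (ht : t * t = 1)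
    (hX : Subgroup.closure {s, t} = ⊤) (ho : Odd (orderOf (s * t))) : OO G := by
  intro x
  obtain ⟨k, rfl | rfl⟩ := dihedral_decomp hs ht hX x
  · exact Or.inr (odd_zpow ho k)
  · exact Or.inl (refl_pow_sq hs ht k)

lemma dihedral_QQ {s t : G} (hs : s * s = 1) (ht : t * t = 1)
    (hX : Subgroup.closure {s, t} = ⊤) (ho : 4 ∣ orderOf (s * t)) : QQ G := by
  intro a r h1 h2 h3 h4
  have hr2 : r * r ≠ 1 := fun e => h2 (odd_sq h3 e)
  obtain ⟨k, rfl | rfl⟩ := dihedral_decomp hs ht hX r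
  swap
  · exact absurd (refl_pow_sq hs ht k) hr2
  refine ⟨s * t, Commute.self_zpow _ _, ?_⟩
  obtain ⟨j, rfl | rfl⟩ := dihedral_decomp hs ht hX a
  · exfalso
    apply hr2
    rw [(Commute.zpow_zpow (Commute.refl (s * t)) j k).eq, mul_assoc, h1, mul_one] at h4
    nth_rewrite 1 [h4]
    exact inv_mul_cancel _
  · have e : (s * t) ^ j * s * (s * t) * ((s * t) ^ j * s)⁻¹ * (s * t)⁻¹ = ((s * t) ^ 2)⁻¹ := by
      have h5 := refl_pow hs ht 1
      rw [zpow_one] at h5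
      rw [mul_assoc _ s, h5]
      generalize s * t = ρ
      group
    rw [e, orderOf_inv]
    intro hodd
    have h6 : orderOf (s * t) ∣ 2 * orderOf ((s * t) ^ 2) :=
      orderOf_dvd_of_pow_eq_one (by rw [pow_mul, pow_orderOf_eq_one])
    have := ho.trans h6
    obtain ⟨m, hm⟩ := hodd
    omega

end groups

end CoxRep

namespace CoxRep

section strongEven

variable {G : Type} [Group G]

/-- reflection in the first coordinate -/
def pA : Equiv.Perm (ℤ × ℤ) := ⟨fun p => (-p.1, p.2), fun p => (-p.1, p.2),
  fun p => by simp, fun p => by simp⟩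

/-- diagonal reflection -/
def pB : Equiv.Perm (ℤ × ℤ) := ⟨fun p => (p.2, p.1), fun p => (p.2, p.1),
  fun p => by simp, fun p => by simp⟩

/-- affine reflection in the second coordinate -/
def pC : Equiv.Perm (ℤ × ℤ) := ⟨fun p => (p.1, 1 - p.2), fun p => (p.1, 1 - p.2),
  fun p => by simp, fun p => by simp⟩

lemma pA_apply (p) : pA p = (-p.1, p.2) := rfl
lemma pB_apply (p) : pB p = (p.2, p.1) := rfl
lemma pC_apply (p) : pC p = (p.1, 1 - p.2) := rfl

lemma even_of {T : Set G} (hT : IsStrongEvenSet T) {s t : G} (hs : s ∈ T) (ht : t ∈ T)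
    (h : s ≠ t) : 2 ∣ orderOf (s * t) := by
  rcases hT s hs t ht h with h | h
  · rw [h]
  · exact (by norm_num : 2 ∣ 4).trans h

lemma four_of {T : Set G} (hc : IsCoxGenSet T) (hT : IsStrongEvenSet T) {s t : G} (hs : s ∈ T)
    (ht : t ∈ T) (h : ¬ Commute s t) : 4 ∣ orderOf (s * t) := by
  rcases hT s hs t ht (fun e => h (by rw [e])) with h' | h'
  · exact absurd (comm_of_sq (cox_sq hc hs) (cox_sq hc ht) (h' ▸ pow_orderOf_eq_one _)) h
  · exact h'

lemma pow_dvd_one {H : Type} [Group H] {x : H} {m n : ℕ} (h : x ^ m = 1) (hd : m ∣ n) :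
    x ^ n = 1 := by
  obtain ⟨k, rfl⟩ := hd
  rw [pow_mul, h, one_pow]

lemma third [Finite G] {T : Set G} (hc : IsCoxGenSet T) (hT : IsStrongEvenSet T) {a b c : G}
    (ha : a ∈ T) (hb : b ∈ T) (hcT : c ∈ T) (hac : a ≠ c) (hab : ¬ Commute a b) :
    Commute b c := by
  classical
  by_contra hbc
  have nab : a ≠ b := fun e => hab (by rw [e])
  have nbc : b ≠ c := fun e => hbc (by rw [e])
  have four := fun {s t : G} => four_of hc hT (s := s) (t := t)
  let f : G → Equiv.Perm (ℤ × ℤ) := fun x =>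
    if x = a then pA else if x = b then pB else if x = c then pC else 1
  have fa : f a = pA := by simp [f]
  have fb : f b = pB := by simp [f, nab.symm]
  have fc : f c = pC := by simp [f, hac.symm, nbc.symm]
  have fo : ∀ x, x ≠ a → x ≠ b → x ≠ c → f x = 1 := by
    intro x h1 h2 h3; simp [f, h1, h2, h3]
  have sq : ∀ x, f x * f x = 1 := by
    intro x
    by_cases h1 : x = a
    · rw [h1, fa]; ext p <;> simp [pA_apply]
    by_cases h2 : x = b
    · rw [h2, fb]; ext p <;> simp [pB_apply]
    by_cases h3 : x = c
    · rw [h3, fc]; ext p <;> simp [pC_apply]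
    rw [fo x h1 h2 h3]; simp
  have key : ∀ s ∈ T, ∀ t ∈ T, s ≠ t → (f s * f t) ^ orderOf (s * t) = 1 := by
    intro s hs t ht hst
    have ev := even_of hT hs ht hst
    by_cases hso : s ≠ a ∧ s ≠ b ∧ s ≠ c
    · rw [fo s hso.1 hso.2.1 hso.2.2, one_mul]
      exact pow_dvd_one (by rw [pow_two, sq]) ev
    by_cases hto : t ≠ a ∧ t ≠ b ∧ t ≠ c
    · rw [fo t hto.1 hto.2.1 hto.2.2, mul_one]
      exact pow_dvd_one (by rw [pow_two, sq]) ev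
    have hs' : s = a ∨ s = b ∨ s = c := by tauto
    have ht' : t = a ∨ t = b ∨ t = c := by tauto
    rcases hs' with rfl | rfl | rfl <;> rcases ht' with rfl | rfl | rfl
    · exact absurd rfl hst
    · refine pow_dvd_one ?_ (four hs ht hab)
      rw [fa, fb]; ext p <;> simp [pow_succ, pA_apply, pB_apply]
    · refine pow_dvd_one ?_ ev
      rw [fa, fc]; ext p <;> simp [pow_succ, pA_apply, pC_apply]
    · refine pow_dvd_one ?_ (four hs ht (fun h => hab h.symm))
      rw [fa, fb]; ext p <;> simp [pow_succ, pA_apply, pB_apply]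
    · exact absurd rfl hst
    · refine pow_dvd_one ?_ (four hs ht hbc)
      rw [fc, fb]; ext p <;> simp [pow_succ, pC_apply, pB_apply]
    · refine pow_dvd_one ?_ ev
      rw [fa, fc]; ext p <;> simp [pow_succ, pA_apply, pC_apply]
    · refine pow_dvd_one ?_ (four hs ht (fun h => hbc h.symm))
      rw [fc, fb]; ext p <;> simp [pow_succ, pC_apply, pB_apply]
    · exact absurd rfl hst
  obtain ⟨ψ, hψ⟩ := cox_lift hc f (fun s _ => sq s) key
  have hx : ψ (c * (b * a * b)) = pC * (pB * pA * pB) := by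
    simp only [map_mul, hψ a ha, hψ b hb, hψ c hcT, fa, fb, fc]
  have hp : ∀ n : ℕ, ((pC * (pB * pA * pB)) ^ n) (0, 0) = (0, (n : ℤ)) := by
    intro n
    induction n with
    | zero => simp
    | succ n ih =>
      rw [pow_succ', Equiv.Perm.mul_apply, ih]
      simp [pA_apply, pB_apply, pC_apply]; ring
  have h1 := orderOf_pos (c * (b * a * b))
  have h2 := congrArg ψ (pow_orderOf_eq_one (c * (b * a * b)))
  rw [map_pow, hx, map_one] at h2
  have h3 := hp (orderOf (c * (b * a * b)))
  rw [h2] at h3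
  simp at h3
  omega

lemma closure_commute {A D : Set G} (h : ∀ a ∈ A, ∀ d ∈ D, Commute a d)
    {x y : G} (hx : x ∈ Subgroup.closure A) (hy : y ∈ Subgroup.closure D) : Commute x y := by
  have h1 : Subgroup.closure D ≤ Subgroup.centralizer A := by
    rw [Subgroup.closure_le]
    intro d hd
    exact Subgroup.mem_centralizer_iff.2 fun a ha => h a ha d hd
  have h2 : Subgroup.closure A ≤ Subgroup.centralizer (Subgroup.closure D) := by
    rw [Subgroup.closure_le]
    intro a ha
    exact Subgroup.mem_centralizer_iff.2 fun d hd =>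
      ((Subgroup.mem_centralizer_iff.1 (h1 hd)) a ha).symm
  exact ((Subgroup.mem_centralizer_iff.1 (h2 hx)) y hy).symm

lemma split {T A D : Set G} (hc : IsCoxGenSet T) (hT : IsStrongEvenSet T) (hTe : T = A ∪ D)
    (hdis : ∀ x ∈ A, x ∉ D) (hcomm : ∀ a ∈ A, ∀ d ∈ D, Commute a d) :
    Nonempty ((Subgroup.closure A × Subgroup.closure D) ≃* G) := by
  classical
  have hAT : A ⊆ T := hTe ▸ Set.subset_union_left
  have hDT : D ⊆ T := hTe ▸ Set.subset_union_right
  let f : G → G := fun x => if x ∈ A then x else 1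
  have sq : ∀ x ∈ T, f x * f x = 1 := by
    intro x hx
    by_cases h : x ∈ A
    · simp [f, h, cox_sq hc hx]
    · simp [f, h]
  have key : ∀ s ∈ T, ∀ t ∈ T, s ≠ t → (f s * f t) ^ orderOf (s * t) = 1 := by
    intro s hs t ht hst
    have ev := even_of hT hs ht hst
    by_cases h : s ∈ A
    · by_cases h' : t ∈ A
      · simp [f, h, h', pow_orderOf_eq_one]
      · have : f t = 1 := by simp [f, h']
        rw [this, mul_one]
        exact pow_dvd_one (by rw [pow_two, sq s hs]) ev
    · have : f s = 1 := by simp [f, h]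
      rw [this, one_mul]
      exact pow_dvd_one (by rw [pow_two, sq t ht]) ev
  obtain ⟨ψ, hψ⟩ := cox_lift hc f sq key
  have e1 : ∀ x ∈ Subgroup.closure A, ψ x = x := by
    intro x hx
    have : Subgroup.closure A ≤ MonoidHom.eqLocus ψ (MonoidHom.id G) := by
      rw [Subgroup.closure_le]
      intro a ha
      show ψ a = a
      rw [hψ a (hAT ha)]; simp [f, ha]
    exact this hx
  have e2 : ∀ x ∈ Subgroup.closure D, ψ x = 1 := by
    intro x hx
    have : Subgroup.closure D ≤ ψ.ker := by
      rw [Subgroup.closure_le]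
      intro a ha
      show ψ a = 1
      rw [hψ a (hDT ha)]
      have : a ∉ A := fun h => hdis a h ha
      simp [f, this]
    exact this hx
  let F : Subgroup.closure A × Subgroup.closure D →* G :=
    (Subgroup.closure A).subtype.noncommCoprod (Subgroup.closure D).subtype
      (fun x y => closure_commute hcomm x.2 y.2)
  have hF : ∀ x, F x = x.1.1 * x.2.1 := fun x => rfl
  refine ⟨MulEquiv.ofBijective F ⟨?_, ?_⟩⟩
  · rw [injective_iff_map_eq_one]
    rintro ⟨⟨x, hx⟩, ⟨y, hy⟩⟩ h
    rw [hF] at h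
    have h' := congrArg ψ h
    simp only [map_mul, e1 x hx, e2 y hy, mul_one, map_one] at h'
    subst h'
    simp only [one_mul] at h
    subst h
    rfl
  · rw [← MonoidHom.range_eq_top, eq_top_iff, ← cox_closure hc, Subgroup.closure_le, hTe]
    rintro x (hx | hx)
    · exact ⟨(⟨x, Subgroup.subset_closure hx⟩, 1), by rw [hF]; simp⟩
    · exact ⟨(1, ⟨x, Subgroup.subset_closure hx⟩), by rw [hF]; simp⟩

lemma closure_pre (A : Set G) :
    Subgroup.closure ((Subtype.val : Subgroup.closure A → G) ⁻¹' A) = ⊤ :=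
  Subgroup.closure_closure_coe_preimage

lemma strong_pre {T A : Set G} (hT : IsStrongEvenSet T) (hA : A ⊆ T) :
    IsStrongEvenSet ((Subtype.val : Subgroup.closure A → G) ⁻¹' A) := by
  intro s hs t ht hst
  have := hT s.1 (hA hs) t.1 (hA ht) (fun e => hst (Subtype.ext e))
  rwa [← Subgroup.coe_mul, Subgroup.orderOf_coe] at this

lemma closure_pair_top {a b : G} :
    Subgroup.closure ({⟨a, Subgroup.subset_closure (by simp)⟩,
      ⟨b, Subgroup.subset_closure (by simp)⟩} : Set (Subgroup.closure {a, b})) = ⊤ := by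
  rw [← closure_pre {a, b}]
  congr 1
  ext ⟨x, hx⟩
  simp [Subtype.ext_iff]

lemma lemA_aux (n : ℕ) : ∀ (G : Type) [Group G] [Finite G] (T : Set G), T.ncard = n →
    IsCoxGenSet T → IsStrongEvenSet T → Law G ∧ QQ G := by
  induction n using Nat.strong_induction_on with
  | _ n ih =>
  intro G _ _ T hn hc hT
  rcases T.eq_empty_or_nonempty with rfl | ⟨a, ha⟩
  · have h1 := cox_closure hc
    rw [Subgroup.closure_empty] at h1
    have h2 : ∀ x : G, x = 1 := fun x => by
      have : x ∈ (⊥ : Subgroup G) := h1 ▸ Subgroup.mem_top x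
      exact Subgroup.mem_bot.1 this
    refine ⟨fun x y => ?_, fun s r _ h => absurd (h2 r) h⟩
    rw [h2 x, h2 y]
  have main : ∀ A : Set G, A ⊆ T → A.Nonempty → (∀ x ∈ A, ∀ d ∈ T \ A, Commute x d) →
      Law (Subgroup.closure A) → QQ (Subgroup.closure A) → Law G ∧ QQ G := by
    intro A hA hAne hcomm hL hQ
    obtain ⟨e⟩ := split hc hT (Set.union_sdiff_cancel hA).symm (fun x hx hd => hd.2 hx) hcomm
    have hsub : T \ A ⊆ T := Set.sdiff_subset
    obtain ⟨hL', hQ'⟩ := ih (T \ A).ncard (by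
        rw [← hn]
        refine Set.ncard_lt_ncard ⟨hsub, fun h => ?_⟩ (Set.toFinite _)
        obtain ⟨x, hx⟩ := hAne
        exact (h (hA hx)).2 hx)
      (Subgroup.closure (T \ A)) (Subtype.val ⁻¹' (T \ A))
      (Set.ncard_preimage_of_injective_subset_range Subtype.val_injective
        (by intro x hx; exact ⟨⟨x, Subgroup.subset_closure hx⟩, rfl⟩))
      (cox_par hc hsub) (strong_pre hT hsub)
    exact ⟨(hL.prod hL').equiv e, (hQ.prod hQ').equiv e⟩
  by_cases hcase : ∀ b ∈ T, Commute a b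
  · have hcom : ∀ x y : Subgroup.closure ({a} : Set G), x * y = y * x := by
      intro x y
      exact Subtype.ext (closure_commute (A := {a}) (D := {a})
        (by rintro _ rfl _ rfl; exact Commute.refl _) x.2 y.2)
    refine main {a} (by simpa using ha) (by simp) (by rintro _ rfl d hd; exact hcase d hd.1)
      (fun x y => hcom _ _) ?_
    intro s r h1 h2 h3 h4
    rw [hcom s r, mul_assoc, h1, mul_one] at h4
    exact absurd (odd_sq h3 (by nth_rewrite 1 [h4]; exact inv_mul_cancel _)) h2
  · push Not at hcase
    obtain ⟨b, hb, hab⟩ := hcase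
    have hsa := cox_sq hc ha
    have hsb := cox_sq hc hb
    refine main {a, b} (by rintro _ (rfl | rfl) <;> assumption) (by simp) ?_
      (dihedral_law (Subtype.ext hsa) (Subtype.ext hsb) closure_pair_top)
      (dihedral_QQ (Subtype.ext hsa) (Subtype.ext hsb) closure_pair_top ?_)
    · rintro x hx d ⟨hd, hd'⟩
      simp only [Set.mem_insert_iff, Set.mem_singleton_iff, not_or] at hd'
      rcases hx with rfl | rfl
      · exact third hc hT hb ha hd (Ne.symm hd'.2) (fun h => hab h.symm)
      · exact third hc hT ha hb hd (Ne.symm hd'.1) hab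
    · rw [← Subgroup.orderOf_coe]
      exact four_of hc hT ha hb hab

lemma lemA [Finite G] {T : Set G} (hc : IsCoxGenSet T) (hT : IsStrongEvenSet T) : Law G ∧ QQ G :=
  lemA_aux _ G T rfl hc hT

/-- in a group with commuting squares, other generators commute with a non-commuting pair -/
lemma others {T : Set G} (hc : IsCoxGenSet T) (hL : Law G) {s t u : G} (hs : s ∈ T) (ht : t ∈ T)
    (hu : u ∈ T) (hst : ¬ Commute s t) (h1 : u ≠ s) (h2 : u ≠ t) : Commute u s ∧ Commute u t := by
  constructor
  · by_contra h
    exact cox_law hc ht hs hu h2.symm (fun e => hst e.symm) (fun e => h e.symm) (hL _ _)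
  · by_contra h
    exact cox_law hc hs ht hu h1.symm hst (fun e => h e.symm) (hL _ _)

lemma not_comm_of {T : Set G} (hc : IsCoxGenSet T) {s t : G} (hs : s ∈ T) (ht : t ∈ T)
    (hst : s ≠ t) (h2 : orderOf (s * t) ≠ 2) : ¬ Commute s t := by
  intro h
  have h1 : orderOf (s * t) ∣ 2 :=
    orderOf_dvd_of_pow_eq_one (sq_of_comm (cox_sq hc hs) (cox_sq hc ht) h)
  rcases (Nat.dvd_prime Nat.prime_two).1 h1 with h3 | h3
  · rw [orderOf_eq_one_iff] at h3
    exact hst (mul_right_cancel (h3.trans (cox_sq hc ht).symm))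
  · exact h2 h3

lemma lemB {T : Set G} (hc : IsCoxGenSet T) (hL : Law G) (hQ : QQ G) : IsStrongEvenSet T := by
  intro s hs t ht hst
  by_contra hcon
  push Not at hcon
  obtain ⟨hm2, hm4⟩ := hcon
  have hnc := not_comm_of hc hs ht hst hm2
  have ss := cox_sq hc hs
  have tt := cox_sq hc ht
  have s' : s⁻¹ = s := inv_eq_of_mul_eq_one_left ss
  have hr1 : (s * t) ^ 2 ≠ 1 := fun e => hnc (comm_of_sq ss tt e)
  have hro : Odd (orderOf ((s * t) ^ 2)) := by
    rcases Nat.even_or_odd (orderOf (s * t)) with he | ho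
    · obtain ⟨k, hk⟩ := he
      have hk' : Odd k := by
        rw [← Nat.not_even_iff_odd]
        rintro ⟨j, rfl⟩
        exact hm4 ⟨j, by omega⟩
      refine hk'.of_dvd_nat (orderOf_dvd_of_pow_eq_one ?_)
      rw [← pow_mul, two_mul, ← hk, pow_orderOf_eq_one]
    · exact_mod_cast odd_zpow ho 2
  have hconj : s * (s * t) ^ 2 * s = ((s * t) ^ 2)⁻¹ := by
    have := refl_pow ss tt 2
    rw [zpow_neg] at this
    norm_cast at this
    rw [this, mul_assoc, ss, mul_one]
  obtain ⟨g, hg, hg'⟩ := hQ s ((s * t) ^ 2) ss hr1 hro hconj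
  obtain ⟨k, h, hh, hge⟩ := decomp ss tt (Subgroup.centralizer {s, t})
    (fun h hh => by
      rw [Subgroup.mem_centralizer_iff] at hh
      exact ⟨(hh s (by simp)).symm, (hh t (by simp)).symm⟩) T (cox_closure hc)
    (fun u hu => by
      by_cases h1 : u = s
      · exact Or.inl h1
      by_cases h2 : u = t
      · exact Or.inr (Or.inl h2)
      have := others hc hL hs ht hu hnc h1 h2
      right; right
      rw [Subgroup.mem_centralizer_iff]
      rintro _ (rfl | rfl)
      · exact this.1.symm
      · exact this.2.symm) g
  rw [Subgroup.mem_centralizer_iff] at hh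
  have c1 : Commute h s := (hh s (by simp)).symm
  have c2 : Commute h t := (hh t (by simp)).symm
  rcases hge with rfl | rfl
  · apply hg'
    have e : s * ((s * t) ^ k * h) * s⁻¹ * ((s * t) ^ k * h)⁻¹ = ((s * t) ^ 2) ^ (-k) := by
      rw [← mul_assoc, refl_pow ss tt, mul_assoc _ s h, ← c1.eq]
      have : ((s * t) ^ 2) ^ (-k) = (s * t) ^ (-k) * (s * t) ^ (-k) := by
        rw [pow_two, (Commute.refl (s * t)).mul_zpow]
      rw [this]
      generalize s * t = ρ
      group
    rw [e]
    exact odd_zpow hro _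
  · apply hr1
    apply odd_sq hro
    have c3 : Commute h ((s * t) ^ 2) := (c1.mul_right c2).pow_right 2
    have c4 : Commute ((s * t) ^ k) ((s * t) ^ 2) := (Commute.refl _).zpow_left k |>.pow_right 2
    have c5 : Commute s ((s * t) ^ 2) := by
      have := (c4.inv_left.mul_left hg).mul_left c3.inv_left
      simpa [mul_assoc] using this
    rw [c5.eq, mul_assoc, ss, mul_one] at hconj
    nth_rewrite 1 [hconj]
    exact inv_mul_cancel _

end strongEven

end CoxRep

namespace CoxRep

section final

lemma exists_max {W : Type} [Group W] {S : Set W} (hS : IsCoxGenSet S) {T : Set W}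
    (hT : IsSpherical S T) : ∃ U, IsMaxSpherical S U ∧ T ⊆ U := by
  have hfin : {U | IsSpherical S U}.Finite :=
    hS.1.finite_subsets.subset fun U hU => hU.1
  obtain ⟨U, hTU, hU⟩ := hfin.exists_le_maximal hT
  exact ⟨U, ⟨hU.1, fun V hV hUV => (hU.2 hV hUV).antisymm hUV⟩, hTU⟩

lemma mul_order_comm {W : Type} [Group W] (s t : W) : orderOf (s * t) = orderOf (t * s) := by
  have h : MulAut.conj t (s * t) = t * s := by simp [mul_assoc]
  rw [← h, MulEquiv.orderOf_eq]

lemma dihedral_finite {W : Type} [Group W] {s t : W} (hs : s * s = 1) (ht : t * t = 1)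
    (h : orderOf (s * t) ≠ 0) : ((Subgroup.closure {s, t} : Subgroup W) : Set W).Finite := by
  have hz : ((Subgroup.zpowers (s * t) : Subgroup W) : Set W).Finite := by
    rw [finite_zpowers, ← orderOf_pos_iff]; omega
  refine (hz.union (hz.image (· * s))).subset fun x hx => ?_
  obtain ⟨k, hk | hk⟩ := dihedral_decomp (G := Subgroup.closure {s, t}) (Subtype.ext hs)
    (Subtype.ext ht) closure_pair_top ⟨x, hx⟩
  · have := congrArg Subtype.val hk
    left; exact ⟨k, by simpa using this.symm⟩
  · have := congrArg Subtype.val hk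
    right; exact ⟨_, ⟨k, rfl⟩, by simpa using this.symm⟩

variable {W W' : Type} [Group W] [Group W'] {S : Set W} {S' : Set W'}

def Corr (S : Set W) (φ : W ≃* W') (T : Set W) (T' : Set W') : Prop :=
  IsMaxSpherical S T ∧
    ∃ w : W, ∀ x, x ∈ Subgroup.closure T ↔ φ (w * x * w⁻¹) ∈ Subgroup.closure T'

lemma exists_corr (hS : IsCoxGenSet S) (hS' : IsCoxGenSet S') (φ : W ≃* W') {T' : Set W'}
    (hT' : IsMaxSpherical S' T') : ∃ T, Corr S φ T T' := by
  obtain ⟨w, T0, hT0, hw⟩ := cox_conj hS ((Subgroup.closure T').map φ.symm.toMonoidHom)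
    (by rw [Subgroup.coe_map]; exact hT'.1.2.image _)
  obtain ⟨T, hT, hTT⟩ := exists_max hS hT0
  let c : W →* W' := ((MulAut.conj w).trans φ).toMonoidHom
  have hc : ∀ x, c x = φ (w * x * w⁻¹) := fun x => rfl
  have hinj : Function.Injective c := ((MulAut.conj w).trans φ).injective
  let K := (Subgroup.closure T).map c
  have hK : (K : Set W').Finite := by
    rw [Subgroup.coe_map]; exact hT.1.2.image _
  have hsub : Subgroup.closure T' ≤ K := by
    intro x hx
    refine ⟨w⁻¹ * φ.symm x * w, Subgroup.closure_mono hTT (hw _ ⟨x, hx, rfl⟩), ?_⟩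
    rw [hc]
    have : w * (w⁻¹ * φ.symm x * w) * w⁻¹ = φ.symm x := by group
    rw [this]; simp
  obtain ⟨v, U, hU, hv⟩ := cox_conj hS' K hK
  have hUT : U = T' := cox_uniq hS' hT' hU v fun h hh => hv h (hsub hh)
  subst hUT
  have heq : (Subgroup.closure U : Set W') = K := by
    refine Set.eq_of_subset_of_ncard_le hsub ?_ hK
    refine Set.ncard_le_ncard_of_injOn (fun x => v⁻¹ * x * v) hv ?_ hU.2
    intro x _ y _ h
    exact mul_left_cancel (mul_right_cancel h)
  refine ⟨T, hT, w, fun x => ?_⟩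
  have : φ (w * x * w⁻¹) ∈ Subgroup.closure U ↔ φ (w * x * w⁻¹) ∈ K := by
    rw [← SetLike.mem_coe, heq, SetLike.mem_coe]
  rw [this, ← hc]
  exact (Subgroup.mem_map_iff_mem hinj).symm

lemma Corr.equiv {φ : W ≃* W'} {T : Set W} {T' : Set W'} (h : Corr S φ T T') :
    Nonempty (Subgroup.closure T ≃* Subgroup.closure T') := by
  obtain ⟨_, w, hw⟩ := h
  have e : (Subgroup.closure T).map ((MulAut.conj w).trans φ).toMonoidHom
      = Subgroup.closure T' := by
    ext y
    constructor
    · rintro ⟨x, hx, rfl⟩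
      exact (hw x).1 hx
    · intro hy
      refine ⟨((MulAut.conj w).trans φ).symm y, (hw _).2 ?_, MulEquiv.apply_symm_apply _ _⟩
      have := ((MulAut.conj w).trans φ).apply_symm_apply y
      have h2 : φ (w * (((MulAut.conj w).trans φ).symm y) * w⁻¹) = y := this
      rwa [h2]
  exact ⟨(((MulAut.conj w).trans φ).subgroupMap (Subgroup.closure T)).trans
    (MulEquiv.subgroupCongr e)⟩

lemma Corr.inj (hS' : IsCoxGenSet S') {φ : W ≃* W'} {T : Set W} {T₁ T₂ : Set W'}
    (m₁ : IsMaxSpherical S' T₁) (m₂ : IsMaxSpherical S' T₂)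
    (h₁ : Corr S φ T T₁) (h₂ : Corr S φ T T₂) : T₁ = T₂ := by
  obtain ⟨_, w, hw⟩ := h₁
  obtain ⟨_, v, hv⟩ := h₂
  refine (cox_uniq hS' m₁ m₂.1 (φ (w * v⁻¹)) fun x hx => ?_).symm
  have h1 : w⁻¹ * φ.symm x * w ∈ Subgroup.closure T := by
    rw [hw]
    have : w * (w⁻¹ * φ.symm x * w) * w⁻¹ = φ.symm x := by group
    rwa [this, MulEquiv.apply_symm_apply]
  have h2 := (hv _).1 h1
  have h3 : φ (v * (w⁻¹ * φ.symm x * w) * v⁻¹) = (φ (w * v⁻¹))⁻¹ * x * φ (w * v⁻¹) := by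
    simp [mul_assoc]
  rwa [h3] at h2

lemma max_type (hc : Conds S) {T : Set W} (hT : IsMaxSpherical S T) :
    IsStrongEvenSet T ∨ ∃ s ∈ S, ∃ t ∈ S, s ≠ t ∧ Odd (orderOf (s * t)) ∧ T = {s, t} := by
  by_cases h : ∃ s ∈ T, ∃ t ∈ T, s ≠ t ∧ Odd (orderOf (s * t))
  · obtain ⟨s, hs, t, ht, hst, ho⟩ := h
    right
    refine ⟨s, hT.1.1 hs, t, hT.1.1 ht, hst, ho, ?_⟩
    exact (hc.2.1 s (hT.1.1 hs) t (hT.1.1 ht) hst ho).2 T hT.1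
      (by rintro _ (rfl | rfl) <;> assumption)
  · left
    intro s hs t ht hst
    refine hc.1 s (hT.1.1 hs) t (hT.1.1 ht) hst ?_
    rw [← Nat.not_odd_iff_even]
    exact fun ho => h ⟨s, hs, t, ht, hst, ho⟩

lemma corr_strong (hS : IsCoxGenSet S) (hS' : IsCoxGenSet S') {φ : W ≃* W'} {T : Set W}
    {T' : Set W'} (hT' : T' ⊆ S') (h : Corr S φ T T') (hT : IsStrongEvenSet T) :
    IsStrongEvenSet T' := by
  obtain ⟨e⟩ := h.equiv
  have : Finite (Subgroup.closure T) := h.1.1.2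
  obtain ⟨hL, hQ⟩ := lemA (cox_par hS h.1.1.1) (strong_pre hT (le_refl T))
  have hB := lemB (cox_par hS' hT') (hL.equiv e) (hQ.equiv e)
  intro s hs t ht hst
  have := hB ⟨s, Subgroup.subset_closure hs⟩ hs ⟨t, Subgroup.subset_closure ht⟩ ht
    (fun e => hst (congrArg Subtype.val e))
  rwa [← Subgroup.orderOf_coe] at this

lemma corr_odd (hS : IsCoxGenSet S) {φ : W ≃* W'} {s t : W} (hs : s ∈ S) (ht : t ∈ S)
    (ho : Odd (orderOf (s * t))) {T' : Set W'} (h : Corr S φ {s, t} T') :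
    Law (Subgroup.closure T') ∧ OO (Subgroup.closure T') := by
  obtain ⟨e⟩ := h.equiv
  have ss := cox_sq hS hs
  have tt := cox_sq hS ht
  refine ⟨(dihedral_law (Subtype.ext ss) (Subtype.ext tt) closure_pair_top).equiv e,
    (dihedral_OO (Subtype.ext ss) (Subtype.ext tt) closure_pair_top ?_).equiv e⟩
  rwa [← Subgroup.orderOf_coe]

lemma oddpair (hS : IsCoxGenSet S) (hS' : IsCoxGenSet S') (φ : W ≃* W') (hc : Conds S)
    {s' t' : W'} (hs' : s' ∈ S') (ht' : t' ∈ S') (hst' : s' ≠ t') (ho' : Odd (orderOf (s' * t'))) :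
    IsMaxSpherical S' {s', t'} ∧ ∃ s ∈ S, ∃ t ∈ S, s ≠ t ∧ Odd (orderOf (s * t)) ∧
      Corr S φ {s, t} {s', t'} := by
  have ss := cox_sq hS' hs'
  have tt := cox_sq hS' ht'
  have hn0 : orderOf (s' * t') ≠ 0 := by rintro e; rw [e] at ho'; exact absurd ho' (by decide)
  have hn2 : orderOf (s' * t') ≠ 2 := by rintro e; rw [e] at ho'; exact absurd ho' (by decide)
  obtain ⟨T', hT', hsub⟩ := exists_max hS' (T := {s', t'})
    ⟨by rintro _ (rfl | rfl) <;> assumption, dihedral_finite ss tt hn0⟩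
  have hsT : s' ∈ T' := hsub (by simp)
  have htT : t' ∈ T' := hsub (by simp)
  obtain ⟨T, hT⟩ := exists_corr hS hS' φ hT'
  rcases max_type hc hT.1 with hse | ⟨s, hs, t, ht, hst, ho, rfl⟩
  · exfalso
    rcases corr_strong hS hS' hT'.1.1 hT hse s' hsT t' htT hst' with h | h
    · exact hn2 h
    · obtain ⟨m, hm⟩ := ho'
      omega
  · obtain ⟨hL, hO⟩ := corr_odd hS hs ht ho hT
    have hnc := not_comm_of hS' hs' ht' hst' hn2
    have hE : T' = {s', t'} := by
      refine Set.Subset.antisymm (fun u hu => ?_) hsub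
      by_contra hcon
      simp only [Set.mem_insert_iff, Set.mem_singleton_iff, not_or] at hcon
      obtain ⟨c1, c2⟩ := others (cox_par hS' hT'.1.1) hL
        (s := ⟨s', Subgroup.subset_closure hsT⟩) (t := ⟨t', Subgroup.subset_closure htT⟩)
        (u := ⟨u, Subgroup.subset_closure hu⟩) hsT htT hu
        (fun e => hnc (congrArg Subtype.val e.eq)) (fun e => hcon.1 (congrArg Subtype.val e))
        (fun e => hcon.2 (congrArg Subtype.val e))
      have d1 : Commute u s' := congrArg Subtype.val c1.eq
      have d2 : Commute u t' := congrArg Subtype.val c2.eq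
      have d : Commute (s' * t') u := (d1.mul_right d2).symm
      have uu := cox_sq hS' (hT'.1.1 hu)
      have u1 := cox_ne_one hS' (hT'.1.1 hu)
      have hx := hO ⟨s' * t' * u, Subgroup.mul_mem _ (Subgroup.mul_mem _
        (Subgroup.subset_closure hsT) (Subgroup.subset_closure htT)) (Subgroup.subset_closure hu)⟩
      rw [← Subgroup.orderOf_coe] at hx
      rcases hx with hx | hx
      · have hx' : (s' * t' * u) * (s' * t' * u) = 1 := congrArg Subtype.val hx
        rw [← pow_two, d.mul_pow, pow_two u, uu, mul_one] at hx'
        exact hnc (comm_of_sq ss tt hx')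
      · have hx' : (s' * t' * u) ^ orderOf (s' * t' * u) = 1 := pow_orderOf_eq_one _
        change Odd (orderOf (s' * t' * u)) at hx
        revert hx hx'
        generalize orderOf (s' * t' * u) = n
        rintro hx' ⟨k, rfl⟩
        rw [d.mul_pow, pow_succ u, pow_mul, pow_two, uu, one_pow, one_mul] at hx'
        have hu' : u = ((s' * t') ^ (2 * k + 1))⁻¹ := eq_inv_of_mul_eq_one_right hx'
        apply u1
        refine odd_sq ?_ uu
        rw [hu', orderOf_inv]
        exact_mod_cast odd_zpow ho' ((2 * k + 1 : ℕ) : ℤ)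
    subst hE
    exact ⟨hT', s, hs, t, ht, hst, ho, hT⟩

lemma exists_eps (hS : IsCoxGenSet S) (hc : Conds S) {s t : W} (hs : s ∈ S) (ht : t ∈ S)
    (hst : s ≠ t) (ho : Odd (orderOf (s * t))) :
    ∃ ε : W →* ℤˣ, ε s = -1 ∧ ε t = -1 ∧ ∀ u ∈ S, u ≠ s → u ≠ t → ε u = 1 := by
  classical
  let f : W → ℤˣ := fun x => if x = s ∨ x = t then -1 else 1
  have f1 : ∀ x, (x = s ∨ x = t) → f x = -1 := fun x h => by simp only [f, if_pos h]
  have f2 : ∀ x, ¬ (x = s ∨ x = t) → f x = 1 := fun x h => by simp only [f, if_neg h]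
  have ho2 : Odd (orderOf (t * s)) := by rwa [mul_order_comm]
  have hev : ∀ x u, (x = s ∨ x = t) → ¬ (u = s ∨ u = t) → u ∈ S → Even (orderOf (x * u)) := by
    intro x u hx hu huS
    rw [← Nat.not_odd_iff_even]
    intro hodd
    rw [not_or] at hu
    rcases hx with rfl | rfl
    · exact hc.2.2.1 ⟨t, ht, x, hs, u, huS, hst.symm, Ne.symm hu.1, Ne.symm hu.2, ho2, hodd⟩
    · exact hc.2.2.1 ⟨s, hs, x, ht, u, huS, hst, Ne.symm hu.2, Ne.symm hu.1, ho, hodd⟩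
  obtain ⟨ψ, hψ⟩ := cox_lift hS f (fun x _ => Int.units_mul_self _) (by
    intro x hx y hy hxy
    by_cases h1 : x = s ∨ x = t
    · by_cases h2 : y = s ∨ y = t
      · rw [f1 x h1, f1 y h2]; simp
      · rw [f1 x h1, f2 y h2, mul_one]
        exact (hev x y h1 h2 hy).neg_one_pow
    · by_cases h2 : y = s ∨ y = t
      · rw [f2 x h1, f1 y h2, one_mul, mul_order_comm]
        exact (hev y x h2 h1 hx).neg_one_pow
      · rw [f2 x h1, f2 y h2]; simp)
  exact ⟨ψ, (hψ s hs).trans (f1 s (Or.inl rfl)), (hψ t ht).trans (f1 t (Or.inr rfl)),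
    fun u hu h1 h2 => (hψ u hu).trans (f2 u (by tauto))⟩

lemma eps_conj (ε : W →* ℤˣ) (w x : W) : ε (w * x * w⁻¹) = ε x := by
  rw [map_mul, map_mul, map_inv, mul_comm, inv_mul_cancel_left]

lemma Corr.elt {φ : W ≃* W'} {T : Set W} {T' : Set W'} (h : Corr S φ T T') {y : W'}
    (hy : y ∈ T') : ∃ k ∈ Subgroup.closure T, ∃ w : W, φ (w * k * w⁻¹) = y := by
  obtain ⟨_, w, hw⟩ := h
  have : w * (w⁻¹ * φ.symm y * w) * w⁻¹ = φ.symm y := by group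
  refine ⟨w⁻¹ * φ.symm y * w, ?_, w, by rw [this, MulEquiv.apply_symm_apply]⟩
  rw [hw, this, MulEquiv.apply_symm_apply]
  exact Subgroup.subset_closure hy

lemma eps_neg (hS : IsCoxGenSet S) (hS' : IsCoxGenSet S') {φ : W ≃* W'} {s t : W}
    (hs : s ∈ S) (ht : t ∈ S) (ho : Odd (orderOf (s * t))) {T' : Set W'} (hT' : T' ⊆ S')
    (h : Corr S φ {s, t} T') (ε : W →* ℤˣ) (e1 : ε s = -1) (e2 : ε t = -1) {y : W'}
    (hy : y ∈ T') : ε (φ.symm y) = -1 := by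
  have ss := cox_sq hS hs
  have tt := cox_sq hS ht
  obtain ⟨k, hk, w, rfl⟩ := h.elt hy
  have yy := cox_sq hS' (hT' hy)
  have y1 := cox_ne_one hS' (hT' hy)
  rw [MulEquiv.symm_apply_apply, eps_conj]
  have k1 : k ≠ 1 := by rintro rfl; simp at y1
  have kk : k * k = 1 := by
    rw [← map_mul, MulEquiv.map_eq_one_iff] at yy
    have h3 : w * k * w⁻¹ * (w * k * w⁻¹) = w * (k * k) * w⁻¹ := by group
    rwa [h3, conj_eq_one_iff] at yy
  obtain ⟨j, hj | hj⟩ := dihedral_decomp (G := Subgroup.closure {s, t}) (Subtype.ext ss)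
    (Subtype.ext tt) closure_pair_top ⟨k, hk⟩
  · exfalso
    have hj' : k = (s * t) ^ j := by simpa using congrArg Subtype.val hj
    exact k1 (odd_sq (hj' ▸ odd_zpow ho j) kk)
  · have hj' : k = (s * t) ^ j * s := by simpa using congrArg Subtype.val hj
    rw [hj', map_mul, map_zpow, map_mul, e1, e2]
    simp

lemma meets {φ : W ≃* W'} {s t : W} (ε : W →* ℤˣ)
    (e : ∀ u ∈ S, u ≠ s → u ≠ t → ε u = 1) {T : Set W} {T' : Set W'} (h : Corr S φ T T') {y : W'}
    (hy : y ∈ T') (hε : ε (φ.symm y) = -1) : (T ∩ {s, t}).Nonempty := by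
  obtain ⟨k, hk, w, rfl⟩ := h.elt hy
  rw [MulEquiv.symm_apply_apply, eps_conj] at hε
  by_contra hcon
  rw [Set.not_nonempty_iff_eq_empty] at hcon
  have hle : Subgroup.closure T ≤ ε.ker := by
    rw [Subgroup.closure_le]
    intro u hu
    have hn : u ∉ ({s, t} : Set W) := fun h' => by
      have : u ∈ T ∩ {s, t} := ⟨hu, h'⟩
      rw [hcon] at this
      exact this
    simp only [Set.mem_insert_iff, Set.mem_singleton_iff, not_or] at hn
    exact e u (h.1.1.1 hu) hn.1 hn.2
  have : ε k = 1 := hle hk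
  rw [this] at hε
  exact absurd hε (by decide)

lemma pair_eq (h2 : Cond2 S) {s t a b : W} (hs : s ∈ S) (ht : t ∈ S) (ha : a ∈ S) (hb : b ∈ S)
    (hst : s ≠ t) (hab : a ≠ b) (h : Odd (orderOf (s * t))) (h' : Odd (orderOf (a * b)))
    (hne : (({a, b} : Set W) ∩ {s, t}).Nonempty) : ({a, b} : Set W) = {s, t} := by
  have hsym : Odd (orderOf (t * s)) := by rwa [mul_order_comm]
  have hsym' : Odd (orderOf (b * a)) := by rwa [mul_order_comm]
  obtain ⟨x, hx1, hx2⟩ := hne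
  by_contra hcon
  rcases hx1 with rfl | rfl <;> rcases hx2 with rfl | rfl
  · exact h2 ⟨t, ht, x, hs, b, hb, hst.symm, hab, fun e => hcon (by rw [e]), hsym, h'⟩
  · exact h2 ⟨s, hs, x, ht, b, hb, hst, hab, fun e => hcon (by rw [e, Set.pair_comm]), h, h'⟩
  · exact h2 ⟨t, ht, x, hs, a, ha, hst.symm, hab.symm,
      fun e => hcon (by rw [e, Set.pair_comm]), hsym, hsym'⟩
  · exact h2 ⟨s, hs, x, ht, a, ha, hst, hab.symm, fun e => hcon (by rw [e]), h, hsym'⟩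

theorem transfer (hS : IsCoxGenSet S) (hS' : IsCoxGenSet S') (φ : W ≃* W')
    (hc : Conds S) : Conds S' := by
  refine ⟨?_, ?_, ?_, ?_⟩
  · intro s hs t ht hst he
    by_cases h0 : orderOf (s * t) = 0
    · right; rw [h0]; exact dvd_zero 4
    obtain ⟨T', hT', hsub⟩ := exists_max hS' (T := {s, t})
      ⟨by rintro _ (rfl | rfl) <;> assumption,
        dihedral_finite (cox_sq hS' hs) (cox_sq hS' ht) h0⟩
    have hsT : s ∈ T' := hsub (by simp)
    have htT : t ∈ T' := hsub (by simp)
    obtain ⟨T, hT⟩ := exists_corr hS hS' φ hT'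
    rcases max_type hc hT.1 with hse | ⟨a, ha, b, hb, hab, ho, rfl⟩
    · exact corr_strong hS hS' hT'.1.1 hT hse s hsT t htT hst
    · obtain ⟨hL, hO⟩ := corr_odd hS ha hb ho hT
      have hx := hO ⟨s * t, Subgroup.mul_mem _
        (Subgroup.subset_closure hsT) (Subgroup.subset_closure htT)⟩
      rw [← Subgroup.orderOf_coe] at hx
      rcases hx with hx | hx
      · have hx' : (s * t) * (s * t) = 1 := congrArg Subtype.val hx
        left
        have h1 : orderOf (s * t) ∣ 2 := orderOf_dvd_of_pow_eq_one (by rw [pow_two, hx'])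
        rcases (Nat.dvd_prime Nat.prime_two).1 h1 with h3 | h3
        · rw [h3] at he; exact absurd he (by decide)
        · exact h3
      · exact absurd he (Nat.not_even_iff_odd.2 hx)
  · intro s hs t ht hst ho
    exact (oddpair hS hS' φ hc hs ht hst ho).1
  · rintro ⟨s', hs', t', ht', u', hu', hst, htu, hsu, o1, o2⟩
    obtain ⟨m1, s, hs, t, ht, n1, p1, c1⟩ := oddpair hS hS' φ hc hs' ht' hst o1
    obtain ⟨m2, a, ha, b, hb, n2, p2, c2⟩ := oddpair hS hS' φ hc ht' hu' htu o2
    obtain ⟨ε, e1, e2, e3⟩ := exists_eps hS hc hs ht n1 p1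
    have h1 := eps_neg hS hS' hs ht p1 m1.1.1 c1 ε e1 e2 (y := t') (by simp)
    have h2 := meets ε e3 c2 (y := t') (by simp) h1
    rw [pair_eq hc.2.2.1 hs ht ha hb n1 n2 p1 p2 h2] at c2
    have h3 := Corr.inj hS' m1 m2 c1 c2
    have h4 : u' ∈ ({s', t'} : Set W') := by rw [h3]; simp
    rcases h4 with h4 | h4
    · exact hsu h4.symm
    · exact htu h4.symm
  · intro s' hs' t' ht' hst ho T₁ T₂ T₃ h₁ h₂ h₃
    obtain ⟨m, s, hs, t, ht, n, p, c⟩ := oddpair hS hS' φ hc hs' ht' hst ho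
    obtain ⟨ε, e1, e2, e3⟩ := exists_eps hS hc hs ht n p
    have key : ∀ T', (IsMaxSpherical S' T' ∧ (T' ∩ {s', t'}).Nonempty) →
        ∃ T, Corr S φ T T' ∧ (T ∩ {s, t}).Nonempty := by
      rintro T' ⟨hT', y, hy1, hy2⟩
      obtain ⟨T, hT⟩ := exists_corr hS hS' φ hT'
      exact ⟨T, hT, meets ε e3 hT hy1 (eps_neg hS hS' hs ht p m.1.1 c ε e1 e2 hy2)⟩
    obtain ⟨U₁, k₁, n₁⟩ := key T₁ h₁
    obtain ⟨U₂, k₂, n₂⟩ := key T₂ h₂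
    obtain ⟨U₃, k₃, n₃⟩ := key T₃ h₃
    rcases hc.2.2.2 s hs t ht n p U₁ U₂ U₃ ⟨k₁.1, n₁⟩ ⟨k₂.1, n₂⟩ ⟨k₃.1, n₃⟩ with e | e | e
    · subst e; exact Or.inl (Corr.inj hS' h₁.1 h₂.1 k₁ k₂)
    · subst e; exact Or.inr (Or.inl (Corr.inj hS' h₁.1 h₃.1 k₁ k₃))
    · subst e; exact Or.inr (Or.inr (Corr.inj hS' h₂.1 h₃.1 k₂ k₃))

end final

end CoxRep

/-- Conditions (0)–(3) transfer along an isomorphism of Coxeter groups. -/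
theorem conds_transfer {W W' : Type} [Group W] [Group W'] (S : Set W) (S' : Set W')
    (hS : IsCoxGenSet S) (hS' : IsCoxGenSet S') (φ : W ≃* W')
    (hc : Conds S) : Conds S' := by
  exact CoxRep.transfer hS hS' φ hc
end

section
/- Let φ: W → W' be an isomorphism of Coxeter groups with Coxeter systems (W,S), (W',S') satisfying conditions (0)–(3) and (0')–(3') respectively. Let S̄ be the union of all maximal spherical subsets T of S for which (W_T, T) is strong even, and define S̄' analogously. Then for each maximal independent subset T of S̄, there exists a unique maximal independent subset T' of S̄' such that π'(φ(W_T)) = π'(W'_{T'}), where π' is the abelianization map of W'. -/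
open Subgroup

/-- Transversal weights for a fixed point free permutation of prime order. -/
lemma trans_exists {Y k : Type*} [AddCommMonoidWithOne k] (p : ℕ) (hp : p.Prime) (σ : Equiv.Perm Y)
    (hσ : σ ^ p = 1) (hf : ∀ y, σ y ≠ y) :
    ∃ e : Y → k, ∀ y, ∑ i ∈ Finset.range p, e ((σ ^ i) y) = 1 := by
  classical
  let st := Equiv.Perm.SameCycle.setoid σ
  refine ⟨fun y => if (Quotient.out (s := st) (Quotient.mk st y)) = y then 1 else 0, fun y => ?_⟩
  set o := Quotient.out (s := st) (Quotient.mk st y) with ho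
  have hoy : σ.SameCycle y o := (Quotient.exact (Quotient.out_eq (Quotient.mk st y))).symm
  have hmk : ∀ i : ℕ, Quotient.mk st ((σ ^ i) y) = Quotient.mk st y := by
    intro i
    apply Quotient.sound
    show σ.SameCycle _ _
    exact ⟨-(i : ℤ), by simp⟩
  have hpm : Function.IsPeriodicPt σ p y := by
    have := congrArg (fun τ : Equiv.Perm Y => τ y) hσ
    simpa [Function.IsPeriodicPt, Function.IsFixedPt, Equiv.Perm.iterate_eq_pow] using this
  have hmin : Function.minimalPeriod σ y = p := by
    rcases (Nat.dvd_prime hp).1 hpm.minimalPeriod_dvd with h | h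
    · exact absurd (Function.minimalPeriod_eq_one_iff_isFixedPt.1 h) (hf y)
    · exact h
  obtain ⟨i0, hi0, hi0'⟩ : ∃ i < p, (σ ^ i) y = o := by
    obtain ⟨n, hn⟩ := hoy
    have hpz : (0 : ℤ) < p := by exact_mod_cast hp.pos
    refine ⟨(n % p).toNat, ?_, ?_⟩
    · have := Int.emod_lt_of_pos n hpz
      have := Int.emod_nonneg n hpz.ne'
      omega
    · rw [← hn]
      have h1 := Int.emod_nonneg n hpz.ne'
      have : σ ^ n = σ ^ (n % p).toNat := by
        rw [← zpow_natCast, Int.toNat_of_nonneg h1]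
        conv_lhs => rw [← Int.emod_add_mul_ediv n p, zpow_add, zpow_mul, zpow_natCast, hσ]
        simp
      rw [this]
  rw [Finset.sum_eq_single i0]
  · beta_reduce
    rw [hmk, if_pos (by rw [hi0', ho])]
  · intro j hj hji
    beta_reduce
    rw [hmk, if_neg]
    intro h
    apply hji
    have : σ^[j] y = σ^[i0] y := by
      rw [Equiv.Perm.iterate_eq_pow, Equiv.Perm.iterate_eq_pow, hi0', ho]; exact h.symm
    have hj' : j < p := Finset.mem_range.1 hj
    rw [← hmin] at hj' hi0
    exact Function.iterate_injOn_Iio_minimalPeriod hj' hi0 this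
  · intro h; exact absurd (Finset.mem_range.2 hi0) h

/-- The permutation module. -/
noncomputable def LL (k : Type*) [CommRing k] {W : Type*} [Group W] {Y : Type*} [MulAction W Y] (g : W) :
    (Y →₀ k) →ₗ[k] (Y →₀ k) := Finsupp.lmapDomain k k (fun y => g • y)

lemma LL_single (k : Type*) [CommRing k] {W : Type*} [Group W] {Y : Type*} [MulAction W Y] (g : W)
    (y : Y) (c : k) : LL k g (Finsupp.single y c) = Finsupp.single (g • y) c := by
  simp [LL]

lemma LL_mul (k : Type*) [CommRing k] {W : Type*} [Group W] {Y : Type*} [MulAction W Y] (g h : W)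
    (z : Y →₀ k) : LL k (g * h) z = LL k g (LL k h z) := by
  induction z using Finsupp.induction_linear with
  | zero => simp
  | add f g hf hg => simp [hf, hg]
  | single a b => simp [LL_single, mul_smul]

lemma LL_one (k : Type*) [CommRing k] {W : Type*} [Group W] {Y : Type*} [MulAction W Y]
    (z : Y →₀ k) : LL k (1 : W) z = z := by
  induction z using Finsupp.induction_linear with
  | zero => simp
  | add f g hf hg => simp [hf, hg]
  | single a b => simp [LL_single]

lemma LL_apply (k : Type*) [CommRing k] {W : Type*} [Group W] {Y : Type*} [MulAction W Y] (g : W)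
    (z : Y →₀ k) (y : Y) : LL k g z y = z (g⁻¹ • y) := by
  have : y = g • (g⁻¹ • y) := by simp
  conv_lhs => rw [this]
  unfold LL
  rw [Finsupp.lmapDomain_apply, Finsupp.mapDomain_apply (MulAction.injective g)]

lemma free_op (k : Type*) [CommRing k] {W : Type*} [Group W] {Y : Type*} [MulAction W Y] (x : W)
    (p : ℕ) (hp : p.Prime) (hx : x ^ p = 1) (hf : ∀ y : Y, x • y ≠ y) :
    ∃ m : (Y →₀ k) →ₗ[k] (Y →₀ k), ∀ z,
      ∑ i ∈ Finset.range p, LL k (x ^ i) (m (LL k ((x ^ i)⁻¹) z)) = z := by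
  obtain ⟨e, he⟩ := trans_exists (k := k) p hp (MulAction.toPerm x⁻¹ : Equiv.Perm Y)
    (by ext y
        have : ∀ n : ℕ, ((MulAction.toPerm x⁻¹ : Equiv.Perm Y) ^ n) y = (x ^ n)⁻¹ • y := by
          intro n
          rw [← inv_pow]
          exact (congrArg (fun f : Equiv.Perm Y => f y)
            (map_pow (MulAction.toPermHom W Y) x⁻¹ n)).symm
        rw [this, hx]; simp)
    (by intro y h
        apply hf y
        have h' : x⁻¹ • y = y := h
        rw [inv_smul_eq_iff] at h'
        exact h'.symm)
  have hpow : ∀ (n : ℕ) (y : Y), ((MulAction.toPerm x⁻¹ : Equiv.Perm Y) ^ n) y = (x ^ n)⁻¹ • y := by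
    intro n y
    rw [← inv_pow]
    exact (congrArg (fun f : Equiv.Perm Y => f y)
      (map_pow (MulAction.toPermHom W Y) x⁻¹ n)).symm
  refine ⟨Finsupp.linearCombination k (fun y => Finsupp.single y (e y)), fun z => ?_⟩
  induction z using Finsupp.induction_linear with
  | zero => simp
  | add f g hf hg => simp [Finset.sum_add_distrib, hf, hg]
  | single y c =>
    have : ∀ i ∈ Finset.range p, LL k (x ^ i) (Finsupp.linearCombination k
        (fun y => Finsupp.single y (e y)) (LL k ((x ^ i)⁻¹) (Finsupp.single y c)))
        = Finsupp.single y (c * e (((MulAction.toPerm x⁻¹ : Equiv.Perm Y) ^ i) y)) := by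
      intro i _
      rw [hpow, LL_single, Finsupp.linearCombination_single, Finsupp.smul_single, LL_single]
      simp
    rw [Finset.sum_congr rfl this, ← Finsupp.single_finsetSum, ← Finset.mul_sum, he, mul_one]

/-- Abstract fixed point theorem: an element of prime order acting on an algebraic tree
with free action on edges has exactly one fixed vertex. -/
lemma fix_unique {W : Type*} [Group W] {E V : Type*} [MulAction W E] [MulAction W V]
    (p : ℕ) (hp : p.Prime) (x : W) (hx : x ^ p = 1) (hE : ∀ y : E, x • y ≠ y)
    (d : (E →₀ ZMod p) →ₗ[ZMod p] (V →₀ ZMod p)) (D : (V →₀ ZMod p) →ₗ[ZMod p] (E →₀ ZMod p))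
    (hd : ∀ z, d (LL _ x z) = LL _ x (d z)) (hDd : ∀ z, D (d z) = z) (v₀ : V)
    (hdD : ∀ v, d (D (Finsupp.single v 1)) = Finsupp.single v 1 - Finsupp.single v₀ 1)
    (hd0 : ∀ z, Finsupp.linearCombination (ZMod p) (fun _ : V => (1 : ZMod p)) (d z) = 0) :
    ∃! v : V, x • v = v := by
  classical
  have : Fact p.Prime := ⟨hp⟩
  have dinj : ∀ a b, d a = d b → a = b := fun a b h => by rw [← hDd a, h, hDd]
  obtain ⟨m, hm⟩ := free_op (ZMod p) x p hp hx hE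
  have hp0 : (p : ZMod p) = 0 := by simp
  refine existsUnique_of_exists_of_unique ?_ ?_
  · by_contra hno
    push Not at hno
    obtain ⟨n, hn⟩ := free_op (ZMod p) x p hp hx hno
    let y : ℕ → (E →₀ ZMod p) := fun i => D (Finsupp.single (x ^ i • v₀) 1)
    have hdy : ∀ i, d (y i) = Finsupp.single (x ^ i • v₀) 1 - Finsupp.single v₀ 1 := fun i => hdD _
    have hyc : ∀ i, LL _ x (y i) = y (i + 1) - y 1 := by
      intro i
      apply dinj
      rw [hd, map_sub, hdy, hdy, hdy, map_sub, LL_single, LL_single, pow_succ', mul_smul, pow_one]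
      abel
    let g : ℕ → (E →₀ ZMod p) := fun i => LL _ (x ^ i) (m (LL _ ((x ^ i)⁻¹) (y i)))
    have hshift : ∀ f : ℕ → (E →₀ ZMod p), f p = f 0 →
        ∑ i ∈ Finset.range p, f (i + 1) = ∑ i ∈ Finset.range p, f i := by
      intro f h
      have h1 := Finset.sum_range_succ f p
      have h2 := Finset.sum_range_succ' f p
      rw [h1, h] at h2
      exact (add_right_cancel h2).symm
    let u := ∑ i ∈ Finset.range p, g i
    have hu : LL _ x u = u - y 1 := by
      have h1 : ∀ i ∈ Finset.range p, LL _ x (g i) = g (i + 1) -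
          LL _ (x ^ (i + 1)) (m (LL _ ((x ^ (i + 1))⁻¹) (y 1))) := by
        intro i _
        have : y (i + 1) = LL _ x (y i) + y 1 := by rw [hyc]; abel
        simp only [g]
        rw [this, map_add, map_add, map_add, ← LL_mul, ← LL_mul]
        have e1 : (x ^ (i + 1))⁻¹ * x = (x ^ i)⁻¹ := by rw [pow_succ']; group
        rw [e1, ← pow_succ']
        abel
      simp only [u]
      rw [map_sum, Finset.sum_congr rfl h1, Finset.sum_sub_distrib,
        hshift g (by simp [g, y, hx]),
        hshift (fun i => LL _ (x ^ i) (m (LL _ ((x ^ i)⁻¹) (y 1)))) (by simp [hx]), hm]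
    let z : V →₀ ZMod p := Finsupp.single v₀ 1 + d u
    have hz : LL _ x z = z := by
      simp only [z]
      rw [map_add, ← hd, hu, map_sub, hdy, LL_single, pow_one]
      abel
    have hzi : ∀ i : ℕ, LL _ (x ^ i) z = z := by
      intro i
      induction i with
      | zero => simp [LL_one]
      | succ i ih => rw [pow_succ, LL_mul, hz, ih]
    have hzi' : ∀ i : ℕ, LL _ ((x ^ i)⁻¹) z = z := by
      intro i
      conv_lhs => rw [← hzi i]
      rw [← LL_mul]; simp [LL_one]
    have hεL : ∀ (w : W) (z : V →₀ ZMod p), Finsupp.linearCombination (ZMod p)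
        (fun _ : V => (1 : ZMod p)) (LL _ w z) =
        Finsupp.linearCombination (ZMod p) (fun _ : V => (1 : ZMod p)) z := by
      intro w z
      induction z using Finsupp.induction_linear with
      | zero => simp
      | add f g hf hg => simp [hf, hg]
      | single a b => simp [LL_single]
    have hε : Finsupp.linearCombination (ZMod p) (fun _ : V => (1 : ZMod p)) z = 1 := by
      simp only [z]; rw [map_add, hd0]; simp
    have hε0 : Finsupp.linearCombination (ZMod p) (fun _ : V => (1 : ZMod p)) z = 0 := by
      rw [← hn z, map_sum]
      simp only [hεL, hzi']
      simp
    rw [hε] at hε0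
    exact one_ne_zero hε0
  · intro v1 v2 h1 h2
    by_contra hne
    let y := D (Finsupp.single v1 1) - D (Finsupp.single v2 1)
    have hdy : d y = Finsupp.single v1 1 - Finsupp.single v2 1 := by
      simp only [y]; rw [map_sub, hdD, hdD]; abel
    have hy : LL _ x y = y := by
      apply dinj
      rw [hd, hdy, map_sub, LL_single, LL_single, h1, h2]
    have hyi : ∀ i : ℕ, LL _ (x ^ i) y = y := by
      intro i
      induction i with
      | zero => simp [LL_one]
      | succ i ih => rw [pow_succ, LL_mul, hy, ih]
    have hyi' : ∀ i : ℕ, LL _ ((x ^ i)⁻¹) y = y := by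
      intro i
      conv_lhs => rw [← hyi i]
      rw [← LL_mul]; simp [LL_one]
    have hdi : ∀ (i : ℕ) z, d (LL _ (x ^ i) z) = LL _ (x ^ i) (d z) := by
      intro i
      induction i with
      | zero => intro z; simp [LL_one]
      | succ i ih => intro z; rw [pow_succ, LL_mul, ih, hd, ← LL_mul]
    have hv1 : ∀ i : ℕ, (x ^ i)⁻¹ • v1 = v1 := by
      intro i
      rw [inv_smul_eq_iff]
      induction i with
      | zero => simp
      | succ i ih => rw [pow_succ, mul_smul, h1]; exact ih
    have := congrArg (fun f => f v1) (congrArg d (hm y))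
    simp only [hyi', map_sum, hdi, Finsupp.coe_finsetSum, Finset.sum_apply, LL_apply, hv1, hdy] at this
    simp [Ne.symm hne] at this

/-- The facts on Coxeter generating sets that are used below. -/
structure CoxD {W : Type} [Group W] (S : Set W) : Prop where
  fin : S.Finite
  gen : Subgroup.closure S = ⊤
  inv : ∀ s ∈ S, s * s = 1
  lift : ∀ (G : Type) [Group G] (f : W → G), (∀ s ∈ S, f s * f s = 1) →
    (∀ s ∈ S, ∀ t ∈ S, s ≠ t → (f s * f t) ^ orderOf (s * t) = 1) →
    ∃ F : W →* G, ∀ s ∈ S, F s = f s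

lemma IsCoxGenSet.coxD {W : Type} [Group W] {S : Set W} (h : IsCoxGenSet S) : CoxD S := by
  obtain ⟨hfin, M, cs, hcs⟩ := h
  refine ⟨hfin, ?_, ?_, ?_⟩
  · have := cs.subgroup_closure_range_simple
    have h2 : Set.range cs.simple = S := by
      ext x
      constructor
      · rintro ⟨i, rfl⟩; rw [hcs]; exact i.2
      · intro hx; exact ⟨⟨x, hx⟩, hcs _⟩
    rwa [h2] at this
  · intro s hs
    have := cs.simple_mul_simple_self ⟨s, hs⟩
    rwa [hcs] at this
  · intro G _ f h1 h2
    have hl : M.IsLiftable (fun s : S => f s) := by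
      intro i j
      by_cases hij : i = j
      · subst hij
        rw [h1 _ i.2, one_pow]
      · have h3 := h2 i i.2 j j.2 (fun h => hij (Subtype.ext h))
        have h4 : orderOf ((i : W) * j) ∣ M i j := by
          apply orderOf_dvd_of_pow_eq_one
          have := cs.simple_mul_simple_pow i j
          rwa [hcs, hcs] at this
        obtain ⟨c, hc⟩ := h4
        rw [hc, pow_mul, h3, one_pow]
    refine ⟨cs.lift ⟨_, hl⟩, fun s hs => ?_⟩
    have := cs.lift_apply_simple hl ⟨s, hs⟩
    rwa [hcs] at this

lemma hom_eq {W G : Type*} [Group W] [Group G] {S : Set W} (h : Subgroup.closure S = ⊤)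
    (f g : W →* G) (hfg : ∀ s ∈ S, f s = g s) : f = g :=
  MonoidHom.eq_of_eqOn_dense h hfg

/-- Existence of the derivation attached to a free splitting. -/
lemma deriv_exists {W : Type} [Group W] {S : Set W} (hS : CoxD S) (A : Set W)
    (hA : ∀ a ∈ A, ∀ b ∈ S, b ∉ A → orderOf (a * b) = 0)
    (k : Type) [CommRing k] :
    ∃ δ : W → (W →₀ k), (∀ x y, δ (x * y) = LL k x (δ y) + δ x) ∧
      (∀ a ∈ S, a ∈ A → δ a = Finsupp.single a 1 - Finsupp.single 1 1) ∧
      (∀ b ∈ S, b ∉ A → δ b = 0) := by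
  classical
  have e1 : ∀ (g : W) (z : W →₀ k), LL k g⁻¹ (LL k g z) = z := fun g z => by
    rw [← LL_mul, inv_mul_cancel, LL_one]
  have e2 : ∀ (g : W) (z : W →₀ k), LL k g (LL k g⁻¹ z) = z := fun g z => by
    rw [← LL_mul, mul_inv_cancel, LL_one]
  let P : W →* Equiv.Perm (W →₀ k) := MonoidHom.mk' (fun g => ⟨LL k g, LL k g⁻¹, e1 g, e2 g⟩) (by
    intro a b
    ext1 z
    exact LL_mul k a b z)
  have hP : ∀ g z, P g z = LL k g z := fun _ _ => rfl
  let τ : Equiv.Perm (W →₀ k) := Equiv.addRight (Finsupp.single 1 1)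
  let Q : W →* Equiv.Perm (W →₀ k) := (MulAut.conj τ⁻¹).toMonoidHom.comp P
  have hQ : ∀ g z, Q g z = LL k g z + (Finsupp.single g 1 - Finsupp.single 1 1) := by
    intro g z
    simp only [Q, MonoidHom.comp_apply, MulEquiv.coe_toMonoidHom, MulAut.conj_apply, inv_inv,
      Equiv.Perm.mul_apply]
    have : τ⁻¹ = Equiv.addRight (-(Finsupp.single 1 1 : W →₀ k)) := by
      simp [τ]
    rw [this]
    simp only [τ, Equiv.coe_addRight, hP, map_add, LL_single, smul_eq_mul, mul_one]
    abel
  obtain ⟨F, hF⟩ := hS.lift (Equiv.Perm (W →₀ k)) (fun s => if s ∈ A then Q s else P s)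
    (by intro s hs
        by_cases h : s ∈ A
        · simp only [if_pos h, ← map_mul, hS.inv s hs, map_one]
        · simp only [if_neg h, ← map_mul, hS.inv s hs, map_one])
    (by intro s hs t ht hst
        by_cases h : s ∈ A <;> by_cases h' : t ∈ A
        · simp only [if_pos h, if_pos h', ← map_mul, ← map_pow, pow_orderOf_eq_one, map_one]
        · rw [hA s h t ht h', pow_zero]
        · rw [← orderOf_inv, mul_inv_rev, inv_eq_of_mul_eq_one_left (hS.inv s hs),
            inv_eq_of_mul_eq_one_left (hS.inv t ht), hA t h' s hs h, pow_zero]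
        · simp only [if_neg h, if_neg h', ← map_mul, ← map_pow, pow_orderOf_eq_one, map_one])
  have haff : ∀ w z, F w z = LL k w z + F w 0 := by
    intro w
    have hw : w ∈ Subgroup.closure S := by rw [hS.gen]; trivial
    induction hw using Subgroup.closure_induction with
    | mem s hs =>
      intro z
      rw [hF s hs]
      by_cases h : s ∈ A
      · simp only [if_pos h, hQ, map_zero, zero_add]
      · simp only [if_neg h, hP, map_zero, add_zero]
    | one => intro z; simp [LL_one]
    | mul x y _ _ hx hy =>
      intro z
      rw [map_mul, Equiv.Perm.mul_apply, Equiv.Perm.mul_apply, hx, hy, hx (F y 0), LL_mul, map_add,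
        add_assoc]
    | inv x _ hx =>
      intro z
      have hxi : ∀ z, F x ((F x)⁻¹ z) = z := by
        intro z; rw [← Equiv.Perm.mul_apply, mul_inv_cancel, Equiv.Perm.one_apply]
      rw [map_inv]
      apply (F x).injective
      rw [hxi, hx, map_add, e2, add_assoc, ← hx,
        hxi, add_zero]
  refine ⟨fun w => F w 0, ?_, ?_, ?_⟩
  · intro x y
    beta_reduce
    rw [map_mul, Equiv.Perm.mul_apply, haff]
  · intro a ha ha'
    beta_reduce
    rw [hF a ha, if_pos ha', hQ]; simp
  · intro a ha ha'
    simp only [hF a ha, if_neg ha', hP, map_zero]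

/-- An element of prime order in a free product of special subgroups is contained in exactly
one conjugate of a factor. -/
lemma free_fix {W : Type} [Group W] {S : Set W} (hS : CoxD S) (A : Set W)
    (hA : ∀ a ∈ A, ∀ b ∈ S, b ∉ A → orderOf (a * b) = 0) (hAS : A ⊆ S)
    (p : ℕ) (hp : p.Prime) (x : W) (hx : x ^ p = 1) (hx1 : x ≠ 1) :
    ∃! v : (W ⧸ Subgroup.closure A) ⊕ (W ⧸ Subgroup.closure (S \ A)), x • v = v := by
  classical
  obtain ⟨δ, hδ, hδA, hδB⟩ := deriv_exists hS A hA (ZMod p)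
  have hδ1 : δ 1 = 0 := by
    have := hδ 1 1
    rw [LL_one, mul_one] at this
    simpa using this
  have hδinv : ∀ x, δ x⁻¹ = - LL _ x⁻¹ (δ x) := by
    intro x
    have := hδ x⁻¹ x
    rw [inv_mul_cancel, hδ1] at this
    exact (neg_eq_of_add_eq_zero_right this.symm).symm
  have hG : ∀ g ∈ Subgroup.closure A, δ g = Finsupp.single g 1 - Finsupp.single 1 1 := by
    intro g hg
    induction hg using Subgroup.closure_induction with
    | mem s hs => exact hδA s (hAS hs) hs
    | one => simp [hδ1]
    | mul x y _ _ hx hy => rw [hδ, hx, hy, map_sub, LL_single, LL_single]; simp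
    | inv x _ hx => rw [hδinv, hx, map_sub, LL_single, LL_single]; simp
  have hH : ∀ g ∈ Subgroup.closure (S \ A), δ g = 0 := by
    intro g hg
    induction hg using Subgroup.closure_induction with
    | mem s hs => exact hδB s hs.1 hs.2
    | one => simp [hδ1]
    | mul x y _ _ hx hy => rw [hδ, hx, hy]; simp
    | inv x _ hx => rw [hδinv, hx]; simp
  let V := (W ⧸ Subgroup.closure A) ⊕ (W ⧸ Subgroup.closure (S \ A))
  let iG : W → V := fun w => Sum.inl (QuotientGroup.mk w)
  let iH : W → V := fun w => Sum.inr (QuotientGroup.mk w)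
  have iGs : ∀ x w, x • iG w = iG (x * w) := fun _ _ => rfl
  have iHs : ∀ x w, x • iH w = iH (x * w) := fun _ _ => rfl
  let d : (W →₀ ZMod p) →ₗ[ZMod p] (V →₀ ZMod p) :=
    Finsupp.lmapDomain _ _ iH - Finsupp.lmapDomain _ _ iG
  have hds : ∀ w c, d (Finsupp.single w c) = Finsupp.single (iH w) c - Finsupp.single (iG w) c := by
    intro w c; simp [d]
  let D₀ : V → (W →₀ ZMod p) := Sum.elim
    (fun q => Quotient.liftOn' q (fun w => δ w - Finsupp.single w 1) (by
      intro a b hab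
      rw [QuotientGroup.leftRel_apply] at hab
      have : b = a * (a⁻¹ * b) := by group
      rw [this, hδ, hG _ hab, map_sub, LL_single, LL_single]
      simp only [smul_eq_mul, mul_one]
      abel))
    (fun q => Quotient.liftOn' q δ (by
      intro a b hab
      rw [QuotientGroup.leftRel_apply] at hab
      have : b = a * (a⁻¹ * b) := by group
      rw [this, hδ, hH _ hab]
      simp))
  have hD0G : ∀ w, D₀ (iG w) = δ w - Finsupp.single w 1 := fun _ => rfl
  have hD0H : ∀ w, D₀ (iH w) = δ w := fun _ => rfl
  let D : (V →₀ ZMod p) →ₗ[ZMod p] (W →₀ ZMod p) := Finsupp.linearCombination _ D₀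
  have hd : ∀ (x : W) z, d (LL _ x z) = LL _ x (d z) := by
    intro x z
    induction z using Finsupp.induction_linear with
    | zero => simp
    | add f g hf hg => simp only [map_add, hf, hg]
    | single a b => rw [LL_single, hds, hds, map_sub, LL_single, LL_single]; rfl
  have hDd : ∀ z, D (d z) = z := by
    intro z
    induction z using Finsupp.induction_linear with
    | zero => simp
    | add f g hf hg => simp only [map_add, hf, hg]
    | single a b =>
      rw [hds, map_sub]
      simp only [D, Finsupp.linearCombination_single, hD0G, hD0H, smul_sub, Finsupp.smul_single]
      simp
  have hdδ : ∀ w, d (δ w) = Finsupp.single (iH w) 1 - Finsupp.single (iH 1) 1 := by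
    intro w
    have hw : w ∈ Subgroup.closure S := by rw [hS.gen]; trivial
    induction hw using Subgroup.closure_induction with
    | mem s hs =>
      by_cases h : s ∈ A
      · rw [hδA s hs h, map_sub, hds, hds]
        have : iG s = iG 1 := by
          simp only [iG]; congr 1
          rw [QuotientGroup.eq]
          exact Subgroup.mul_mem _ (Subgroup.inv_mem _ (Subgroup.subset_closure h)) (Subgroup.one_mem _)
        rw [this]; abel
      · rw [hδB s hs h]
        have : iH s = iH 1 := by
          simp only [iH]; congr 1
          rw [QuotientGroup.eq]
          exact Subgroup.mul_mem _ (Subgroup.inv_mem _ (Subgroup.subset_closure ⟨hs, h⟩)) (Subgroup.one_mem _)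
        rw [this]; simp
    | one => simp [hδ1]
    | mul x y _ _ hx hy =>
      rw [hδ, map_add, hd, hx, hy, map_sub, LL_single, LL_single, iHs, iHs, mul_one]; abel
    | inv x _ hx =>
      rw [hδinv, map_neg, hd, hx, map_sub, LL_single, LL_single, iHs, iHs, mul_one, inv_mul_cancel]
      abel
  refine fix_unique (E := W) p hp x hx ?_ d D (hd x) hDd (iH 1) ?_ ?_
  · intro y h
    apply hx1
    simpa using h
  · intro v
    simp only [D, Finsupp.linearCombination_single, one_smul]
    rcases v with v | v
    · obtain ⟨w, rfl⟩ := QuotientGroup.mk_surjective v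
      change d (D₀ (iG w)) = Finsupp.single (iG w) 1 - _
      rw [hD0G, map_sub, hdδ, hds]
      abel
    · obtain ⟨w, rfl⟩ := QuotientGroup.mk_surjective v
      change d (D₀ (iH w)) = Finsupp.single (iH w) 1 - _
      rw [hD0H, hdδ]
  · intro z
    induction z using Finsupp.induction_linear with
    | zero => simp
    | add f g hf hg => simp only [map_add, hf, hg, add_zero]
    | single a b => rw [hds]; simp

lemma ord_comm {W : Type*} [Group W] (s t : W) : orderOf (s * t) = orderOf (t * s) := by
  have : t * s = s⁻¹ * (s * t) * s⁻¹⁻¹ := by group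
  rw [this]
  exact (orderOf_injective (MulAut.conj s⁻¹).toMonoidHom (MulAut.conj s⁻¹).injective (s * t)).symm

lemma dihedral_elts {W : Type*} [Group W] {s t : W} (hs : s * s = 1) (ht : t * t = 1) {g : W}
    (hg : g ∈ Subgroup.closure ({s, t} : Set W)) :
    ∃ i : ℤ, g = (s * t) ^ i ∨ g = s * (s * t) ^ i := by
  have hsi : s⁻¹ = s := inv_eq_of_mul_eq_one_left hs
  have hti : t⁻¹ = t := inv_eq_of_mul_eq_one_left ht
  have hc : s * (s * t) * s⁻¹ = (s * t)⁻¹ := by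
    rw [mul_inv_rev, hsi, hti, ← mul_assoc, hs, one_mul]
  have hcz : ∀ i : ℤ, (s * t) ^ i * s = s * (s * t) ^ (-i) := by
    intro i
    have h1 : (s * (s * t) * s⁻¹) ^ (-i) = s * (s * t) ^ (-i) * s⁻¹ := conj_zpow
    rw [hc, inv_zpow, zpow_neg, inv_inv] at h1
    rw [h1, inv_mul_cancel_right, zpow_neg]
  induction hg using Subgroup.closure_induction with
  | mem x hx =>
    rcases hx with rfl | rfl
    · exact ⟨0, Or.inr (by simp)⟩
    · exact ⟨1, Or.inr (by rw [zpow_one, ← mul_assoc, hs, one_mul])⟩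
  | one => exact ⟨0, Or.inl (by simp)⟩
  | mul x y _ _ hx hy =>
    obtain ⟨i, rfl | rfl⟩ := hx <;> obtain ⟨j, rfl | rfl⟩ := hy
    · exact ⟨i + j, Or.inl (by rw [zpow_add])⟩
    · exact ⟨-i + j, Or.inr (by rw [← mul_assoc, hcz, mul_assoc, zpow_add])⟩
    · exact ⟨i + j, Or.inr (by rw [mul_assoc, zpow_add])⟩
    · refine ⟨-i + j, Or.inl ?_⟩
      rw [mul_assoc, ← mul_assoc ((s * t) ^ i), hcz, mul_assoc, ← mul_assoc s s, hs, one_mul,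
        zpow_add]
  | inv x _ hx =>
    obtain ⟨i, rfl | rfl⟩ := hx
    · exact ⟨-i, Or.inl (by rw [zpow_neg])⟩
    · refine ⟨i, Or.inr ?_⟩
      rw [mul_inv_rev, hsi, ← zpow_neg, hcz, neg_neg]

section comb
variable {W : Type} [Group W] {S : Set W}

lemma sph_pair (hS : CoxD S) {s t : W} (hs : s ∈ S) (ht : t ∈ S) (h : orderOf (s * t) ≠ 0) :
    IsSpherical S {s, t} := by
  refine ⟨by rintro x (rfl | rfl) <;> assumption, ?_⟩
  have hf : ((Subgroup.zpowers (s * t) : Subgroup W) : Set W).Finite := by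
    rw [orderOf_ne_zero_iff] at h
    have := h.finite_zpowers
    exact this
  apply (hf.union (hf.image (fun x => s * x))).subset
  intro g hg
  obtain ⟨i, rfl | rfl⟩ := dihedral_elts (hS.inv s hs) (hS.inv t ht) hg
  · left; exact ⟨i, rfl⟩
  · right; exact ⟨_, ⟨i, rfl⟩, rfl⟩

lemma exists_maxsph (hS : CoxD S) {T : Set W} (hT : IsSpherical S T) :
    ∃ U, IsMaxSpherical S U ∧ T ⊆ U := by
  have hfin : {U | IsSpherical S U}.Finite := hS.fin.finite_subsets.subset (fun U hU => hU.1)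
  obtain ⟨U, hTU, hU⟩ := hfin.exists_le_maximal hT
  exact ⟨U, ⟨hU.1, fun V hV hUV => Set.Subset.antisymm (hU.2 hV hUV) hUV⟩, hTU⟩

lemma ord_ne_zero {U : Set W} (hU : IsSpherical S U) {s t : W} (hs : s ∈ U) (ht : t ∈ U) :
    orderOf (s * t) ≠ 0 := by
  have : Finite (Subgroup.closure U) := hU.2
  have h := orderOf_pos (⟨s * t, mul_mem (Subgroup.subset_closure hs)
    (Subgroup.subset_closure ht)⟩ : Subgroup.closure U)
  rw [Subgroup.orderOf_mk] at h
  omega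

lemma sbar_sub : Sbar S ⊆ S := by
  rintro x ⟨U, ⟨hU, _⟩, hx⟩
  exact hU.1.1 hx

lemma strong_not_odd {U : Set W} (hU : IsStrongEvenSet U) {s t : W} (hs : s ∈ U) (ht : t ∈ U)
    (hst : s ≠ t) : ¬ Odd (orderOf (s * t)) := by
  intro h
  rw [Nat.odd_iff] at h
  rcases hU s hs t ht hst with h' | h' <;> omega

lemma strong_of_max (hc : Conds S) {U : Set W} (hU : IsMaxSpherical S U)
    (hn : ¬ IsStrongEvenSet U) : ∃ a ∈ S, ∃ b ∈ S, a ≠ b ∧ Odd (orderOf (a * b)) ∧ U = {a, b} := by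
  unfold IsStrongEvenSet at hn
  push Not at hn
  obtain ⟨a, ha, b, hb, hab, h2, h4⟩ := hn
  have ha' := hU.1.1 ha
  have hb' := hU.1.1 hb
  have hodd : Odd (orderOf (a * b)) := by
    rw [← Nat.not_even_iff_odd]
    intro he
    rcases hc.1 a ha' b hb' hab he with h | h
    · exact h2 h
    · exact h4 h
  refine ⟨a, ha', b, hb', hab, hodd, ?_⟩
  exact (hc.2.1 a ha' b hb' hab hodd).2 U hU.1 (by rintro x (rfl | rfl) <;> assumption)

lemma sbar_even (hc : Conds S) {x y : W} (hx : x ∈ Sbar S) (hy : y ∈ Sbar S) (hxy : x ≠ y) :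
    ¬ Odd (orderOf (x * y)) := by
  intro h
  have hx' := sbar_sub hx
  have hy' := sbar_sub hy
  obtain ⟨U, ⟨hU, hUs⟩, hxU⟩ := hx
  obtain ⟨V, ⟨hV, hVs⟩, hyV⟩ := hy
  rcases hc.2.2.2 x hx' y hy' hxy h {x, y} U V
    ⟨hc.2.1 x hx' y hy' hxy h, x, by simp⟩ ⟨hU, x, by simp [hxU]⟩ ⟨hV, y, by simp [hyV]⟩ with h1 | h1 | h1
  · exact strong_not_odd hUs hxU (by rw [← h1]; simp) hxy h
  · exact strong_not_odd hVs (by rw [← h1]; simp) hyV hxy h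
  · exact strong_not_odd hUs hxU (by rw [h1]; exact hyV) hxy h

lemma sbar_mate (hS : CoxD S) (hc : Conds S) {x y u : W} (hx : x ∈ Sbar S) (hy' : y ∈ S)
    (hxy : x ≠ y) (h : Odd (orderOf (x * y))) (hu : u ∈ S) (hux : u ≠ x) (huy : u ≠ y) :
    orderOf (y * u) = 0 := by
  by_contra h0
  have hx' := sbar_sub hx
  obtain ⟨U, ⟨hU, hUs⟩, hxU⟩ := hx
  obtain ⟨V, hV, hVy⟩ := exists_maxsph hS (sph_pair hS hy' hu h0)
  have hyV : y ∈ V := hVy (by simp)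
  have huV : u ∈ V := hVy (by simp)
  rcases hc.2.2.2 x hx' y hy' hxy h {x, y} U V
    ⟨hc.2.1 x hx' y hy' hxy h, x, by simp⟩ ⟨hU, x, by simp [hxU]⟩ ⟨hV, y, by simp [hyV]⟩ with h1 | h1 | h1
  · exact strong_not_odd hUs hxU (by rw [← h1]; simp) hxy h
  · rw [← h1] at huV
    rcases huV with h | h
    · exact hux h
    · exact huy h
  · exact strong_not_odd hUs hxU (by rw [h1]; exact hyV) hxy h

lemma not_sbar_odd (hS : CoxD S) (hc : Conds S) {y v : W} (hy : y ∈ S) (hyb : y ∉ Sbar S)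
    (hv : v ∈ S) (hyv : y ≠ v) (h0 : orderOf (y * v) ≠ 0) : Odd (orderOf (y * v)) := by
  obtain ⟨V, hV, hVy⟩ := exists_maxsph hS (sph_pair hS hy hv h0)
  have hyV : y ∈ V := hVy (by simp)
  have hvV : v ∈ V := hVy (by simp)
  obtain ⟨a, ha, b, hb, hab, hodd, rfl⟩ := strong_of_max hc hV (fun h => hyb ⟨V, ⟨hV, h⟩, hyV⟩)
  rcases hyV with rfl | rfl <;> rcases hvV with rfl | rfl
  · exact absurd rfl hyv
  · exact hodd
  · rwa [ord_comm]
  · exact absurd rfl hyv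

lemma not_sbar_mate (hS : CoxD S) (hc : Conds S) {y : W} (hy : y ∈ S) (hyb : y ∉ Sbar S) :
    ∃ v ∈ S, y ≠ v ∧ Odd (orderOf (y * v)) := by
  obtain ⟨V, hV, hVy⟩ := exists_maxsph hS (sph_pair hS hy hy (by rw [hS.inv y hy]; simp))
  have hyV : y ∈ V := hVy (by simp)
  obtain ⟨a, ha, b, hb, hab, hodd, rfl⟩ := strong_of_max hc hV (fun h => hyb ⟨V, ⟨hV, h⟩, hyV⟩)
  rcases hyV with rfl | rfl
  · exact ⟨b, hb, hab, hodd⟩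
  · exact ⟨a, ha, hab.symm, by rwa [ord_comm]⟩

/-- The odd class of `x`. -/
def Cl (S : Set W) (x : W) : Set W := {u | u ∈ S ∧ Odd (orderOf (x * u))}

lemma self_mem_cl (hS : CoxD S) {x : W} (hx : x ∈ S) : x ∈ Cl S x :=
  ⟨hx, by rw [hS.inv x hx]; simp⟩

lemma cl_sub (hS : CoxD S) (hc : Conds S) {x y : W} (hx : x ∈ S) (hy : y ∈ Cl S x) :
    Cl S y ⊆ Cl S x := by
  intro z hz
  refine ⟨hz.1, ?_⟩
  by_cases h1 : x = y
  · rw [h1]; exact hz.2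
  by_cases h2 : y = z
  · rw [← h2]; exact hy.2
  by_cases h3 : x = z
  · rw [← h3, hS.inv x hx]; simp
  exact absurd ⟨x, hx, y, hy.1, z, hz.1, h1, h2, h3, hy.2, hz.2⟩ hc.2.2.1

lemma cl_eq (hS : CoxD S) (hc : Conds S) {x y : W} (hx : x ∈ S) (hy : y ∈ Cl S x) :
    Cl S y = Cl S x :=
  Set.Subset.antisymm (cl_sub hS hc hx hy)
    (cl_sub hS hc hy.1 ⟨hx, by rw [ord_comm]; exact hy.2⟩)

lemma even_of_cl (hS : CoxD S) (hc : Conds S) {x s t : W} (hx : x ∈ S) (hs : s ∈ Cl S x)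
    (ht : t ∈ S) (ht' : t ∉ Cl S x) : Even (orderOf (s * t)) := by
  rw [← Nat.not_odd_iff_even]
  intro h
  exact ht' (cl_sub hS hc hx hs ⟨ht, h⟩)

/-- `χ` is the sign character attached to the odd class of `x`. -/
def IsChi (S : Set W) (x : W) (χ : W →* ℤˣ) : Prop :=
  ∀ u ∈ S, (u ∈ Cl S x → χ u = -1) ∧ (u ∉ Cl S x → χ u = 1)

lemma chi_exists (hS : CoxD S) (hc : Conds S) {x : W} (hx : x ∈ S) : ∃ χ, IsChi S x χ := by
  classical
  obtain ⟨F, hF⟩ := hS.lift ℤˣ (fun u => if u ∈ Cl S x then -1 else 1)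
    (by intro s hs; split_ifs <;> simp)
    (by intro s hs t ht hst
        by_cases h1 : s ∈ Cl S x <;> by_cases h2 : t ∈ Cl S x
        · simp [h1, h2]
        · simp [h1, h2, (even_of_cl hS hc hx h1 ht h2).neg_one_pow]
        · rw [ord_comm]
          simp [h1, h2, (even_of_cl hS hc hx h2 hs h1).neg_one_pow]
        · simp [h1, h2])
  exact ⟨F, fun u hu => ⟨fun h => by rw [hF u hu, if_pos h], fun h => by rw [hF u hu, if_neg h]⟩⟩

lemma sign_exists (hS : CoxD S) : ∃ χ : W →* ℤˣ, ∀ u ∈ S, χ u = -1 := by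
  obtain ⟨F, hF⟩ := hS.lift ℤˣ (fun _ => -1) (by simp) (by simp)
  exact ⟨F, hF⟩

lemma ab_eq (hS : CoxD S) {u v : W} (hu : u ∈ S) (hv : v ∈ S) (h : Odd (orderOf (u * v))) :
    Abelianization.of u = Abelianization.of v := by
  have h1 : Abelianization.of u * Abelianization.of u = 1 := by rw [← map_mul, hS.inv u hu, map_one]
  have h2 : Abelianization.of v * Abelianization.of v = 1 := by rw [← map_mul, hS.inv v hv, map_one]
  have h3 : (Abelianization.of u * Abelianization.of v) ^ orderOf (u * v) = 1 := by
    rw [← map_mul, ← map_pow, pow_orderOf_eq_one, map_one]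
  obtain ⟨k, hk⟩ := h
  have h4 : (Abelianization.of u * Abelianization.of v) ^ 2 = 1 := by
    rw [pow_two, mul_mul_mul_comm, h1, h2, one_mul]
  rw [hk, pow_succ, pow_mul, h4, one_pow, one_mul] at h3
  calc Abelianization.of u = Abelianization.of u * (Abelianization.of v * Abelianization.of v) := by
        rw [h2, mul_one]
    _ = _ := by rw [← mul_assoc, h3, one_mul]

lemma span_ab (hS : CoxD S) (hc : Conds S) (g : W) (K : Subgroup (Abelianization W))
    (hK : ∀ u ∈ S, ∀ χ, IsChi S u χ → χ g = -1 → Abelianization.of u ∈ K) :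
    Abelianization.of g ∈ K := by
  classical
  have hκ : ∀ C : Set W, C ∈ Set.image (Cl S) S → ∃ κ : W →* Abelianization W,
      ∀ u ∈ S, κ u = if u ∈ C then Abelianization.of u else 1 := by
    rintro _ ⟨x, hx, rfl⟩
    have hsq : ∀ s ∈ S, Abelianization.of s * Abelianization.of s = 1 := fun s hs => by
      rw [← map_mul, hS.inv s hs, map_one]
    apply hS.lift
    · intro s hs
      split_ifs
      · exact hsq s hs
      · simp
    · intro s hs t ht hst
      by_cases h1 : s ∈ Cl S x <;> by_cases h2 : t ∈ Cl S x
      · simp only [if_pos h1, if_pos h2]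
        rw [← map_mul, ← map_pow, pow_orderOf_eq_one, map_one]
      · obtain ⟨k, hk⟩ := even_of_cl hS hc hx h1 ht h2
        simp only [if_pos h1, if_neg h2]
        rw [hk, mul_one, ← two_mul, pow_mul, pow_two, hsq s hs, one_pow]
      · obtain ⟨k, hk⟩ := even_of_cl hS hc hx h2 hs h1
        simp only [if_neg h1, if_pos h2]
        rw [ord_comm, hk, one_mul, ← two_mul, pow_mul, pow_two, hsq t ht, one_pow]
      · simp [h1, h2]
  choose! κ hκ using hκ
  let I : Finset (Set W) := (hS.fin.image (Cl S)).toFinset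
  have hI : ∀ C, C ∈ I ↔ C ∈ Set.image (Cl S) S := fun C => by simp [I]
  have hprod : Abelianization.of = ∏ C ∈ I, κ C := by
    apply hom_eq hS.gen
    intro u hu
    rw [MonoidHom.finsetProd_apply, Finset.prod_eq_single (Cl S u)]
    · rw [hκ _ ⟨u, hu, rfl⟩ u hu, if_pos (self_mem_cl hS hu)]
    · intro C hC hne
      obtain ⟨x, hx, rfl⟩ := (hI C).1 hC
      rw [hκ _ ⟨x, hx, rfl⟩ u hu, if_neg]
      intro h
      exact hne (cl_eq hS hc hx h).symm
    · intro h
      exact absurd ((hI _).2 ⟨u, hu, rfl⟩) h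
  rw [hprod, MonoidHom.finsetProd_apply]
  apply Subgroup.prod_mem
  intro C hC
  obtain ⟨x, hx, rfl⟩ := (hI C).1 hC
  obtain ⟨χ, hχ⟩ := chi_exists hS hc hx
  have hsq : Abelianization.of x * Abelianization.of x = 1 := by
    rw [← map_mul, hS.inv x hx, map_one]
  have key : (χ g = 1 ∧ κ (Cl S x) g = 1) ∨ (χ g = -1 ∧ κ (Cl S x) g = Abelianization.of x) := by
    clear hK
    have hw : g ∈ Subgroup.closure S := by rw [hS.gen]; trivial
    induction hw using Subgroup.closure_induction with
    | mem s hs =>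
      rw [hκ _ ⟨x, hx, rfl⟩ s hs]
      by_cases h : s ∈ Cl S x
      · right
        exact ⟨(hχ s hs).1 h, by rw [if_pos h]; exact (ab_eq hS hx hs h.2).symm⟩
      · left
        exact ⟨(hχ s hs).2 h, by rw [if_neg h]⟩
    | one => left; simp
    | mul a b _ _ ha hb =>
      rw [map_mul, map_mul]
      rcases ha with ⟨h1, h2⟩ | ⟨h1, h2⟩ <;> rcases hb with ⟨h3, h4⟩ | ⟨h3, h4⟩ <;>
        simp [h1, h2, h3, h4, hsq]
    | inv a _ ha =>
      rw [map_inv, map_inv]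
      rcases ha with ⟨h1, h2⟩ | ⟨h1, h2⟩
      · simp [h1, h2]
      · simp [h1, h2, inv_eq_of_mul_eq_one_left hsq]
  rcases key with ⟨_, h⟩ | ⟨h1, h⟩
  · rw [h]; exact K.one_mem
  · rw [h]; exact hK x hx χ hχ h1

end comb

/-- First sign character of the dihedral group of order eight. -/
def Xx : DihedralGroup 4 →* ℤˣ := MonoidHom.mk'
  (fun g => match g with
    | .r i => (-1) ^ i.val
    | .sr i => (-1) ^ (i.val + 1)) (by decide)

/-- Second sign character of the dihedral group of order eight. -/
def Xy : DihedralGroup 4 →* ℤˣ := MonoidHom.mk'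
  (fun g => match g with
    | .r i => (-1) ^ i.val
    | .sr i => (-1) ^ i.val) (by decide)

lemma X_key : ∀ g h : DihedralGroup 4, g * g = 1 → h * h = 1 → g * h = h * g → Xx g = -1 →
    Xy h = -1 → False := by decide

section comb2
variable {W : Type} [Group W] {S : Set W}

lemma dihedral_key (hS : CoxD S) (hc : Conds S) {x y : W} (hx : x ∈ Sbar S) (hy : y ∈ Sbar S)
    (hxy : x ≠ y) (h2 : orderOf (x * y) ≠ 2) {χ₁ χ₂ : W →* ℤˣ} (h₁ : IsChi S x χ₁)
    (h₂ : IsChi S y χ₂) {g h : W} (hg : g * g = 1) (hh : h * h = 1) (hgh : g * h = h * g)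
    (hχ₁ : χ₁ g = -1) (hχ₂ : χ₂ h = -1) : False := by
  classical
  have hx' := sbar_sub hx
  have hy' := sbar_sub hy
  have hno := sbar_even hc hx hy hxy
  have h4 : 4 ∣ orderOf (x * y) :=
    (hc.1 x hx' y hy' hxy (Nat.not_odd_iff_even.1 hno)).resolve_left h2
  have hdisj : ∀ u, u ∈ Cl S x → u ∈ Cl S y → False := by
    intro u hux huy
    have : y ∈ Cl S x := by
      rw [← cl_eq hS hc hx' hux, cl_eq hS hc hy' huy]; exact self_mem_cl hS hy'
    exact hno this.2
  have hcross : ∀ s t, s ∈ Cl S x → t ∈ Cl S y → 4 ∣ orderOf (s * t) := by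
    intro s t hs ht
    have hst : s ≠ t := fun h => hdisj s hs (h ▸ ht)
    have htx : t ≠ x := fun h => hdisj t (by rw [h]; exact self_mem_cl hS hx') ht
    by_cases h1 : s = x
    · by_cases h3 : t = y
      · rw [h1, h3]; exact h4
      · rw [ord_comm, h1, sbar_mate hS hc hy ht.1 (Ne.symm h3) ht.2 hx' hxy (Ne.symm htx)]
        exact dvd_zero _
    · rw [sbar_mate hS hc hx hs.1 (Ne.symm h1) hs.2 ht.1 htx (Ne.symm hst)]
      exact dvd_zero _
  have hsq0 : (DihedralGroup.sr 0 : DihedralGroup 4) * DihedralGroup.sr 0 = 1 := by decide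
  have hsq1 : (DihedralGroup.sr 1 : DihedralGroup 4) * DihedralGroup.sr 1 = 1 := by decide
  have hpq : ((DihedralGroup.sr 0 : DihedralGroup 4) * DihedralGroup.sr 1) ^ 4 = 1 := by decide
  have hqp : ((DihedralGroup.sr 1 : DihedralGroup 4) * DihedralGroup.sr 0) ^ 4 = 1 := by decide
  have hev : ∀ (a : DihedralGroup 4) (n : ℕ), a * a = 1 → Even n → a ^ n = 1 := by
    rintro a n ha ⟨k, rfl⟩
    rw [← two_mul, pow_mul, pow_two, ha, one_pow]
  obtain ⟨ψ, hψ⟩ := hS.lift (DihedralGroup 4) (fun u => if u ∈ Cl S x then .sr 0 else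
      if u ∈ Cl S y then .sr 1 else 1)
    (by intro s hs
        by_cases a : s ∈ Cl S x
        · simp only [if_pos a]; exact hsq0
        · by_cases b : s ∈ Cl S y
          · simp only [if_neg a, if_pos b]; exact hsq1
          · simp only [if_neg a, if_neg b, mul_one])
    (by intro s hs t ht hst
        by_cases a : s ∈ Cl S x
        · by_cases c : t ∈ Cl S x
          · simp only [if_pos a, if_pos c]; rw [hsq0, one_pow]
          · by_cases e : t ∈ Cl S y
            · simp only [if_pos a, if_neg c, if_pos e]
              obtain ⟨n, hn⟩ := hcross s t a e
              rw [hn, pow_mul, hpq, one_pow]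
            · simp only [if_pos a, if_neg c, if_neg e, mul_one]
              exact hev _ _ hsq0 (even_of_cl hS hc hx' a ht c)
        · by_cases b : s ∈ Cl S y
          · by_cases c : t ∈ Cl S x
            · simp only [if_neg a, if_pos b, if_pos c]
              obtain ⟨n, hn⟩ := hcross t s c b
              rw [ord_comm, hn, pow_mul, hqp, one_pow]
            · by_cases e : t ∈ Cl S y
              · simp only [if_neg a, if_pos b, if_neg c, if_pos e]; rw [hsq1, one_pow]
              · simp only [if_neg a, if_pos b, if_neg c, if_neg e, mul_one]
                exact hev _ _ hsq1 (even_of_cl hS hc hy' b ht e)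
          · by_cases c : t ∈ Cl S x
            · simp only [if_neg a, if_neg b, if_pos c, one_mul]
              rw [ord_comm]
              exact hev _ _ hsq0 (even_of_cl hS hc hx' c hs a)
            · by_cases e : t ∈ Cl S y
              · simp only [if_neg a, if_neg b, if_neg c, if_pos e, one_mul]
                rw [ord_comm]
                exact hev _ _ hsq1 (even_of_cl hS hc hy' e hs b)
              · simp only [if_neg a, if_neg b, if_neg c, if_neg e, mul_one, one_pow])
  have e1 : χ₁ = Xx.comp ψ := by
    apply hom_eq hS.gen
    intro u hu
    rw [MonoidHom.comp_apply, hψ u hu]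
    by_cases a : u ∈ Cl S x
    · rw [(h₁ u hu).1 a, if_pos a]; decide
    · rw [(h₁ u hu).2 a, if_neg a]
      split_ifs <;> decide
  have e2 : χ₂ = Xy.comp ψ := by
    apply hom_eq hS.gen
    intro u hu
    rw [MonoidHom.comp_apply, hψ u hu]
    by_cases a : u ∈ Cl S y
    · rw [(h₂ u hu).1 a, if_neg (fun h => hdisj u h a), if_pos a]; decide
    · rw [(h₂ u hu).2 a, if_neg a]
      split_ifs <;> decide
  rw [e1] at hχ₁
  rw [e2] at hχ₂
  refine X_key (ψ g) (ψ h) ?_ ?_ ?_ hχ₁ hχ₂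
  · rw [← map_mul, hg, map_one]
  · rw [← map_mul, hh, map_one]
  · rw [← map_mul, hgh, map_mul]

lemma hom_trivial {G : Type*} [CommGroup G] (χ : W →* G) {B : Set W} (hB : ∀ b ∈ B, χ b = 1) {g : W}
    (hg : g ∈ Subgroup.closure B) : χ g = 1 := by
  have : Subgroup.closure B ≤ χ.ker := (Subgroup.closure_le _).2 hB
  exact this hg

lemma fix_inl {A B : Set W} (x w : W) (h : x • (Sum.inl (QuotientGroup.mk w) :
    (W ⧸ Subgroup.closure A) ⊕ (W ⧸ Subgroup.closure B)) = Sum.inl (QuotientGroup.mk w)) :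
    w⁻¹ * x * w ∈ Subgroup.closure A := by
  have h1 : (QuotientGroup.mk (x * w) : W ⧸ Subgroup.closure A) = QuotientGroup.mk w :=
    Sum.inl_injective h
  rw [eq_comm, QuotientGroup.eq, ← mul_assoc] at h1
  exact h1

lemma fix_inr {A B : Set W} (x w : W) (h : x • (Sum.inr (QuotientGroup.mk w) :
    (W ⧸ Subgroup.closure A) ⊕ (W ⧸ Subgroup.closure B)) = Sum.inr (QuotientGroup.mk w)) :
    w⁻¹ * x * w ∈ Subgroup.closure B := by
  have h1 : (QuotientGroup.mk (x * w) : W ⧸ Subgroup.closure B) = QuotientGroup.mk w :=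
    Sum.inr_injective h
  rw [eq_comm, QuotientGroup.eq, ← mul_assoc] at h1
  exact h1

lemma hom_conj {G : Type*} [CommGroup G] (χ : W →* G) (w x : W) : χ (w⁻¹ * x * w) = χ x := by
  rw [map_mul, map_mul, map_inv, mul_comm, mul_inv_cancel_left]

/-- Isolated odd classes. -/
lemma isolated (hS : CoxD S) (hc : Conds S) {u : W} (hu : u ∈ S)
    (hiso : ∀ x ∈ Cl S u, x ∉ Sbar S) : ∃ v ∈ S, u ≠ v ∧ Odd (orderOf (u * v)) ∧
      Cl S u = {u, v} ∧ ∀ a ∈ ({u, v} : Set W), ∀ b ∈ S, b ∉ ({u, v} : Set W) → orderOf (a * b) = 0 := by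
  obtain ⟨v, hv, huv, hodd⟩ := not_sbar_mate hS hc hu (hiso u (self_mem_cl hS hu))
  have hvC : v ∈ Cl S u := ⟨hv, hodd⟩
  have hC : Cl S u = {u, v} := by
    apply Set.Subset.antisymm
    · intro z hz
      by_contra hn
      simp only [Set.mem_insert_iff, Set.mem_singleton_iff, not_or] at hn
      exact hc.2.2.1 ⟨z, hz.1, u, hu, v, hv, hn.1, huv, hn.2, by rw [ord_comm]; exact hz.2, hodd⟩
    · rintro z (rfl | rfl)
      · exact self_mem_cl hS hu
      · exact hvC
  refine ⟨v, hv, huv, hodd, hC, ?_⟩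
  intro a ha b hb hab
  by_contra h0
  have haC : a ∈ Cl S u := by rw [hC]; exact ha
  have hne : a ≠ b := fun h => hab (h ▸ ha)
  have := not_sbar_odd hS hc haC.1 (hiso a haC) hb hne h0
  apply hab
  rw [← hC]
  exact cl_sub hS hc hu haC ⟨hb, this⟩

end comb2

lemma bad_case {W W' : Type} [Group W] [Group W'] {S : Set W} {S' : Set W'}
    (hS : CoxD S) (hS' : CoxD S') (hc : Conds S) (hc' : Conds S') (φ : W ≃* W') {a : W}
    (ha : a ∈ Sbar S) {u : W'} (hu : u ∈ S') (hiso : ∀ x ∈ Cl S' u, x ∉ Sbar S')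
    {χ : W' →* ℤˣ} (hχ : IsChi S' u χ) (hχa : χ (φ a) = -1) : False := by
  obtain ⟨v, hv, huv, hodd, hC, hA⟩ := isolated hS' hc' hu hiso
  have haS := sbar_sub ha
  have haa := hS.inv a haS
  obtain ⟨sg, hsg⟩ := sign_exists hS
  have ha1 : a ≠ 1 := by
    rintro rfl
    have := hsg 1 haS
    rw [map_one] at this
    exact absurd this (by decide)
  have huu := hS'.inv u hu
  have hvv := hS'.inv v hv
  have hχu : χ u = -1 := (hχ u hu).1 (self_mem_cl hS' hu)
  have hχv : χ v = -1 := (hχ v hv).1 (by rw [hC]; simp)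
  have hχq : χ (u * v) = 1 := by rw [map_mul, hχu, hχv]; decide
  have hH : ∀ w x : W', w⁻¹ * x * w ∈ Subgroup.closure (S' \ {u, v}) → χ x = 1 := by
    intro w x hx
    rw [← hom_conj χ w]
    apply hom_trivial χ _ hx
    intro b hb
    exact (hχ b hb.1).2 (by rw [hC]; exact hb.2)
  have hAS : ({u, v} : Set W') ⊆ S' := by rintro z (rfl | rfl) <;> assumption
  obtain ⟨t, ht, htu⟩ := free_fix hS' {u, v} hA hAS 2 Nat.prime_two (φ a)
    (by rw [pow_two, ← map_mul, haa, map_one])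
    (by intro h; exact ha1 (φ.injective (by rw [h, map_one])))
  obtain ⟨w, rfl⟩ : ∃ w : W', t = Sum.inl (QuotientGroup.mk w) := by
    rcases t with t | t
    · obtain ⟨w, rfl⟩ := QuotientGroup.mk_surjective t
      exact ⟨w, rfl⟩
    · obtain ⟨w, rfl⟩ := QuotientGroup.mk_surjective t
      have := hH _ _ (fix_inr _ _ ht)
      rw [hχa] at this
      exact absurd this (by decide)
  -- the centralizer of `a` is small
  have hcent : ∀ c : W, c * a = a * c → c * c = 1 → χ (φ c) = 1 → c = 1 := by
    intro c hca hcc hχc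
    have hfix : φ c • (Sum.inl (QuotientGroup.mk w) : (W' ⧸ Subgroup.closure ({u, v} : Set W')) ⊕
        (W' ⧸ Subgroup.closure (S' \ {u, v}))) = Sum.inl (QuotientGroup.mk w) := by
      apply htu
      rw [← mul_smul, ← map_mul, ← hca, map_mul, mul_smul, ht]
    have hmem := fix_inl _ _ hfix
    obtain ⟨i, hi | hi⟩ := dihedral_elts huu hvv hmem
    · have h1 : (w⁻¹ * φ c * w) ^ orderOf (u * v) = 1 := by
        rw [hi, ← zpow_natCast, ← zpow_mul, mul_comm, zpow_mul, zpow_natCast, pow_orderOf_eq_one,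
          one_zpow]
      have h2 : (w⁻¹ * φ c * w) ^ 2 = 1 := by
        rw [pow_two]
        have : w⁻¹ * φ c * w * (w⁻¹ * φ c * w) = w⁻¹ * (φ c * φ c) * w := by group
        rw [this, ← map_mul, hcc, map_one]; group
      obtain ⟨k, hk⟩ := hodd
      rw [hk, pow_succ, pow_mul, h2, one_pow, one_mul] at h1
      have h3 : φ c = 1 := by
        have : φ c = w * (w⁻¹ * φ c * w) * w⁻¹ := by group
        rw [this, h1]; group
      exact φ.injective (by rw [h3, map_one])
    · have h1 := congrArg χ hi
      rw [hom_conj, hχc, map_mul, map_zpow, hχq, one_zpow, mul_one, hχu] at h1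
      exact absurd h1 (by decide)
  have hcent' : ∀ c : W, c * a = a * c → c * c = 1 → c = 1 ∨ c = a := by
    intro c hca hcc
    rcases Int.units_eq_one_or (χ (φ c)) with h | h
    · exact Or.inl (hcent c hca hcc h)
    · right
      have h1 : c * a = 1 := by
        apply hcent
        · rw [mul_assoc, haa, ← mul_assoc, ← hca, mul_assoc, haa]
        · rw [mul_assoc, ← mul_assoc a, ← hca, mul_assoc c a a, haa, mul_one, hcc]
        · rw [map_mul, map_mul, h, hχa]; decide
      rw [← inv_eq_of_mul_eq_one_left h1]
      exact inv_eq_of_mul_eq_one_left haa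
  obtain ⟨U, ⟨hU, hUs⟩, haU⟩ := ha
  by_cases hUa : ∃ b ∈ U, a ≠ b
  · obtain ⟨b, hbU, hab⟩ := hUa
    have hbS := hU.1.1 hbU
    have hbb := hS.inv b hbS
    have hn0 := ord_ne_zero hU.1 haU hbU
    obtain ⟨n, hn⟩ : ∃ n, orderOf (a * b) = 2 * n := by
      have := strong_not_odd hUs haU hbU hab
      rw [Nat.not_odd_iff_even] at this
      obtain ⟨n, hn⟩ := this
      exact ⟨n, by omega⟩
    have hai : a⁻¹ = a := inv_eq_of_mul_eq_one_left haa
    have hbi : b⁻¹ = b := inv_eq_of_mul_eq_one_left hbb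
    have hc2 : (a * b) ^ n * (a * b) ^ n = 1 := by
      rw [← pow_add, ← two_mul, ← hn, pow_orderOf_eq_one]
    have hconj : a * (a * b) ^ n * a⁻¹ = (a * b) ^ n := by
      rw [← conj_pow]
      have : a * (a * b) * a⁻¹ = (a * b)⁻¹ := by
        rw [mul_inv_rev, hai, hbi, ← mul_assoc, haa, one_mul]
      rw [this, inv_pow]
      exact inv_eq_of_mul_eq_one_left hc2
    rcases hcent' ((a * b) ^ n) (by nth_rewrite 1 [← hconj]; group) hc2 with h | h
    · have := orderOf_dvd_of_pow_eq_one h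
      have := Nat.le_of_dvd (by omega) this
      omega
    · have h1 := congrArg sg h
      rw [map_pow, map_mul, hsg a haS, hsg b hbS] at h1
      simp at h1
  · push Not at hUa
    have hfree : ∀ x ∈ ({a} : Set W), ∀ b ∈ S, b ∉ ({a} : Set W) → orderOf (x * b) = 0 := by
      rintro x rfl b hb hbx
      by_contra h0
      have h1 := hU.2 {x, b} (sph_pair hS haS hb h0) (by
        intro z hz; rw [← hUa z hz]; simp)
      have h2 : b ∈ U := by rw [← h1]; simp
      exact hbx (hUa b h2).symm
    have hm1 : orderOf (u * v) ≠ 1 := by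
      rw [Ne, orderOf_eq_one_iff]
      intro h
      apply huv
      rw [← inv_eq_of_mul_eq_one_left h]
      exact inv_eq_of_mul_eq_one_left hvv
    have hm0 : orderOf (u * v) ≠ 0 := by
      intro h; rw [h] at hodd; exact absurd hodd (by decide)
    obtain ⟨p, hp, hpd⟩ := Nat.exists_prime_and_dvd hm1
    have hpodd : Odd p := hodd.of_dvd_nat hpd
    obtain ⟨l, hl⟩ := hpd
    have hl0 : l ≠ 0 := by rintro rfl; omega
    let q := (u * v) ^ l
    have hqp : q ^ p = 1 := by
      simp only [q]; rw [← pow_mul, mul_comm, ← hl, pow_orderOf_eq_one]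
    have hq1 : q ≠ 1 := by
      intro h
      have h5 := Nat.le_of_dvd (by omega) (orderOf_dvd_of_pow_eq_one h)
      rw [hl] at h5
      have := Nat.pos_of_ne_zero hl0
      have := hp.two_le
      nlinarith
    have hui : u⁻¹ = u := inv_eq_of_mul_eq_one_left huu
    have hvi : v⁻¹ = v := inv_eq_of_mul_eq_one_left hvv
    -- `a` inverts `q`
    have hinv : (w⁻¹ * φ a * w) * q * (w⁻¹ * φ a * w)⁻¹ = q⁻¹ := by
      obtain ⟨i, hi | hi⟩ := dihedral_elts huu hvv (fix_inl _ _ ht)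
      · have h1 := congrArg χ hi
        rw [hom_conj, hχa, map_zpow, hχq, one_zpow] at h1
        exact absurd h1 (by decide)
      · rw [hi]
        have h1 : u * (u * v) * u⁻¹ = (u * v)⁻¹ := by
          rw [mul_inv_rev, hui, hvi, ← mul_assoc, huu, one_mul]
        have h2 : u * q * u⁻¹ = q⁻¹ := by
          simp only [q]; rw [← conj_pow, h1, inv_pow]
        have h3 : (u * v) ^ i * q * ((u * v) ^ i)⁻¹ = q := by
          simp only [q]
          rw [((Commute.refl (u * v)).zpow_left i |>.pow_right l).eq, mul_inv_cancel_right]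
        calc u * (u * v) ^ i * q * (u * (u * v) ^ i)⁻¹
            = u * ((u * v) ^ i * q * ((u * v) ^ i)⁻¹) * u⁻¹ := by group
          _ = _ := by rw [h3, h2]
    let ρ := φ.symm (w * q * w⁻¹)
    have hφρ : φ ρ = w * q * w⁻¹ := by simp [ρ]
    have hρ1 : ρ ≠ 1 := by
      intro h
      rw [h, map_one] at hφρ
      apply hq1
      have : q = w⁻¹ * (w * q * w⁻¹) * w := by group
      rw [this, ← hφρ]; group
    have hρp : ρ ^ p = 1 := by
      apply φ.injective
      rw [map_pow, hφρ, conj_pow, hqp, map_one]; group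
    have hρinv : ρ * a = a * ρ⁻¹ := by
      apply φ.injective
      rw [map_mul, map_mul, map_inv, hφρ]
      have haφ : φ a * φ a = 1 := by rw [← map_mul, haa, map_one]
      have h4 : φ a * (w * q * w⁻¹) * (φ a)⁻¹ = (w * q * w⁻¹)⁻¹ := by
        calc φ a * (w * q * w⁻¹) * (φ a)⁻¹
            = w * ((w⁻¹ * φ a * w) * q * (w⁻¹ * φ a * w)⁻¹) * w⁻¹ := by group
          _ = _ := by rw [hinv]; group
      rw [← h4, ← mul_assoc, ← mul_assoc, haφ, one_mul, inv_eq_of_mul_eq_one_left haφ]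
    obtain ⟨t', ht', htu'⟩ := free_fix hS {a} hfree (by simpa using haS) p hp ρ hρp hρ1
    have hat : a • t' = t' := by
      apply htu'
      rw [← mul_smul, hρinv, mul_smul, inv_smul_eq_iff.2 ht'.symm]
    rcases t' with t' | t'
    · obtain ⟨g, rfl⟩ := QuotientGroup.mk_surjective t'
      have h1 := fix_inl _ _ ht'
      rw [Subgroup.mem_closure_singleton] at h1
      obtain ⟨n, hn⟩ := h1
      have h2 : (g⁻¹ * ρ * g) ^ 2 = 1 := by
        rw [← hn, ← zpow_natCast, ← zpow_mul, mul_comm, zpow_mul, zpow_natCast, pow_two, haa,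
          one_zpow]
      have h3 : (g⁻¹ * ρ * g) ^ p = 1 := by
        have := conj_pow (a := g⁻¹) (b := ρ) (i := p)
        rw [inv_inv] at this
        rw [this, hρp]; group
      obtain ⟨k, hk⟩ := hpodd
      rw [hk, pow_succ, pow_mul, h2, one_pow, one_mul] at h3
      apply hρ1
      have : ρ = g * (g⁻¹ * ρ * g) * g⁻¹ := by group
      rw [this, h3]; group
    · obtain ⟨g, rfl⟩ := QuotientGroup.mk_surjective t'
      have h1 := fix_inr _ _ hat
      obtain ⟨χ', hχ'⟩ := chi_exists hS hc haS
      have h2 : χ' a = 1 := by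
        rw [← hom_conj χ' g]
        apply hom_trivial χ' _ h1
        intro b hb
        apply (hχ' b hb.1).2
        intro h
        have := h.2
        rw [hfree a rfl b hb.1 hb.2] at this
        exact absurd this (by decide)
      rw [(hχ' a haS).1 (self_mem_cl hS haS)] at h2
      exact absurd h2 (by decide)

lemma key_lemma {W W' : Type} [Group W] [Group W'] {S : Set W} {S' : Set W'}
    (hS : CoxD S) (hS' : CoxD S') (hc : Conds S) (hc' : Conds S') (φ : W ≃* W') {T : Set W}
    (hT : IsIndep T) (hTS : T ⊆ Sbar S) : ∃ T' : Set W', IsIndep T' ∧ T' ⊆ Sbar S' ∧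
      Subgroup.map ((Abelianization.of).comp φ.toMonoidHom) (Subgroup.closure T) ≤
        Subgroup.map Abelianization.of (Subgroup.closure T') := by
  refine ⟨{x | x ∈ Sbar S' ∧ ∃ χ, IsChi S' x χ ∧ ∃ a ∈ T, χ (φ a) = -1}, ?_, fun x hx => hx.1, ?_⟩
  · rintro x ⟨hx, χ₁, h₁, a, ha, hχa⟩ y ⟨hy, χ₂, h₂, b, hb, hχb⟩ hxy
    by_contra h2
    have haa := hS.inv a (sbar_sub (hTS ha))
    have hbb := hS.inv b (sbar_sub (hTS hb))
    have hcomm : a * b = b * a := by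
      by_cases hab : a = b
      · rw [hab]
      · have h := pow_orderOf_eq_one (a * b)
        rw [hT a ha b hb hab, pow_two] at h
        have h3 := inv_eq_of_mul_eq_one_left h
        rw [mul_inv_rev, inv_eq_of_mul_eq_one_left haa, inv_eq_of_mul_eq_one_left hbb] at h3
        exact h3.symm
    refine dihedral_key hS' hc' hx hy hxy h2 h₁ h₂ (g := φ a) (h := φ b) ?_ ?_ ?_ hχa hχb
    · rw [← map_mul, haa, map_one]
    · rw [← map_mul, hbb, map_one]
    · rw [← map_mul, hcomm, map_mul]
  · rw [Subgroup.map_le_iff_le_comap, Subgroup.closure_le]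
    intro a ha
    rw [SetLike.mem_coe, Subgroup.mem_comap]
    refine span_ab hS' hc' (φ a) (Subgroup.map Abelianization.of (Subgroup.closure _)) ?_
    intro u hu χ hχ hχa
    by_cases hiso : ∀ x ∈ Cl S' u, x ∉ Sbar S'
    · exact (bad_case hS hS' hc hc' φ (hTS ha) hu hiso hχ hχa).elim
    · push Not at hiso
      obtain ⟨x, hxC, hx⟩ := hiso
      rw [ab_eq hS' hu hxC.1 hxC.2]
      apply Subgroup.mem_map_of_mem
      apply Subgroup.subset_closure
      refine ⟨hx, χ, ?_, a, ha, hχa⟩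
      unfold IsChi
      rw [cl_eq hS' hc' hu hxC]
      exact hχ

lemma inj_lemma {W : Type} [Group W] {S : Set W} (hS : CoxD S) (hc : Conds S) {T₁ T₂ : Set W}
    (h₁ : T₁ ⊆ Sbar S) (h₂ : T₂ ⊆ Sbar S)
    (h : Subgroup.map Abelianization.of (Subgroup.closure T₁) ≤
      Subgroup.map Abelianization.of (Subgroup.closure T₂)) : T₁ ⊆ T₂ := by
  intro x hx
  by_contra hn
  have hxS := sbar_sub (h₁ hx)
  obtain ⟨χ, hχ⟩ := chi_exists hS hc hxS
  obtain ⟨g, hg, hgx⟩ := h (Subgroup.mem_map_of_mem _ (Subgroup.subset_closure hx))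
  have h3 : χ g = 1 := by
    apply hom_trivial χ _ hg
    intro b hb
    apply (hχ b (sbar_sub (h₂ hb))).2
    intro hbC
    exact sbar_even hc (h₁ hx) (h₂ hb) (fun h => hn (h ▸ hb)) hbC.2
  have h4 := congrArg (Abelianization.lift χ) hgx
  rw [Abelianization.lift_apply_of, Abelianization.lift_apply_of, h3,
    (hχ x hxS).1 (self_mem_cl hS hxS)] at h4
  exact absurd h4 (by decide)

lemma transfer {W W' : Type} [Group W] [Group W'] (φ : W ≃* W') {K : Subgroup W} {K' : Subgroup W'}
    (h : Subgroup.map ((Abelianization.of).comp φ.toMonoidHom) K ≤ Subgroup.map Abelianization.of K') :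
    Subgroup.map Abelianization.of K ≤
      Subgroup.map ((Abelianization.of).comp φ.symm.toMonoidHom) K' := by
  have h1 := Subgroup.map_mono (f := Abelianization.map φ.symm.toMonoidHom) h
  rw [Subgroup.map_map, Subgroup.map_map] at h1
  convert h1 using 2
  · ext x
    simp
  · ext x
    simp

lemma transfer' {W W' : Type} [Group W] [Group W'] (φ : W ≃* W') {K : Subgroup W} {K' : Subgroup W'}
    (h : Subgroup.map ((Abelianization.of).comp φ.symm.toMonoidHom) K' ≤
      Subgroup.map Abelianization.of K) :
    Subgroup.map Abelianization.of K' ≤ Subgroup.map ((Abelianization.of).comp φ.toMonoidHom) K :=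
  transfer φ.symm h

/-- Maximal independent subsets of `S̄` correspond uniquely under `τ`. -/
theorem max_indep_correspond {W W' : Type} [Group W] [Group W'] (S : Set W) (S' : Set W')
    (hS : IsCoxGenSet S) (hS' : IsCoxGenSet S') (hc : Conds S) (hc' : Conds S')
    (φ : W ≃* W') (T : Set W) (hT : IsMaxIndep (Sbar S) T) :
    ∃! T' : Set W', IsMaxIndep (Sbar S') T' ∧ Tau φ.toMonoidHom T T' := by
  have cS := hS.coxD
  have cS' := hS'.coxD
  obtain ⟨hTi, hTs, hTm⟩ := hT
  obtain ⟨T', hT'i, hT's, hle⟩ := key_lemma cS cS' hc hc' φ hTi hTs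
  -- anything above `T'` goes back into `T`
  have back : ∀ U : Set W', IsIndep U → U ⊆ Sbar S' → T' ⊆ U →
      Subgroup.map Abelianization.of (Subgroup.closure U) ≤
        Subgroup.map ((Abelianization.of).comp φ.toMonoidHom) (Subgroup.closure T) := by
    intro U hUi hUs hTU
    obtain ⟨T₁, hT₁i, hT₁s, hle₁⟩ := key_lemma cS' cS hc' hc φ.symm hUi hUs
    have h1 : T ⊆ T₁ := by
      apply inj_lemma cS hc hTs hT₁s
      exact (transfer φ hle).trans
        ((Subgroup.map_mono (Subgroup.closure_mono hTU)).trans hle₁)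
    have h2 := hTm T₁ hT₁i hT₁s h1
    rw [h2] at hle₁
    exact transfer' φ hle₁
  refine ⟨T', ⟨⟨hT'i, hT's, ?_⟩, ?_⟩, ?_⟩
  · intro U hUi hUs hTU
    exact Set.Subset.antisymm (inj_lemma cS' hc' hUs hT's ((back U hUi hUs hTU).trans hle)) hTU
  · exact le_antisymm hle (back T' hT'i hT's subset_rfl)
  · rintro T'' ⟨⟨_, hs, _⟩, htau⟩
    have htau' : Subgroup.map ((Abelianization.of).comp φ.toMonoidHom) (Subgroup.closure T) =
      Subgroup.map Abelianization.of (Subgroup.closure T'') := htau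
    apply Set.Subset.antisymm
    · exact inj_lemma cS' hc' hs hT's (htau' ▸ hle)
    · exact inj_lemma cS' hc' hT's hs (htau' ▸ back T' hT'i hT's subset_rfl)
end
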